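/- Let s_m = (m,m,…,m) (t entries) and ε_m = {0,1,…,t−1}; the type of s_m is (m(p−1),…,m(p−1)), so J(s_m) = {0,…,t−1} and (s_m,ε_m) ∈ S. Then the k-span in k[P] of the characteristic functions χ_W, as W ranges over all totally isotropic m-dimensional subspaces of V, is the internal direct sum of k·1 (the constant functions on P) and Ŷ(s_m,ε_m), where Ŷ(s_m,ε_m) denotes the k-span in k[P] of the induced functions f̂, as f ranges over all symplectic basis functions whose signed H-type (s',ε') lies in S and satisfies (s',ε') ≤ (s_m,ε_m). -/

import Mathlib

open scoped Classical

noncomputable section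

/-- The `2m`-dimensional standard symplectic space over `k = F_q = GaloisField p t`:
pairs `(x,y)` of `m`-tuples; the coordinates are `x_i(v) = v.1 i`, `y_i(v) = v.2 i`. -/
abbrev SympV (p t m : ℕ) [Fact p.Prime] : Type :=
  (Fin m → GaloisField p t) × (Fin m → GaloisField p t)

/-- The nonsingular alternating bilinear form
`⟨(x,y),(x',y')⟩ = Σ_i (x_i y'_i − y_i x'_i)`. -/
def sform {p t m : ℕ} [Fact p.Prime] (v w : SympV p t m) : GaloisField p t :=
  ∑ i, (v.1 i * w.2 i - v.2 i * w.1 i)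

/-- Membership in the symplectic group `Sp(V)`: a linear automorphism of `V`
preserving the form. -/
def IsSymp {p t m : ℕ} [Fact p.Prime]
    (g : SympV p t m ≃ₗ[GaloisField p t] SympV p t m) : Prop :=
  ∀ v w, sform (g v) (g w) = sform v w

/-- A `k`-subspace `M` of `k[V]` is `Sp(V)`-stable (a `kSp(V)`-submodule) if it is
closed under the action `(g·f)(v) = f(g⁻¹v)`. -/
def SpStable {p t m : ℕ} [Fact p.Prime]
    (M : Submodule (GaloisField p t) (SympV p t m → GaloisField p t)) : Prop :=
  ∀ g : SympV p t m ≃ₗ[GaloisField p t] SympV p t m, IsSymp g →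
    ∀ h ∈ M, (fun v => h (g.symm v)) ∈ M

/-- The monomial `x^α y^β = ∏_i x_i^{α_i} y_i^{β_i}` as a function `V → k`. -/
def mono {p t m : ℕ} [Fact p.Prime] (α β : Fin m → ℕ) :
    SympV p t m → GaloisField p t :=
  fun v => ∏ i, (v.1 i ^ α i * v.2 i ^ β i)

/-- The complementary multi-index `ᾱ = (p−1−α₁,…,p−1−α_m)`. -/
def abar (p : ℕ) {m : ℕ} (α : Fin m → ℕ) : Fin m → ℕ := fun i => p - 1 - α i

/-- `α! = ∏_i α_i!`, computed in the prime field `F_p ⊆ k`. -/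
def factk (p t : ℕ) [Fact p.Prime] {m : ℕ} (α : Fin m → ℕ) : GaloisField p t :=
  ∏ i, ((α i).factorial : GaloisField p t)

/-- Allowable `j`-th digit of a symplectic basis function, of degree `lam`;
`pl` records whether this digit counts towards the signature (a monomial
`x^α y^{ᾱ}` or a '+' binomial when `lam = m(p−1)`). -/
def IsDigit (p t m lam : ℕ) [Fact p.Prime] (pl : Prop)
    (g : SympV p t m → GaloisField p t) : Prop :=
  (lam ≠ m * (p - 1) ∧ ¬pl ∧
    ∃ α β : Fin m → ℕ, (∀ i, α i ≤ p - 1) ∧ (∀ i, β i ≤ p - 1) ∧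
      (∑ i, α i) + (∑ i, β i) = lam ∧ g = mono α β) ∨
  (lam = m * (p - 1) ∧ pl ∧
    ∃ α : Fin m → ℕ, (∀ i, α i ≤ p - 1) ∧ g = mono α (abar p α)) ∨
  (lam = m * (p - 1) ∧
    ∃ α β : Fin m → ℕ, (∀ i, α i ≤ p - 1) ∧ (∀ i, β i ≤ p - 1) ∧
      (∑ i, α i) + (∑ i, β i) = m * (p - 1) ∧ β ≠ abar p α ∧
      g = mono α β +
        ((if pl then (1 : GaloisField p t) else -1) *
          ((-1) ^ ((∑ i, β i) + m) * factk p t α * factk p t β)) •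
            mono (abar p β) (abar p α))

/-- `f` is a symplectic basis function of type `λ` with signature `ε`:
`f = f₀·f₁^p⋯f_{t−1}^{p^{t−1}}` with every digit `f_j` allowable of degree `λ_j`,
and `ε` is the set of digits of '+' kind. -/
def IsSBF (p t m : ℕ) [Fact p.Prime] (lam : Fin t → ℕ) (eps : Finset (Fin t))
    (f : SympV p t m → GaloisField p t) : Prop :=
  ∃ g : Fin t → (SympV p t m → GaloisField p t),
    (∀ j, IsDigit p t m (lam j) (j ∈ eps) (g j)) ∧
    f = fun v => ∏ j, (g j v) ^ (p ^ (j : ℕ))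

/-- The `j`-th `p`-adic digit of `d`. -/
def digitp (p d j : ℕ) : ℕ := d / p ^ j % p

/-- The type `λ` attached to a tuple `s` (for `d`): `λ_j = p·s_{j+1} − s_j + d_j`,
indices mod `t`. -/
def lamOf (p t d : ℕ) [NeZero t] (s : Fin t → ℤ) (j : Fin t) : ℤ :=
  (p : ℤ) * s (j + 1) - s j + digitp p d (j : ℕ)

/-- The type of `s` as a tuple of naturals. -/
def lamOfN (p t d : ℕ) [NeZero t] (s : Fin t → ℤ) (j : Fin t) : ℕ :=
  (lamOf p t d s j).toNat

/-- Membership in `H[d]`: `0 ≤ s_j ≤ 2m−1` and `0 ≤ λ_j ≤ 2m(p−1)` for all `j`. -/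
def memHd (p t m d : ℕ) [NeZero t] (s : Fin t → ℤ) : Prop :=
  (∀ j, 0 ≤ s j ∧ s j ≤ 2 * m - 1) ∧
  (∀ j, 0 ≤ lamOf p t d s j ∧ lamOf p t d s j ≤ 2 * m * ((p : ℤ) - 1))

/-- Membership in `H`: `1 ≤ s_j ≤ 2m−1` and `0 ≤ p·s_{j+1} − s_j ≤ 2m(p−1)`. -/
def memH (p t m : ℕ) [NeZero t] (s : Fin t → ℤ) : Prop :=
  (∀ j, 1 ≤ s j ∧ s j ≤ 2 * m - 1) ∧
  (∀ j, 0 ≤ lamOf p t 0 s j ∧ lamOf p t 0 s j ≤ 2 * m * ((p : ℤ) - 1))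

/-- `J(s) = {j : λ_j = m(p−1)}`. -/
def Jset (p t m d : ℕ) [NeZero t] (s : Fin t → ℤ) : Finset (Fin t) :=
  Finset.univ.filter (fun j => lamOf p t d s j = m * ((p : ℤ) - 1))

/-- Membership in `S[d]`: `s ∈ H[d]` and `ε ⊆ J(s)`. -/
def memSd (p t m d : ℕ) [NeZero t] (s : Fin t → ℤ) (eps : Finset (Fin t)) : Prop :=
  memHd p t m d s ∧ eps ⊆ Jset p t m d s

/-- Membership in `S`: `s ∈ H` and `ε ⊆ J(s)` (with `d = 0`). -/
def memS (p t m : ℕ) [NeZero t] (s : Fin t → ℤ) (eps : Finset (Fin t)) : Prop :=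
  memH p t m s ∧ eps ⊆ Jset p t m 0 s

/-- Case distinction: for `d ≠ 0` the relevant poset is `S[d]`, for `d = 0` it is `S`. -/
def memCase (p t m d : ℕ) [NeZero t] (s : Fin t → ℤ) (eps : Finset (Fin t)) : Prop :=
  if d = 0 then memS p t m s eps else memSd p t m d s eps

/-- `Z(s',s) = {j : s'_j = s_j, s'_{j+1} = s_{j+1}, λ'_j = m(p−1)}`. -/
def Zset (p t m d : ℕ) [NeZero t] (s' s : Fin t → ℤ) : Finset (Fin t) :=
  Finset.univ.filter (fun j =>
    s' j = s j ∧ s' (j + 1) = s (j + 1) ∧ lamOf p t d s' j = m * ((p : ℤ) - 1))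

/-- The order on `S[d]` (and on `S`): `(s',ε') ≤ (s,ε)` iff `s' ≤ s` pointwise and
`ε ∩ Z(s',s) = ε' ∩ Z(s',s)`. -/
def leSd (p t m d : ℕ) [NeZero t] (s' : Fin t → ℤ) (eps' : Finset (Fin t))
    (s : Fin t → ℤ) (eps : Finset (Fin t)) : Prop :=
  (∀ j, s' j ≤ s j) ∧ eps ∩ Zset p t m d s' s = eps' ∩ Zset p t m d s' s

/-- `Y(s,ε)[d]` (for `d ≠ 0`), resp. `Y(s,ε)` (for `d = 0`): the span in `k[V]` of all
symplectic basis functions with signed `H`-type `(s',ε') ≤ (s,ε)` in `S[d]`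
(resp. in `S`). -/
def Ymod (p t m d : ℕ) [Fact p.Prime] [NeZero t] (s : Fin t → ℤ)
    (eps : Finset (Fin t)) :
    Submodule (GaloisField p t) (SympV p t m → GaloisField p t) :=
  Submodule.span (GaloisField p t)
    {f | ∃ s' eps', memCase p t m d s' eps' ∧ leSd p t m d s' eps' s eps ∧
      IsSBF p t m (lamOfN p t d s') eps' f}

/-- `Y_<(s,ε)[d]`: the span of the symplectic basis functions with signed `H`-type
strictly below `(s,ε)`. -/
def Yltmod (p t m d : ℕ) [Fact p.Prime] [NeZero t] (s : Fin t → ℤ)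
    (eps : Finset (Fin t)) :
    Submodule (GaloisField p t) (SympV p t m → GaloisField p t) :=
  Submodule.span (GaloisField p t)
    {f | ∃ s' eps', memCase p t m d s' eps' ∧ leSd p t m d s' eps' s eps ∧
      ¬(s' = s ∧ eps' = eps) ∧ IsSBF p t m (lamOfN p t d s') eps' f}

instance {p t m : ℕ} [Fact p.Prime] :
    Finite (Submodule (GaloisField p t) (SympV p t m)) :=
  Finite.of_injective (fun W => (W : Set (SympV p t m))) SetLike.coe_injective

/-- A subspace is totally isotropic if the form vanishes identically on it. -/
def IsTotIso {p t m : ℕ} [Fact p.Prime]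
    (W : Submodule (GaloisField p t) (SympV p t m)) : Prop :=
  ∀ u ∈ W, ∀ w ∈ W, sform u w = 0

/-- `P`: the set of points (1-dimensional subspaces) of `V`. -/
abbrev Pts (p t m : ℕ) [Fact p.Prime] : Type :=
  {Z : Submodule (GaloisField p t) (SympV p t m) //
    Module.finrank (GaloisField p t) Z = 1}

/-- The characteristic function `χ_W ∈ k[P]` of a subspace `W ⊆ V`. -/
def chi {p t m : ℕ} [Fact p.Prime]
    (W : Submodule (GaloisField p t) (SympV p t m)) :
    Pts p t m → GaloisField p t :=
  fun Z => if Z.val ≤ W then 1 else 0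

/-- `Ŷ(s_m,ε_m)` for `s_m = (m,…,m)`, `ε_m = {0,…,t−1}`: the span in `k[P]` of the
functions induced on `P` by the symplectic basis functions of signed `H`-type
`(s',ε') ∈ S` with `(s',ε') ≤ (s_m,ε_m)`. -/
def YhatSm (p t m : ℕ) [Fact p.Prime] [NeZero t] :
    Submodule (GaloisField p t) (Pts p t m → GaloisField p t) :=
  Submodule.span (GaloisField p t)
    {F | ∃ (s' : Fin t → ℤ) (eps' : Finset (Fin t))
          (f : SympV p t m → GaloisField p t),
        memS p t m s' eps' ∧
        leSd p t m 0 s' eps' (fun _ => (m : ℤ)) Finset.univ ∧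
        IsSBF p t m (lamOfN p t 0 s') eps' f ∧
        ∀ Z : Pts p t m, ∀ v ∈ Z.val, v ≠ 0 → F Z = f v}

namespace SP
open MvPolynomial

abbrev Sg (m : ℕ) : Type := Fin m ⊕ Fin m

section taudef
variable {K : Type*} [Field K] (p : ℕ) {m : ℕ}

/-- Reduced exponents. -/
def Rd (e : Sg m →₀ ℕ) : Prop := ∀ z, e z ≤ p - 1

/-- The ideal of `p`-th powers of the variables. -/
def Ov (K : Type*) [Field K] (p m : ℕ) : Ideal (MvPolynomial (Sg m) K) :=
  Ideal.span (Set.range fun z => (X z : MvPolynomial (Sg m) K) ^ p)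

theorem mem_Ov [hp : Fact p.Prime] {f : MvPolynomial (Sg m) K} :
    f ∈ Ov K p m ↔ ∀ e ∈ f.support, ¬ Rd p e := by
  have h : (Set.range fun z => (X z : MvPolynomial (Sg m) K) ^ p) =
      Set.image (fun s => monomial s (1 : K)) (Set.range fun z : Sg m => Finsupp.single z p) := by
    rw [← Set.range_comp]
    congr 1
    ext1 z
    simp [X_pow_eq_monomial]
  rw [Ov, h, mem_ideal_span_monomial_image]
  refine forall₂_congr fun e _ => ?_
  have := hp.out.pos
  simp only [Set.mem_range, exists_exists_eq_and, Rd, not_forall, not_le]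
  refine exists_congr fun z => ?_
  rw [Finsupp.single_le_iff]
  omega

theorem monomial_mem_Ov [hp : Fact p.Prime] {e : Sg m →₀ ℕ} (h : ¬ Rd p e) (c : K) :
    monomial e c ∈ Ov K p m := by
  rw [mem_Ov]
  intro e' he'
  have := support_monomial_subset he'
  simp at this
  rwa [this]

def bar (e : Sg m →₀ ℕ) : Sg m →₀ ℕ :=
  Finsupp.equivFunOnFinite.symm (fun z => p - 1 - e z.swap)

@[simp] theorem bar_apply (e : Sg m →₀ ℕ) (z : Sg m) : bar p e z = p - 1 - e z.swap := rfl

def sgn (K : Type*) [Field K] (e : Sg m →₀ ℕ) : K :=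
  (-1) ^ ((∑ i, e (Sum.inr i)) + m) * ∏ z, ((e z).factorial : K)

def tau : MvPolynomial (Sg m) K →ₗ[K] MvPolynomial (Sg m) K :=
  (basisMonomials (Sg m) K).constr K
    (fun e => if Rd p e then monomial (bar p e) (sgn K e) else 0)

theorem tau_monomial (e : Sg m →₀ ℕ) (c : K) :
    tau p (monomial e c) = if Rd p e then monomial (bar p e) (c * sgn K e) else 0 := by
  have h1 : (monomial e c : MvPolynomial (Sg m) K) = c • basisMonomials (Sg m) K e := by
    simp [smul_monomial]
  rw [h1, map_smul, tau, Module.Basis.constr_basis]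
  split_ifs <;> simp [smul_monomial]

theorem tau_of_mem_Ov [hp : Fact p.Prime] {f : MvPolynomial (Sg m) K} (hf : f ∈ Ov K p m) :
    tau p f = 0 := by
  rw [mem_Ov] at hf
  rw [f.as_sum, map_sum]
  refine Finset.sum_eq_zero fun e he => ?_
  rw [tau_monomial, if_neg (hf e he)]

theorem Rd_bar (e : Sg m →₀ ℕ) : Rd p (bar p e) := fun z => by simp

theorem bar_bar {e : Sg m →₀ ℕ} (h : Rd p e) : bar p (bar p e) = e := by
  ext z
  have := h z
  simp
  omega

/-- `D_z = Σ_w J z w ∂_w`. -/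
def Dz : Sg m → MvPolynomial (Sg m) K → MvPolynomial (Sg m) K
  | Sum.inl i => fun f => - pderiv (Sum.inr i) f
  | Sum.inr i => fun f => pderiv (Sum.inl i) f

theorem fact_wilson [hp : Fact p.Prime] [CharP K p] (a : ℕ) (ha : a ≤ p - 1) :
    ((a.factorial : K)) * ((p - 1 - a).factorial : K) = (-1) ^ (a + 1) := by
  have hp1 := hp.out.one_lt
  induction a with
  | zero =>
    have := ZMod.wilsons_lemma p
    have h2 : (((p - 1).factorial : ℤ) : K) = ((-1 : ℤ) : K) := by
      rw [CharP.intCast_eq_intCast K p]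
      rw [← ZMod.intCast_eq_intCast_iff]
      simpa using this
    simpa using h2
  | succ a ih =>
    have ih := ih (by omega)
    have e1 : p - 1 - a = (p - 1 - (a + 1)) + 1 := by omega
    rw [e1, Nat.factorial_succ] at ih
    have e2 : ((p - 1 - (a + 1) + 1 : ℕ) : K) = - ((a + 1 : ℕ) : K) := by
      have : (p - 1 - (a + 1) + 1) + (a + 1) = p := by omega
      have h3 : (((p - 1 - (a + 1) + 1) + (a + 1) : ℕ) : K) = 0 := by rw [this]; simp
      rw [Nat.cast_add] at h3
      exact eq_neg_of_add_eq_zero_left h3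
    rw [Nat.cast_mul, e2] at ih
    rw [Nat.factorial_succ, Nat.cast_mul, pow_succ, ← ih]
    ring

theorem tau_X_mul_monomial [hp : Fact p.Prime] [CharP K p] (z : Sg m) (e : Sg m →₀ ℕ) (c : K) :
    tau p (X z * monomial e c) = Dz z (tau p (monomial e c)) := by
  have hp1 := hp.out.one_lt
  have hX : (X z * monomial e c : MvPolynomial (Sg m) K) = monomial (e + Finsupp.single z 1) c := by
    rw [mul_comm, X, monomial_mul]; simp
  rw [hX, tau_monomial, tau_monomial]
  by_cases hr : Rd p e
  · rw [if_pos hr]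
    have hz := hr z
    have hprod : ∏ w, (((e + Finsupp.single z 1 : Sg m →₀ ℕ) w).factorial : K)
        = (e z + 1 : ℕ) * ∏ w, ((e w).factorial : K) := by
      rw [← Finset.mul_prod_erase _ _ (Finset.mem_univ z),
        ← Finset.mul_prod_erase (Finset.univ) (fun w => ((e w).factorial : K)) (Finset.mem_univ z)]
      rw [← mul_assoc]
      congr 1
      · simp [Nat.factorial_succ]
      · refine Finset.prod_congr rfl fun w hw => ?_
        have : w ≠ z := (Finset.mem_erase.1 hw).1
        simp [Finsupp.single_apply, this.symm]
    have hcast : ((p - 1 - e z : ℕ) : K) = - ((e z + 1 : ℕ) : K) := by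
      have : (p - 1 - e z) + (e z + 1) = p := by omega
      have h3 : (((p - 1 - e z) + (e z + 1) : ℕ) : K) = 0 := by rw [this]; simp
      rw [Nat.cast_add] at h3
      exact eq_neg_of_add_eq_zero_left h3
    have hD : Dz z (monomial (bar p e) (c * sgn K e))
        = monomial (bar p e - Finsupp.single z.swap 1) (c * sgn K (e + Finsupp.single z 1)) := by
      rcases z with i | i
      · simp only [Dz, Sum.swap_inl]
        rw [pderiv_monomial, ← map_neg]
        congr 1
        rw [bar_apply, Sum.swap_inr, hcast, sgn, sgn, hprod]
        simp
        ring
      · simp only [Dz, Sum.swap_inr]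
        rw [pderiv_monomial]
        congr 1
        rw [bar_apply, Sum.swap_inl, hcast, sgn, sgn, hprod]
        have : ∑ j, (e + Finsupp.single (Sum.inr i) 1 : Sg m →₀ ℕ) (Sum.inr j)
            = (∑ j, e (Sum.inr j)) + 1 := by
          simp [Finset.sum_add_distrib, Finsupp.single_apply]
        rw [this]
        ring
    rw [hD]
    by_cases h2 : e z + 1 ≤ p - 1
    · rw [if_pos]
      · congr 2
        ext w
        simp only [bar_apply, Finsupp.coe_add, Pi.add_apply, Finsupp.coe_tsub, Pi.sub_apply,
          Finsupp.single_apply]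
        by_cases h : z = w.swap
        · have : z.swap = w := by rw [h]; simp
          rw [if_pos h, if_pos this]; omega
        · have : z.swap ≠ w := fun h' => h (by rw [← h']; simp)
          rw [if_neg h, if_neg this]; omega
      · intro w
        have := hr w
        by_cases h : z = w
        · subst h; simpa using h2
        · simpa [Finsupp.single_apply, h] using this
    · rw [if_neg]
      · have : (e z + 1 : ℕ) = p := by omega
        rw [sgn, hprod, this]
        simp
      · intro h
        apply h2
        have := h z
        simpa using this
  · rw [if_neg hr, if_neg]
    · rcases z with i | i <;> simp [Dz]
    · intro h
      apply hr
      intro w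
      have := h w
      simp at this
      omega

theorem Dz_add (z : Sg m) (f g : MvPolynomial (Sg m) K) : Dz z (f + g) = Dz z f + Dz z g := by
  rcases z with i | i <;> simp [Dz]; ring

theorem tau_X_mul [hp : Fact p.Prime] [CharP K p] (z : Sg m) (f : MvPolynomial (Sg m) K) :
    tau p (X z * f) = Dz z (tau p f) := by
  induction f using MvPolynomial.induction_on' with
  | monomial e c => exact tau_X_mul_monomial p z e c
  | add f g hf hg => rw [mul_add, map_add, map_add, hf, hg, Dz_add]

end taudef
end SP

namespace SP
open MvPolynomial

section subst
variable {K : Type*} [Field K] {m : ℕ}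

/-- linear substitution -/
def Ts (a : Matrix (Sg m) (Sg m) K) : MvPolynomial (Sg m) K →ₐ[K] MvPolynomial (Sg m) K :=
  aeval (fun z => ∑ w, C (a z w) * X w)

theorem Ts_X (a : Matrix (Sg m) (Sg m) K) (z : Sg m) :
    Ts a (X z) = ∑ w, C (a z w) * X w := by simp [Ts]

theorem eval_Ts (a : Matrix (Sg m) (Sg m) K) (v : Sg m → K) (f : MvPolynomial (Sg m) K) :
    eval v (Ts a f) = eval (a.mulVec v) f := by
  induction f using MvPolynomial.induction_on with
  | C c => simp [Ts]
  | add f g hf hg => simp [hf, hg]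
  | mul_X f z hf =>
    rw [map_mul, map_mul, hf, Ts_X, map_mul]
    simp [Matrix.mulVec, dotProduct]

theorem Ts_Ts (a b : Matrix (Sg m) (Sg m) K) (f : MvPolynomial (Sg m) K) :
    Ts a (Ts b f) = Ts (b * a) f := by
  induction f using MvPolynomial.induction_on with
  | C c => simp [Ts]
  | add f g hf hg => simp [hf, hg]
  | mul_X f z hf =>
    rw [map_mul, map_mul, map_mul, hf, Ts_X, Ts_X]
    congr 1
    simp only [map_sum, map_mul, Ts_X, Matrix.mul_apply, Finset.mul_sum, Finset.sum_mul]
    rw [Finset.sum_comm]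
    refine Finset.sum_congr rfl fun w _ => Finset.sum_congr rfl fun u _ => ?_
    simp [Ts, mul_assoc]

theorem Ts_one (f : MvPolynomial (Sg m) K) : Ts 1 f = f := by
  induction f using MvPolynomial.induction_on with
  | C c => simp [Ts]
  | add f g hf hg => simp [hf, hg]
  | mul_X f z hf =>
    rw [map_mul, hf, Ts_X]
    congr 1
    simp [Matrix.one_apply, apply_ite (C : K → MvPolynomial (Sg m) K)]

theorem Ts_homog {a : Matrix (Sg m) (Sg m) K} {f : MvPolynomial (Sg m) K} {n : ℕ}
    (hf : f.IsHomogeneous n) : (Ts a f).IsHomogeneous n := by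
  have := IsHomogeneous.aeval hf (n := 1) (fun z => ∑ w, C (a z w) * X w) (fun z => by
    refine IsHomogeneous.sum _ _ _ fun w _ => ?_
    simpa using (isHomogeneous_C (Sg m) (a z w)).mul (isHomogeneous_X K w))
  simpa [Ts] using this

theorem pderiv_Ts (a : Matrix (Sg m) (Sg m) K) (w : Sg m) (f : MvPolynomial (Sg m) K) :
    pderiv w (Ts a f) = ∑ z, C (a z w) * Ts a (pderiv z f) := by
  induction f using MvPolynomial.induction_on with
  | C c => simp [Ts]
  | add f g hf hg => simp [hf, hg, mul_add, Finset.sum_add_distrib]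
  | mul_X f u hf =>
    rw [map_mul, Derivation.leibniz, hf, Ts_X]
    have h1 : pderiv w (∑ w, C (a u w) * X w : MvPolynomial (Sg m) K) = C (a u w) := by
      simp [Derivation.leibniz, pderiv_X, Pi.single_apply, -Fintype.sum_sum_type]
    rw [h1]
    simp only [Derivation.leibniz, map_add, smul_eq_mul, map_mul, Ts_X, mul_add,
      Finset.sum_add_distrib, pderiv_X, Pi.single_apply]
    congr 1
    · rw [Finset.sum_eq_single u]
      · simp [mul_comm]
      · intro b _ hb; simp [hb.symm]
      · simp
    · rw [Finset.mul_sum]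
      refine Finset.sum_congr rfl fun z _ => ?_
      ring

theorem Dz_eq (z : Sg m) (f : MvPolynomial (Sg m) K) :
    Dz z f = ∑ w, C (Matrix.J (Fin m) K z w) * pderiv w f := by
  rcases z with i | i
  · simp [Dz, Matrix.J, Fintype.sum_sum_type, Matrix.one_apply, apply_ite (C : K → MvPolynomial (Sg m) K)]
  · simp [Dz, Matrix.J, Fintype.sum_sum_type, Matrix.one_apply, apply_ite (C : K → MvPolynomial (Sg m) K)]

theorem Ts_Dz {a : Matrix (Sg m) (Sg m) K} (ha : a * Matrix.J (Fin m) K * a.transpose = Matrix.J (Fin m) K)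
    (z : Sg m) (f : MvPolynomial (Sg m) K) :
    Ts a (Dz z f) = ∑ w, C (a z w) * Dz w (Ts a f) := by
  have h1 : ∀ y, Matrix.J (Fin m) K z y = ∑ u, (∑ w, a z w * Matrix.J (Fin m) K w u) * a y u := by
    intro y
    conv_lhs => rw [← ha]
    simp [Matrix.mul_apply]
  rw [Dz_eq, map_sum]
  simp only [Dz_eq, pderiv_Ts, map_mul]
  have hC : ∀ c : K, Ts a (C c) = C c := fun c => by simp [Ts]
  simp only [hC, Finset.mul_sum, h1, map_sum, Finset.sum_mul, map_mul]
  rw [Finset.sum_comm]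
  rw [Finset.sum_congr rfl fun u _ => Finset.sum_comm]
  rw [Finset.sum_comm]
  refine Finset.sum_congr rfl fun w _ => Finset.sum_congr rfl fun u _ =>
    Finset.sum_congr rfl fun y _ => ?_
  ring

theorem pderiv_mem_Ov (p : ℕ) [CharP K p] {f : MvPolynomial (Sg m) K} (hf : f ∈ Ov K p m) (z : Sg m) :
    pderiv z f ∈ Ov K p m := by
  unfold Ov at hf
  induction hf using Submodule.span_induction with
  | mem x hx =>
    obtain ⟨w, rfl⟩ := hx
    simp [Derivation.leibniz_pow]
  | zero => simp
  | add x y _ _ hx hy => rw [map_add]; exact Ideal.add_mem _ hx hy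
  | smul c x hx0 hx =>
    rw [smul_eq_mul, Derivation.leibniz, smul_eq_mul, smul_eq_mul]
    exact Ideal.add_mem _ (Ideal.mul_mem_left _ _ hx) (Ideal.mul_mem_right _ _ hx0)

theorem Dz_mem_Ov (p : ℕ) [CharP K p] {f : MvPolynomial (Sg m) K} (hf : f ∈ Ov K p m) (z : Sg m) :
    Dz z f ∈ Ov K p m := by
  rw [Dz_eq]
  exact Ideal.sum_mem _ fun w _ => Ideal.mul_mem_left _ _ (pderiv_mem_Ov p hf w)

theorem Ts_mem_Ov (p : ℕ) [hp : Fact p.Prime] [CharP K p] {f : MvPolynomial (Sg m) K} (hf : f ∈ Ov K p m)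
    (a : Matrix (Sg m) (Sg m) K) : Ts a f ∈ Ov K p m := by
  unfold Ov at hf
  induction hf using Submodule.span_induction with
  | mem x hx =>
    obtain ⟨w, rfl⟩ := hx
    rw [map_pow, Ts_X, sum_pow_char]
    refine Ideal.sum_mem _ fun u _ => ?_
    rw [mul_pow]
    exact Ideal.mul_mem_left _ _ (Ideal.subset_span ⟨u, rfl⟩)
  | zero => simp
  | add x y _ _ hx hy => rw [map_add]; exact Ideal.add_mem _ hx hy
  | smul c x hx0 hx =>
    rw [smul_eq_mul, map_mul]
    exact Ideal.mul_mem_left _ _ hx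

/-- full exponent -/
def full (p m : ℕ) : Sg m →₀ ℕ := Finsupp.equivFunOnFinite.symm (fun _ => p - 1)

theorem homog_top (p : ℕ) [hp : Fact p.Prime] {f : MvPolynomial (Sg m) K}
    (hf : f.IsHomogeneous (full p m).degree) : f - monomial (full p m) (coeff (full p m) f) ∈ Ov K p m := by
  rw [mem_Ov]
  intro e he hr
  by_cases h : e = full p m
  · subst h
    simp at he
  · rw [mem_support_iff, coeff_sub, coeff_monomial, if_neg (Ne.symm h), sub_zero] at he
    have h1 : e.degree = (full p m).degree := by
      have := hf he
      rw [← this, Finsupp.degree_eq_weight_one]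
      rfl
    apply h
    have hle : ∀ z, e z ≤ full p m z := hr
    rw [Finsupp.degree_eq_sum, Finsupp.degree_eq_sum] at h1
    ext z
    exact (Finset.sum_eq_sum_iff_of_le (fun z _ => hle z)).1 h1 z (Finset.mem_univ z)

theorem pow_char_one (p : ℕ) [hp : Fact p.Prime] [CharP K p] {κ : K} (h : κ ^ p = 1) : κ = 1 := by
  have : (κ - 1) ^ p = 0 := by rw [sub_pow_char, h]; simp
  exact sub_eq_zero.1 (pow_eq_zero_iff hp.out.ne_zero |>.1 this)

theorem Ts_full (p : ℕ) [hp : Fact p.Prime] [CharP K p] {a : Matrix (Sg m) (Sg m) K} (ha : a ^ p = 1) :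
    Ts a (monomial (full p m) 1) - monomial (full p m) 1 ∈ Ov K p m := by
  obtain ⟨κ, hκ⟩ : ∃ κ : K, Ts a (monomial (full p m) 1) - κ • monomial (full p m) 1 ∈ Ov K p m := by
    refine ⟨coeff (full p m) (Ts a (monomial (full p m) 1)), ?_⟩
    have := homog_top p (Ts_homog (a := a) (isHomogeneous_monomial (1 : K) (d := full p m) rfl))
    simpa [smul_monomial] using this
  have hn : ∀ n, Ts (a ^ n) (monomial (full p m) 1) - κ ^ n • monomial (full p m) 1 ∈ Ov K p m := by
    intro n
    induction n with
    | zero => simp [Ts_one]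
    | succ n ih =>
      rw [pow_succ', ← Ts_Ts]
      have h1 := Ts_mem_Ov p hκ (a ^ n)
      rw [map_sub, map_smul] at h1
      have h2 := (Ov K p m).smul_of_tower_mem κ ih
      have := Ideal.add_mem _ h1 h2
      rw [smul_sub, smul_smul, ← pow_succ'] at this
      simpa using this
  have h := hn p
  rw [ha, Ts_one] at h
  have h3 : κ = 1 := by
    apply pow_char_one p
    by_contra hne
    rw [mem_Ov] at h
    refine h (full p m) ?_ (fun z => le_rfl)
    simp only [mem_support_iff, coeff_sub, coeff_smul, coeff_monomial]
    simpa [sub_eq_zero] using Ne.symm hne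
  rw [h3, one_smul] at hκ
  exact hκ

theorem tau_Ts (p : ℕ) [hp : Fact p.Prime] [CharP K p] {a : Matrix (Sg m) (Sg m) K}
    (hJ : a * Matrix.J (Fin m) K * a.transpose = Matrix.J (Fin m) K) (ha : a ^ p = 1)
    (f : MvPolynomial (Sg m) K) : tau p (Ts a f) - Ts a (tau p f) ∈ Ov K p m := by
  induction f using MvPolynomial.induction_on with
  | C c =>
    have h1 : Ts a (C c) = C c := by simp [Ts]
    have h2 : tau p (C c : MvPolynomial (Sg m) K) = (c * sgn K (0 : Sg m →₀ ℕ)) • monomial (full p m) 1 := by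
      rw [C_apply, tau_monomial, if_pos (show Rd p (0 : Sg m →₀ ℕ) from fun z => by simp), smul_monomial]
      have : bar p (0 : Sg m →₀ ℕ) = full p m := by ext z; simp [full]
      rw [this]; simp
    rw [h1, h2, map_smul, ← smul_sub, ← neg_sub, smul_neg]
    exact neg_mem ((Ov K p m).smul_of_tower_mem _ (Ts_full p ha))
  | add f g hf hg =>
    have := Ideal.add_mem _ hf hg
    simp only [map_add]
    convert this using 1
    ring
  | mul_X f z hf =>
    rw [mul_comm, map_mul, Ts_X, tau_X_mul, Ts_Dz hJ, Finset.sum_mul, map_sum,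
      ← Finset.sum_sub_distrib]
    refine Ideal.sum_mem _ fun w _ => ?_
    rw [mul_assoc, ← smul_eq_C_mul, map_smul, tau_X_mul, smul_eq_C_mul, ← mul_sub]
    refine Ideal.mul_mem_left _ _ ?_
    have h1 : Dz w (tau p (Ts a f)) = Dz w (tau p (Ts a f) - Ts a (tau p f)) + Dz w (Ts a (tau p f)) := by
      rw [← Dz_add]; simp
    rw [h1, add_sub_cancel_right]
    exact Dz_mem_Ov p hf w

end subst
end SP

namespace SP
open MvPolynomial

section good
variable {K : Type*} [Field K] {m : ℕ}

/-- matrices `1 + S J` with `S` symmetric and `S J S = 0` -/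
def Good (a : Matrix (Sg m) (Sg m) K) : Prop :=
  ∃ S : Matrix (Sg m) (Sg m) K, S.transpose = S ∧ S * Matrix.J (Fin m) K * S = 0 ∧
    a = 1 + S * Matrix.J (Fin m) K

theorem Good.symp {a : Matrix (Sg m) (Sg m) K} (h : Good a) :
    a * Matrix.J (Fin m) K * a.transpose = Matrix.J (Fin m) K := by
  obtain ⟨S, hS, h0, rfl⟩ := h
  have hJ2 := Matrix.J_squared (l := Fin m) (R := K)
  rw [Matrix.transpose_add, Matrix.transpose_mul, hS, Matrix.J_transpose, Matrix.transpose_one]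
  set J := Matrix.J (Fin m) K
  have e1 : (1 + S * J) * J * (1 + -J * S) = J - (J * J) * S + S * (J * J) - (S * (J * J) * J) * S := by
    noncomm_ring
  rw [e1, hJ2]
  have e2 : J - -1 * S + S * -1 - S * -1 * J * S = J + S * J * S := by noncomm_ring
  rw [e2, h0, add_zero]

theorem Good.pow {a : Matrix (Sg m) (Sg m) K} (h : Good a) (p : ℕ) [CharP K p] : a ^ p = 1 := by
  obtain ⟨S, hS, h0, rfl⟩ := h
  set J := Matrix.J (Fin m) K
  have hn : ∀ n : ℕ, (1 + S * J) ^ n = 1 + (n : K) • (S * J) := by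
    intro n
    induction n with
    | zero => simp
    | succ n ih =>
      rw [pow_succ, ih]
      have : S * J * (S * J) = 0 := by rw [← mul_assoc, h0, zero_mul]
      rw [mul_add, mul_one, add_mul, one_mul, smul_mul_assoc, this, Nat.cast_succ, add_smul]
      simp [add_assoc]
  rw [hn]
  simp

end good

section phi
variable {K : Type*} [Field K] {p : ℕ} {t m : ℕ}

def Phi (p : ℕ) (G : Fin t → MvPolynomial (Sg m) K) : (Sg m → K) → K :=
  fun v => ∏ j, (eval v (G j)) ^ (p ^ (j : ℕ))

theorem Phi_update (G : Fin t → MvPolynomial (Sg m) K) (j : Fin t) (g : MvPolynomial (Sg m) K)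
    (v : Sg m → K) :
    Phi p (Function.update G j g) v =
      (eval v g) ^ (p ^ (j : ℕ)) * ∏ i ∈ Finset.univ.erase j, (eval v (G i)) ^ (p ^ (i : ℕ)) := by
  rw [Phi, ← Finset.mul_prod_erase _ _ (Finset.mem_univ j), Function.update_self]
  congr 1
  refine Finset.prod_congr rfl fun i hi => ?_
  rw [Function.update_of_ne (Finset.mem_erase.1 hi).1]

theorem Phi_update_mul (G : Fin t → MvPolynomial (Sg m) K) (j : Fin t) (g : MvPolynomial (Sg m) K)
    (v : Sg m → K) :
    Phi p (Function.update G j (g * G j)) v = (eval v g) ^ (p ^ (j : ℕ)) * Phi p G v := by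
  have h2 := Phi_update (p := p) G j (G j) v
  rw [Function.update_eq_self] at h2
  rw [Phi_update, h2, map_mul, mul_pow]
  ring

/-- digit preimage of a submodule -/
def comapD (N : Submodule K ((Sg m → K) → K)) (p : ℕ) [Fact p.Prime] [CharP K p]
    (G : Fin t → MvPolynomial (Sg m) K) (j : Fin t) :
    Submodule K (MvPolynomial (Sg m) K) where
  carrier := {g | Phi p (Function.update G j g) ∈ N}
  zero_mem' := by
    have : Phi p (Function.update G j 0) = 0 := by
      funext v
      rw [Phi_update]
      have : p ^ (j : ℕ) ≠ 0 := pow_ne_zero _ (Fact.out : p.Prime).ne_zero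
      rw [map_zero, zero_pow this, zero_mul, Pi.zero_apply]
    simp [this]
  add_mem' := by
    intro a b ha hb
    have : Phi p (Function.update G j (a + b)) = Phi p (Function.update G j a) + Phi p (Function.update G j b) := by
      funext v
      rw [Pi.add_apply, Phi_update, Phi_update, Phi_update, map_add, add_pow_char_pow, add_mul]
    simp only [Set.mem_ofPred_eq] at *
    rw [this]
    exact N.add_mem ha hb
  smul_mem' := by
    intro c a ha
    have : Phi p (Function.update G j (c • a)) = (c ^ p ^ (j : ℕ)) • Phi p (Function.update G j a) := by
      funext v
      rw [Pi.smul_apply, Phi_update, Phi_update, smul_eval, mul_pow, smul_eq_mul, mul_assoc]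
    simp only [Set.mem_ofPred_eq] at *
    rw [this]
    exact N.smul_mem _ ha

theorem mem_comapD [Fact p.Prime] [CharP K p] {N : Submodule K ((Sg m → K) → K)}
    {G : Fin t → MvPolynomial (Sg m) K} {j : Fin t} {g : MvPolynomial (Sg m) K} :
    g ∈ comapD N p G j ↔ Phi p (Function.update G j g) ∈ N := Iff.rfl

theorem ML [Fact p.Prime] [CharP K p] (N : Submodule K ((Sg m → K) → K))
    (A : Fin t → Submodule K (MvPolynomial (Sg m) K)) (B : Fin t → Set (MvPolynomial (Sg m) K))
    (hBA : ∀ j, B j ⊆ A j)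
    (hA : ∀ j, ∀ f ∈ A j, ∃ g ∈ Submodule.span K (B j), ∃ h ∈ A j, h ∈ Ov K p m ∧ f = g + h)
    (hO : ∀ G : Fin t → MvPolynomial (Sg m) K, (∀ j, G j ∈ A j) → ∀ j, G j ∈ Ov K p m → Phi p G ∈ N)
    (hB : ∀ G : Fin t → MvPolynomial (Sg m) K, (∀ j, G j ∈ B j) → Phi p G ∈ N)
    (G : Fin t → MvPolynomial (Sg m) K) (hG : ∀ j, G j ∈ A j) : Phi p G ∈ N := by
  have key : ∀ S : Finset (Fin t), ∀ G : Fin t → MvPolynomial (Sg m) K, (∀ j, G j ∈ A j) →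
      (∀ j ∉ S, G j ∈ B j) → Phi p G ∈ N := by
    intro S
    induction S using Finset.induction_on with
    | empty => exact fun G _ h => hB G (fun j => h j (by simp))
    | insert j S hj ih =>
      intro G hG h
      obtain ⟨g, hg, r, hrA, hrO, hf⟩ := hA j (G j) (hG j)
      have hupd : ∀ x ∈ A j, ∀ i, Function.update G j x i ∈ A i := by
        intro x hx i
        by_cases hi : i = j
        · subst hi; simpa using hx
        · rw [Function.update_of_ne hi]; exact hG i
      have h1 : Submodule.span K (B j) ≤ comapD N p G j := by
        rw [Submodule.span_le]
        intro b hb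
        refine ih _ (hupd b (hBA j hb)) ?_
        intro i hi
        by_cases hij : i = j
        · subst hij; simpa using hb
        · rw [Function.update_of_ne hij]; exact h i (by simp [hij, hi])
      have h2 : r ∈ comapD N p G j := hO _ (hupd r hrA) j (by simpa using hrO)
      have h3 : G j ∈ comapD N p G j := by rw [hf]; exact add_mem (h1 hg) h2
      rw [mem_comapD, Function.update_eq_self] at h3
      exact h3
  exact key Finset.univ G hG (by simp)

theorem Phi_Ts (G : Fin t → MvPolynomial (Sg m) K) (a : Matrix (Sg m) (Sg m) K) (v : Sg m → K) :
    Phi p G (a.mulVec v) = Phi p (fun j => Ts a (G j)) v := by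
  simp [Phi, eval_Ts]

end phi

section types
variable {K : Type*} [Field K] {p : ℕ} {t m : ℕ} [NeZero t]

def lam (p : ℕ) (s : Fin t → ℕ) (j : Fin t) : ℕ := p * s (j + 1) - s j

def Valid (p m : ℕ) (s : Fin t → ℕ) : Prop :=
  ∀ j, 1 ≤ s j ∧ s j ≤ m ∧ s j ≤ p * s (j + 1)

def ZZ (m : ℕ) (s : Fin t → ℕ) (j : Fin t) : Prop := s j = m ∧ s (j + 1) = m

def Ad (K : Type*) [Field K] (p m : ℕ) (s : Fin t → ℕ) (j : Fin t) :
    Submodule K (MvPolynomial (Sg m) K) where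
  carrier := {f | f.IsHomogeneous (lam p s j) ∧ (ZZ m s j → tau p f - f ∈ Ov K p m)}
  zero_mem' := ⟨isHomogeneous_zero _ _ _, fun _ => by simp⟩
  add_mem' := by
    rintro a b ⟨ha, ha'⟩ ⟨hb, hb'⟩
    refine ⟨ha.add hb, fun h => ?_⟩
    have := add_mem (ha' h) (hb' h)
    rw [map_add]
    convert this using 1
    ring
  smul_mem' := by
    rintro c a ⟨ha, ha'⟩
    refine ⟨(homogeneousSubmodule (Sg m) K _).smul_mem c ha, fun h => ?_⟩
    rw [map_smul, ← smul_sub]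
    exact (Ov K p m).smul_of_tower_mem c (ha' h)

theorem mem_Ad {s : Fin t → ℕ} {j : Fin t} {f : MvPolynomial (Sg m) K} :
    f ∈ Ad K p m s j ↔ f.IsHomogeneous (lam p s j) ∧ (ZZ m s j → tau p f - f ∈ Ov K p m) := Iff.rfl

def Yf (K : Type*) [Field K] (p t m : ℕ) [NeZero t] : Submodule K ((Sg m → K) → K) :=
  Submodule.span K {F | ∃ s : Fin t → ℕ, Valid p m s ∧
    ∃ G : Fin t → MvPolynomial (Sg m) K, (∀ j, G j ∈ Ad K p m s j) ∧ F = Phi p G}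

def Yl (K : Type*) [Field K] (p m : ℕ) (s : Fin t → ℕ) : Submodule K ((Sg m → K) → K) :=
  Submodule.span K {F | ∃ s' : Fin t → ℕ, Valid p m s' ∧ (∀ j, s' j ≤ s j) ∧ s' ≠ s ∧
    ∃ G : Fin t → MvPolynomial (Sg m) K, (∀ j, G j ∈ Ad K p m s' j) ∧ F = Phi p G}

theorem Yl_le_Yf (s : Fin t → ℕ) : Yl K p m s ≤ Yf K p t m := by
  apply Submodule.span_mono
  rintro F ⟨s', h1, _, _, G, h2, h3⟩
  exact ⟨s', h1, G, h2, h3⟩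

theorem Yf_stable [Fact p.Prime] [CharP K p] {a : Matrix (Sg m) (Sg m) K} (ha : Good a)
    {F : (Sg m → K) → K} (hF : F ∈ Yf K p t m) : (fun v => F (a.mulVec v)) ∈ Yf K p t m := by
  unfold Yf at hF
  induction hF using Submodule.span_induction with
  | mem x hx =>
    obtain ⟨s, hs, G, hG, rfl⟩ := hx
    refine Submodule.subset_span ⟨s, hs, fun j => Ts a (G j), fun j => ?_, ?_⟩
    · obtain ⟨h1, h2⟩ := hG j
      refine ⟨Ts_homog h1, fun hz => ?_⟩
      have e1 := tau_Ts p ha.symp (ha.pow p) (G j)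
      have e2 := Ts_mem_Ov p (h2 hz) a
      rw [map_sub] at e2
      convert add_mem e1 e2 using 1
      ring
    · funext v; rw [Phi_Ts]
  | zero => exact zero_mem _
  | add x y _ _ hx hy => exact add_mem hx hy
  | smul c x _ hx => exact Submodule.smul_mem _ c hx

theorem wrap_pow (hK : ∀ x : K, x ^ p ^ t = x) (j : Fin t) (x : K) :
    x ^ p ^ ((j + 1 : Fin t) : ℕ) = (x ^ p) ^ p ^ (j : ℕ) := by
  rw [← pow_mul, ← pow_succ']
  have hj := j.isLt
  rcases Nat.lt_or_ge ((j : ℕ) + 1) t with h | h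
  · have : ((j + 1 : Fin t) : ℕ) = (j : ℕ) + 1 := by
      rw [Fin.val_add_one_of_lt']
      exact h
    rw [this]
  · have h2 : (j : ℕ) + 1 = t := by omega
    have : ((j + 1 : Fin t) : ℕ) = 0 := by
      rw [Fin.val_add, Fin.val_one']
      simp [h2]
    rw [this, h2, hK]; simp

/-- overflow lemma for a single monomial -/
theorem overflow_mono [hp : Fact p.Prime] [CharP K p] (hK : ∀ x : K, x ^ p ^ t = x)
    {s : Fin t → ℕ} (hs : Valid p m s)
    (G : Fin t → MvPolynomial (Sg m) K) (j0 : Fin t) (hG : ∀ j, j ≠ j0 → G j ∈ Ad K p m s j)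
    (e : Sg m →₀ ℕ) (c : K) (he : e.degree = lam p s j0) (hr : ¬ Rd p e)
    (hj : G j0 = monomial e c) : Phi p G ∈ Yl K p m s := by
  have hp1 := hp.out.one_lt
  simp only [Rd, not_forall, not_le] at hr
  obtain ⟨z, hz⟩ := hr
  have hz' : p ≤ e z := by omega
  set e' : Sg m →₀ ℕ := e - Finsupp.single z p with he'
  have hee : e = e' + Finsupp.single z p := by
    ext w
    simp only [he', Finsupp.coe_add, Finsupp.coe_tsub, Pi.add_apply, Pi.sub_apply, Finsupp.single_apply]
    split_ifs with h
    · subst h; omega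
    · omega
  have hdeg : e'.degree + p = lam p s j0 := by
    rw [← he, hee]; simp
  have hs0 := hs j0
  have hs1 := hs (j0 + 1)
  have hlam : lam p s j0 + s j0 = p * s (j0 + 1) := by unfold lam; omega
  have hs2 : 2 ≤ s (j0 + 1) := by
    by_contra hcon
    have : s (j0 + 1) = 1 := by omega
    rw [this] at hlam
    omega
  set s' : Fin t → ℕ := Function.update s (j0 + 1) (s (j0 + 1) - 1) with hs'
  have s'a : ∀ j, s' j = s j - (if j = j0 + 1 then 1 else 0) := by
    intro j
    rw [hs']
    split_ifs with h
    · subst h; simp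
    · rw [Function.update_of_ne h]; simp
  have s'b : ∀ j, s' (j + 1) = s (j + 1) - (if j = j0 then 1 else 0) := by
    intro j; rw [s'a]; simp
  have hadd : ∀ j, lam p s j + s j = p * s (j + 1) := by
    intro j; have := hs j; unfold lam; omega
  have hp' : ∀ j, p * s' (j + 1) + (if j = j0 then p else 0) = p * s (j + 1) := by
    intro j
    rw [s'b]
    split_ifs with h
    · subst h
      have : 1 ≤ s (j + 1) := by omega
      rw [Nat.mul_sub, mul_one]
      have : p * 1 ≤ p * s (j + 1) := Nat.mul_le_mul_left _ this
      omega
    · simp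
  have hle : ∀ j, s' j ≤ s j := fun j => by rw [s'a]; omega
  have hval : Valid p m s' := by
    intro j
    have h1 := hs j
    have h2 := s'a j
    have h3 := hp' j
    have h4 := hadd j
    refine ⟨?_, by omega, ?_⟩
    · rw [h2]
      split_ifs with h
      · subst h; omega
      · omega
    · split_ifs at h2 h3 with h5 h6 <;> subst_vars <;> omega
  have hlam' : ∀ j, lam p s' j + (if j = j0 then p else 0) = lam p s j + (if j = j0 + 1 then 1 else 0) := by
    intro j
    have h1 := hval j
    have h2 := s'a j
    have h3 := hp' j
    have h4 := hadd j
    have h0 := hs j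
    have h5 : lam p s' j + s' j = p * s' (j + 1) := by unfold lam; omega
    split_ifs at * <;> omega
  set G0 := Function.update G j0 (monomial e' c) with hG0
  have hG0h : ∀ j, (G0 j).IsHomogeneous (lam p s j - (if j = j0 then p else 0)) := by
    intro j
    by_cases h : j = j0
    · subst h
      rw [hG0, Function.update_self]
      apply isHomogeneous_monomial
      simp; omega
    · rw [hG0, Function.update_of_ne h, if_neg h]
      exact (hG j h).1
  have hPhi : Phi p G = Phi p (Function.update G0 (j0 + 1) (X z * G0 (j0 + 1))) := by
    funext v
    have h1 : G = Function.update G0 j0 (X z ^ p * G0 j0) := by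
      funext j
      by_cases h : j = j0
      · subst h
        rw [Function.update_self, hG0, Function.update_self, hj, hee, X_pow_eq_monomial, monomial_mul]
        simp [add_comm]
      · rw [Function.update_of_ne h, hG0, Function.update_of_ne h]
    conv_lhs => rw [h1]
    rw [Phi_update_mul, Phi_update_mul, map_pow, eval_X, wrap_pow hK]
  rw [hPhi]
  refine Submodule.subset_span ⟨s', hval, hle, ?_, _, ?_, rfl⟩
  · intro h
    have := congrFun h (j0 + 1)
    rw [s'a] at this
    simp at this
    omega
  · intro j
    refine ⟨?_, ?_⟩
    · have h1 := hlam' j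
      have h2 := hG0h j
      have h3 : j = j0 → p ≤ lam p s j := by rintro rfl; omega
      by_cases h : j = j0 + 1
      · rw [if_pos h] at h1
        subst h
        rw [Function.update_self]
        have := (isHomogeneous_X K z).mul h2
        convert this using 1
        split_ifs at * with h5
        · have := h3 h5; omega
        · omega
      · rw [if_neg h] at h1
        rw [Function.update_of_ne h]
        convert h2 using 1
        omega
    · intro hz
      have h1 : j ≠ j0 + 1 := by
        intro h
        have := hz.1
        rw [s'a, if_pos h] at this
        have := hs j
        omega
      have h2 : j ≠ j0 := by
        intro h
        have := hz.2
        rw [s'b, if_pos h] at this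
        have := hs (j + 1)
        omega
      rw [Function.update_of_ne h1, hG0, Function.update_of_ne h2]
      refine (hG j h2).2 ⟨?_, ?_⟩
      · have := hz.1; rw [s'a, if_neg h1] at this; simpa using this
      · have := hz.2; rw [s'b, if_neg h2] at this; simpa using this

theorem homog_coeff_degree {f : MvPolynomial (Sg m) K} {n : ℕ} (hf : f.IsHomogeneous n)
    {e : Sg m →₀ ℕ} (he : e ∈ f.support) : e.degree = n := by
  rw [mem_support_iff] at he
  have := hf he
  rw [← this, Finsupp.degree_eq_weight_one]
  rfl

theorem overflow [hp : Fact p.Prime] [CharP K p] (hK : ∀ x : K, x ^ p ^ t = x)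
    {s : Fin t → ℕ} (hs : Valid p m s)
    (G : Fin t → MvPolynomial (Sg m) K) (j0 : Fin t) (hG : ∀ j, j ≠ j0 → G j ∈ Ad K p m s j)
    (hh : (G j0).IsHomogeneous (lam p s j0)) (hO : G j0 ∈ Ov K p m) : Phi p G ∈ Yl K p m s := by
  have h : G j0 ∈ comapD (Yl K p m s) p G j0 := by
    rw [(G j0).as_sum]
    refine Submodule.sum_mem _ fun e he => ?_
    refine overflow_mono hK hs _ j0 ?_ e (coeff e (G j0)) (homog_coeff_degree hh he) ((mem_Ov p).1 hO e he) (by simp)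
    intro j hj
    rw [Function.update_of_ne hj]
    exact hG j hj
  rw [mem_comapD, Function.update_eq_self] at h
  exact h

end types
end SP

namespace SP
open MvPolynomial

section extract
variable {K : Type*} [Field K] [Fintype K] {p : ℕ} {t m : ℕ}

theorem sum_pow_all {q : ℕ} (hq : Fintype.card K = q) {i : ℕ} (hi : 0 < i) :
    ∑ x : K, x ^ i = if (q - 1) ∣ i then -1 else 0 := by
  subst hq
  rw [← FiniteField.sum_pow_units K i]
  have h0 : ∑ x : K, x ^ i = ∑ x ∈ Finset.univ.erase (0 : K), x ^ i := by
    rw [← Finset.add_sum_erase _ _ (Finset.mem_univ (0 : K))]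
    simp [hi.ne']
  rw [h0]
  symm
  refine Finset.sum_bij (fun (x : Kˣ) _ => (x : K)) ?_ ?_ ?_ ?_
  · intro a _; simp
  · intro a _ b _ h; exact Units.ext h
  · intro b hb
    exact ⟨Units.mk0 b (Finset.mem_erase.1 hb).1, Finset.mem_univ _, rfl⟩
  · intro a _; simp

theorem Phi_sum [Fact p.Prime] [CharP K p] {ι : Type*} [Fintype ι]
    (P : Fin t → ι → MvPolynomial (Sg m) K) (v : Sg m → K) :
    Phi p (fun n => ∑ κ, P n κ) v = ∑ κ : Fin t → ι, Phi p (fun n => P n (κ n)) v := by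
  unfold Phi
  simp only [map_sum, sum_pow_char_pow]
  rw [Finset.prod_univ_sum]
  simp

theorem Phi_smul (a : Fin t → K) (P : Fin t → MvPolynomial (Sg m) K) (v : Sg m → K) :
    Phi p (fun n => a n • P n) v = (∏ n, a n ^ (p ^ (n : ℕ))) * Phi p P v := by
  unfold Phi
  simp only [smul_eval, mul_pow, Finset.prod_mul_distrib]

theorem extract0 [Fact p.Prime] [CharP K p] {q : ℕ} (hq : Fintype.card K = q) {ι : Type*} [Fintype ι]
    (I : Submodule K ((Sg m → K) → K)) (d : ι → ℕ) (g : Fin t → ι → MvPolynomial (Sg m) K)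
    (F : (Sg m → K) → K)
    (h : ∀ c : K, (Phi p (fun n => ∑ κ, c ^ d κ • g n κ) - F) ∈ I) (N : ℕ) (hN : 1 ≤ N) (hN2 : N < q - 1) :
    ∑ κ : Fin t → ι, (if (∑ n, d (κ n) * p ^ (n : ℕ)) ≡ N [MOD (q - 1)] then
      Phi p (fun n => g n (κ n)) else 0) ∈ I := by
  have h1 : ∑ c : K, c ^ (q - 1 - N) • (Phi p (fun n => ∑ κ, c ^ d κ • g n κ) - F) ∈ I :=
    Submodule.sum_mem _ fun c _ => I.smul_mem _ (h c)
  have h2 := I.neg_mem h1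
  convert h2 using 1
  have e1 : ∀ c : K, Phi p (fun n => ∑ κ, c ^ d κ • g n κ) =
      ∑ κ : Fin t → ι, c ^ (∑ n, d (κ n) * p ^ (n : ℕ)) • Phi p (fun n => g n (κ n)) := by
    intro c
    funext v
    rw [Phi_sum, Finset.sum_apply]
    refine Finset.sum_congr rfl fun κ _ => ?_
    rw [Phi_smul (fun n => c ^ d (κ n)) (fun n => g n (κ n)), Pi.smul_apply, smul_eq_mul]
    congr 1
    rw [← Finset.prod_pow_eq_pow_sum]
    refine Finset.prod_congr rfl fun n _ => ?_
    rw [pow_mul]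
  simp only [e1, smul_sub, Finset.smul_sum, smul_smul, Finset.sum_sub_distrib]
  rw [Finset.sum_comm, ← Finset.sum_smul, sum_pow_all hq (by omega), if_neg, zero_smul, sub_zero,
    ← Finset.sum_neg_distrib]
  · refine Finset.sum_congr rfl fun κ _ => ?_
    rw [← Finset.sum_smul]
    simp only [← pow_add]
    rw [sum_pow_all hq (by omega)]
    set D := ∑ n, d (κ n) * p ^ (n : ℕ)
    have : (q - 1 ∣ q - 1 - N + D) ↔ D ≡ N [MOD (q - 1)] := by
      rw [Nat.ModEq.comm, ← Nat.modEq_zero_iff_dvd]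
      constructor
      · intro hh
        have h3 := Nat.ModEq.add_right N hh
        have : q - 1 - N + D + N = (q - 1) + D := by omega
        rw [this, zero_add] at h3
        have h4 : q - 1 + D ≡ D [MOD (q - 1)] := by simp [Nat.ModEq]
        exact h3.symm.trans h4
      · intro hh
        have h3 := Nat.ModEq.add_left (q - 1 - N) hh
        have : q - 1 - N + N = q - 1 := by omega
        rw [this] at h3
        exact h3.symm.trans (by simp [Nat.ModEq])
    by_cases hd : D ≡ N [MOD (q - 1)]
    · rw [if_pos hd, if_pos (this.2 hd)]; simp
    · rw [if_neg hd, if_neg (fun hh => hd (this.1 hh))]; simp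
  · intro hd
    have := Nat.le_of_dvd (by omega) hd
    omega

theorem digits_lt (hp1 : 1 < p) (d : Fin t → ℕ) (hd : ∀ n, d n ≤ p - 1) :
    ∑ n, d n * p ^ (n : ℕ) ≤ p ^ t - 1 := by
  have h : ∀ n, d n < p := fun n => by have := hd n; omega
  have := (finFunctionFinEquiv (m := p) (n := t) (fun n => ⟨d n, h n⟩)).isLt
  rw [finFunctionFinEquiv_apply_val] at this
  simp at this
  omega

theorem digits_inj (hp1 : 1 < p) (d d' : Fin t → ℕ) (hd : ∀ n, d n ≤ p - 1) (hd' : ∀ n, d' n ≤ p - 1)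
    (he : ∑ n, d n * p ^ (n : ℕ) = ∑ n, d' n * p ^ (n : ℕ)) : d = d' := by
  have h : ∀ n, d n < p := fun n => by have := hd n; omega
  have h' : ∀ n, d' n < p := fun n => by have := hd' n; omega
  have : (fun n => (⟨d n, h n⟩ : Fin p)) = (fun n => (⟨d' n, h' n⟩ : Fin p)) := by
    apply (finFunctionFinEquiv (m := p) (n := t)).injective
    apply Fin.ext
    rw [finFunctionFinEquiv_apply_val, finFunctionFinEquiv_apply_val]
    exact he
  funext n
  have := congrFun this n
  simpa using this

theorem digit_single (hp3 : 3 ≤ p) (ht : 1 ≤ t) (d : Fin t → ℕ) (hd : ∀ n, d n ≤ p - 1) (l : Fin t)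
    (h : ∑ n, d n * p ^ (n : ℕ) ≡ p ^ (l : ℕ) [MOD (p ^ t - 1)]) : d = Pi.single l 1 := by
  have h1 := digits_lt (by omega) d hd
  have h3 : p ^ (l : ℕ) * 3 ≤ p ^ t := by
    calc p ^ (l : ℕ) * 3 ≤ p ^ (l : ℕ) * p := Nat.mul_le_mul_left _ hp3
      _ = p ^ ((l : ℕ) + 1) := (pow_succ _ _).symm
      _ ≤ p ^ t := Nat.pow_le_pow_right (by omega) l.isLt
  have h4 : 1 ≤ p ^ (l : ℕ) := Nat.one_le_pow _ _ (by omega)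
  have h5 : ∑ n, d n * p ^ (n : ℕ) = p ^ (l : ℕ) := by
    rcases Nat.lt_or_ge (∑ n, d n * p ^ (n : ℕ)) (p ^ t - 1) with h2 | h2
    · exact Nat.ModEq.eq_of_lt_of_lt h h2 (by omega)
    · have h6 : ∑ n, d n * p ^ (n : ℕ) = p ^ t - 1 := by omega
      rw [h6] at h
      have h7 : (0 : ℕ) ≡ p ^ (l : ℕ) [MOD (p ^ t - 1)] := by
        refine Nat.ModEq.trans ?_ h
        simp [Nat.ModEq]
      have := Nat.ModEq.eq_of_lt_of_lt h7 (by omega) (by omega)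
      omega
  apply digits_inj (p := p) (by omega) _ _ hd
  · intro n
    by_cases hn : n = l
    · subst hn; simp; omega
    · simp [hn]
  · rw [h5]
    simp [Pi.single_apply]

theorem extract1 [Fact p.Prime] [CharP K p] (hp3 : 3 ≤ p) (ht : 1 ≤ t) (hq : Fintype.card K = p ^ t)
    {ι : Type*} [Fintype ι]
    (I : Submodule K ((Sg m → K) → K)) (d : ι → ℕ) (κ0 : ι) (hκ0 : ∀ κ, d κ = 0 ↔ κ = κ0)
    (g : Fin t → ι → MvPolynomial (Sg m) K)
    (F : (Sg m → K) → K)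
    (h : ∀ c : K, (Phi p (fun n => ∑ κ, c ^ d κ • g n κ) - F) ∈ I)
    (hI : ∀ κ : Fin t → ι, (∃ n, p ≤ d (κ n)) → Phi p (fun n => g n (κ n)) ∈ I) (l : Fin t) :
    Phi p (Function.update (fun n => g n κ0) l (∑ κ, if d κ = 1 then g l κ else 0)) ∈ I := by
  have h3 : p ^ (l : ℕ) * 3 ≤ p ^ t := by
    calc p ^ (l : ℕ) * 3 ≤ p ^ (l : ℕ) * p := Nat.mul_le_mul_left _ hp3
      _ = p ^ ((l : ℕ) + 1) := (pow_succ _ _).symm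
      _ ≤ p ^ t := Nat.pow_le_pow_right (by omega) l.isLt
  have h4 : 1 ≤ p ^ (l : ℕ) := Nat.one_le_pow _ _ (by omega)
  have h0 := extract0 hq I d g F h (p ^ (l : ℕ)) h4 (by omega)
  have e1 : Phi p (Function.update (fun n => g n κ0) l (∑ κ, if d κ = 1 then g l κ else 0)) =
      ∑ κ : Fin t → ι, if (fun n => d (κ n)) = Pi.single l 1 then Phi p (fun n => g n (κ n)) else 0 := by
    funext v
    have e2 : Function.update (fun n => g n κ0) l (∑ κ, if d κ = 1 then g l κ else 0) =
        fun n => ∑ κ, if d κ = (Pi.single l 1 : Fin t → ℕ) n then g n κ else 0 := by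
      funext n
      by_cases hn : n = l
      · subst hn; simp
      · rw [Function.update_of_ne hn]; simp [hn, hκ0]
    rw [e2, Phi_sum, Finset.sum_apply]
    refine Finset.sum_congr rfl fun κ _ => ?_
    by_cases hd : (fun n => d (κ n)) = Pi.single l 1
    · rw [if_pos hd]
      congr 1
      funext n
      rw [if_pos (congrFun hd n)]
    · rw [if_neg hd]
      have : ∃ n, d (κ n) ≠ (Pi.single l 1 : Fin t → ℕ) n := by
        by_contra hcon
        push Not at hcon
        exact hd (funext hcon)
      obtain ⟨n, hn⟩ := this
      rw [Phi, Pi.zero_apply]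
      refine Finset.prod_eq_zero (Finset.mem_univ n) ?_
      have hpn : p ^ (n : ℕ) ≠ 0 := pow_ne_zero _ (by omega)
      rw [if_neg hn, map_zero, zero_pow hpn]
  rw [e1, ← Submodule.sub_mem_iff_left _ h0, ← Finset.sum_sub_distrib]
  refine Submodule.sum_mem _ fun κ _ => ?_
  by_cases hk : ∃ n, p ≤ d (κ n)
  · have := hI κ hk
    split_ifs <;> simp [this]
  · push Not at hk
    by_cases hd : (fun n => d (κ n)) = Pi.single l 1
    · rw [if_pos hd, if_pos, sub_self]
      · exact zero_mem _
      · have : ∑ n, d (κ n) * p ^ (n : ℕ) = p ^ (l : ℕ) := by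
          have : ∀ n, d (κ n) = (Pi.single l 1 : Fin t → ℕ) n := congrFun hd
          simp [this, Pi.single_apply]
        rw [this]
    · rw [if_neg hd, if_neg, sub_self]
      · exact zero_mem _
      · intro hm
        exact hd (digit_single hp3 ht _ (fun n => by have := hk n; omega) l hm)

end extract

section elem
variable {K : Type*} [Field K] {p : ℕ} {m : ℕ}

def sh (A B : Sg m) (a : ℕ) (e : Sg m →₀ ℕ) : Sg m →₀ ℕ := e - Finsupp.single A a + Finsupp.single B a

def Hs (A B : Sg m) (a : ℕ) : MvPolynomial (Sg m) K →ₗ[K] MvPolynomial (Sg m) K :=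
  (basisMonomials (Sg m) K).constr K (fun e => monomial (sh A B a e) ((e A).choose a : K))

theorem Hs_monomial (A B : Sg m) (a : ℕ) (e : Sg m →₀ ℕ) (c : K) :
    Hs A B a (monomial e c) = monomial (sh A B a e) (c * ((e A).choose a : K)) := by
  have h1 : (monomial e c : MvPolynomial (Sg m) K) = c • basisMonomials (Sg m) K e := by
    simp [smul_monomial]
  rw [h1, map_smul, Hs, Module.Basis.constr_basis, smul_monomial, smul_eq_mul]

theorem Hs_zero (A B : Sg m) (f : MvPolynomial (Sg m) K) : Hs A B 0 f = f := by
  induction f using MvPolynomial.induction_on' with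
  | monomial e c => rw [Hs_monomial]; simp [sh]
  | add f g hf hg => rw [map_add, hf, hg]

theorem Hs_one (A B : Sg m) (f : MvPolynomial (Sg m) K) : Hs A B 1 f = X B * pderiv A f := by
  induction f using MvPolynomial.induction_on' with
  | monomial e c =>
    rw [Hs_monomial, pderiv_monomial, X, monomial_mul, sh]
    simp [add_comm]
  | add f g hf hg => rw [map_add, hf, hg, map_add, mul_add]

theorem Ts_fix (a : Matrix (Sg m) (Sg m) K) (e : Sg m →₀ ℕ) (c : K)
    (h : ∀ z ∈ e.support, Ts a (X z) = X z) : Ts a (monomial e c) = monomial e c := by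
  rw [monomial_eq, map_mul, Finsupp.prod, map_prod]
  congr 1
  · simp [Ts]
  · refine Finset.prod_congr rfl fun z hz => ?_
    rw [map_pow, h z hz]

theorem Ts_transv_X (A B : Sg m) (c : K) (z : Sg m) :
    Ts (Matrix.transvection A B c) (X z) = X z + (if z = A then C c * X B else 0) := by
  rw [Ts_X, Matrix.transvection]
  simp only [Matrix.add_apply, Matrix.one_apply, Matrix.single_apply, map_add, add_mul,
    Finset.sum_add_distrib]
  congr 1
  · simp [apply_ite (C : K → MvPolynomial (Sg m) K), -Fintype.sum_sum_type]
  · by_cases h : z = A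
    · subst h; simp [apply_ite (C : K → MvPolynomial (Sg m) K), -Fintype.sum_sum_type]
    · simp [h, Ne.symm h]

theorem Ts_transv_monomial (A B : Sg m) (c : K) (e : Sg m →₀ ℕ) (r : K)
    (he : e A < p) : Ts (Matrix.transvection A B c) (monomial e r) =
      ∑ a : Fin p, c ^ (a : ℕ) • Hs A B (a : ℕ) (monomial e r) := by
  have h1 : (monomial e r : MvPolynomial (Sg m) K) = monomial (e.erase A) r * X A ^ (e A) := by
    rw [X_pow_eq_monomial, monomial_mul, Finsupp.erase_add_single, mul_one]
  have h2 : Ts (Matrix.transvection A B c) (monomial (e.erase A) r) = monomial (e.erase A) r := by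
    apply Ts_fix
    intro z hz
    rw [Ts_transv_X, if_neg, add_zero]
    rintro rfl
    simp at hz
  conv_lhs => rw [h1]
  rw [map_mul, h2, map_pow, Ts_transv_X, if_pos rfl, add_comm, add_pow, Finset.mul_sum,
    ← Finset.sum_range (fun a => c ^ a • Hs A B a (monomial e r))]
  rw [← Finset.sum_subset (Finset.range_mono (show e A + 1 ≤ p from he))]
  · refine Finset.sum_congr rfl fun a ha => ?_
    have ha' : a ≤ e A := by simpa [Nat.lt_succ_iff] using ha
    rw [Hs_monomial, mul_pow, smul_monomial]
    have h3 : (((e A).choose a : ℕ) : MvPolynomial (Sg m) K) = C ((e A).choose a : K) := by simp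
    rw [h3, ← map_pow, X_pow_eq_monomial, X_pow_eq_monomial]
    rw [C_apply, C_apply]
    simp only [monomial_mul]
    congr 1
    · congr 1
      ext w
      simp only [sh, Finsupp.coe_add, Finsupp.coe_tsub, Pi.add_apply, Pi.sub_apply, Finsupp.single_apply,
        Finsupp.erase_apply, Finsupp.coe_zero, Pi.zero_apply]
      by_cases hw : w = A
      · subst hw; simp; omega
      · simp [hw, Ne.symm hw]
    · simp [smul_eq_mul]; ring
  · intro a _ ha
    have : e A < a := by simpa using ha
    rw [Hs_monomial, Nat.choose_eq_zero_of_lt this]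
    simp

def RdS (p : ℕ) (f : MvPolynomial (Sg m) K) : Prop := ∀ e ∈ f.support, Rd p e

theorem Ts_transv [hp : Fact p.Prime] (A B : Sg m) (c : K) (f : MvPolynomial (Sg m) K) (hf : RdS p f) :
    Ts (Matrix.transvection A B c) f = ∑ a : Fin p, c ^ (a : ℕ) • Hs A B (a : ℕ) f := by
  have hp1 := hp.out.one_lt
  conv_lhs => rw [f.as_sum]
  rw [map_sum]
  conv_rhs => rw [f.as_sum]
  simp only [map_sum, Finset.smul_sum]
  rw [Finset.sum_comm]
  refine Finset.sum_congr rfl fun e he => ?_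
  exact Ts_transv_monomial A B c e _ (by have := hf e he A; omega)

end elem

end SP

namespace SP
open MvPolynomial

section tau2
variable {K : Type*} [Field K] {p : ℕ} {m : ℕ}

theorem sgn_bar [hp : Fact p.Prime] [CharP K p] (hodd : Odd p) {e : Sg m →₀ ℕ} (he : Rd p e) :
    sgn K e * sgn K (bar p e) = 1 := by
  have hsw : ∏ z, ((bar p e z).factorial : K) = ∏ z, ((p - 1 - e z).factorial : K) := by
    rw [← Equiv.prod_comp (Equiv.sumComm (Fin m) (Fin m))]
    refine Finset.prod_congr rfl fun z _ => ?_
    simp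
  have hev : Even (p - 1) := Nat.Odd.sub_odd hodd odd_one
  unfold sgn
  rw [hsw]
  have e1 : ∀ a b c d : K, a * b * (c * d) = (a * c) * (b * d) := by intros; ring
  rw [e1, ← Finset.prod_mul_distrib]
  have e2 : ∏ z, (((e z).factorial : K) * ((p - 1 - e z).factorial : K)) = ∏ z, (-1 : K) ^ (e z + 1) :=
    Finset.prod_congr rfl fun z _ => fact_wilson p _ (he z)
  rw [e2, Fintype.prod_sum_type, pow_add, pow_add]
  have e3 : ∀ x y c : K, c * c = 1 → (x * c) * (y * c) = x * y := by
    intro x y c hc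
    have : (x * c) * (y * c) = (x * y) * (c * c) := by ring
    rw [this, hc, mul_one]
  rw [e3 _ _ _ (by rw [← pow_add]; exact Even.neg_one_pow ⟨m, rfl⟩), ← Finset.prod_pow_eq_pow_sum,
    ← Finset.prod_pow_eq_pow_sum, ← Finset.prod_mul_distrib, ← Finset.prod_mul_distrib,
    ← Finset.prod_mul_distrib]
  refine Finset.prod_eq_one fun i _ => ?_
  simp only [bar_apply, Sum.swap_inr]
  rw [← pow_add, ← pow_add, ← pow_add]
  apply Even.neg_one_pow
  have := he (Sum.inl i)
  have : e (Sum.inr i) + (p - 1 - e (Sum.inl i)) + (e (Sum.inl i) + 1 + (e (Sum.inr i) + 1))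
    = (p - 1) + 2 * (e (Sum.inr i) + 1) := by omega
  rw [this]
  exact hev.add (even_two_mul _)

theorem tau_tau [hp : Fact p.Prime] [CharP K p] (hodd : Odd p) (f : MvPolynomial (Sg m) K) :
    tau p (tau p f) - f ∈ Ov K p m := by
  induction f using MvPolynomial.induction_on' with
  | monomial e c =>
    by_cases he : Rd p e
    · rw [tau_monomial, if_pos he, tau_monomial, if_pos (Rd_bar p e), bar_bar p he, mul_assoc,
        sgn_bar hodd he, mul_one, sub_self]
      exact zero_mem _
    · rw [tau_of_mem_Ov p (monomial_mem_Ov p he c), map_zero, zero_sub]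
      exact neg_mem (monomial_mem_Ov p he c)
  | add f g hf hg =>
    simp only [map_add]
    convert add_mem hf hg using 1
    ring

theorem degree_bar {e : Sg m →₀ ℕ} (he : Rd p e) : (bar p e).degree + e.degree = 2 * m * (p - 1) := by
  rw [Finsupp.degree_eq_sum, Finsupp.degree_eq_sum]
  have : ∑ z, (bar p e) z = ∑ z, (p - 1 - e z) := by
    rw [← Equiv.sum_comp (Equiv.sumComm (Fin m) (Fin m))]
    refine Finset.sum_congr rfl fun z _ => ?_
    simp
  rw [this, ← Finset.sum_add_distrib]
  have h2 : ∀ z ∈ (Finset.univ : Finset (Sg m)), p - 1 - e z + e z = p - 1 := fun z _ => by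
    have := he z; omega
  rw [Finset.sum_congr rfl h2]
  rw [Finset.sum_const, Finset.card_univ, Fintype.card_sum, Fintype.card_fin, smul_eq_mul, two_mul]

theorem tau_homog {f : MvPolynomial (Sg m) K} (hf : f.IsHomogeneous (m * (p - 1))) :
    (tau p f).IsHomogeneous (m * (p - 1)) := by
  rw [f.as_sum, map_sum]
  refine IsHomogeneous.sum _ _ _ fun e he => ?_
  rw [tau_monomial]
  split_ifs with h
  · apply isHomogeneous_monomial
    have h1 := degree_bar h
    have h2 := homog_coeff_degree hf he
    have h3 : 2 * m * (p - 1) = m * (p - 1) + m * (p - 1) := by ring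
    omega
  · exact isHomogeneous_zero _ _ _

theorem tau_Dz [hp : Fact p.Prime] [CharP K p] (hodd : Odd p) (z : Sg m) (f : MvPolynomial (Sg m) K) :
    tau p (Dz z f) - X z * tau p f ∈ Ov K p m := by
  have h1 : tau p (Dz z f) = tau p (tau p (X z * tau p f)) := by
    rw [tau_X_mul]
    have h2 : Dz z f = Dz z (tau p (tau p f)) - Dz z (tau p (tau p f) - f) := by
      rw [eq_sub_iff_add_eq, ← Dz_add]; congr 1; ring
    rw [h2, map_sub, tau_of_mem_Ov p (Dz_mem_Ov p (tau_tau hodd f) z), sub_zero]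
  rw [h1]
  exact tau_tau hodd _

theorem tau_Ei [hp : Fact p.Prime] [CharP K p] (hodd : Odd p) (i : Fin m) (f : MvPolynomial (Sg m) K) :
    tau p (X (Sum.inr i) * pderiv (Sum.inl i) f) - X (Sum.inr i) * pderiv (Sum.inl i) (tau p f) ∈ Ov K p m := by
  have h1 := Dz_mem_Ov p (tau_Dz hodd (Sum.inr i) f) (Sum.inr i)
  rw [tau_X_mul]
  convert h1 using 1
  simp only [Dz, map_sub, Derivation.leibniz, pderiv_X, smul_eq_mul]
  simp

end tau2

section psi
variable {K : Type*} [Field K] {p : ℕ} {t m : ℕ} [NeZero t]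

def Sd (K : Type*) [Field K] (p m : ℕ) (s : Fin t → ℕ) (j : Fin t) :
    MvPolynomial (Sg m) K →ₗ[K] MvPolynomial (Sg m) K :=
  if ZZ m s j then LinearMap.id + tau p else LinearMap.id

theorem Sd_pos {s : Fin t → ℕ} {j : Fin t} (h : ZZ m s j) (f : MvPolynomial (Sg m) K) :
    Sd K p m s j f = f + tau p f := by simp [Sd, h]

theorem Sd_neg {s : Fin t → ℕ} {j : Fin t} (h : ¬ ZZ m s j) (f : MvPolynomial (Sg m) K) :
    Sd K p m s j f = f := by simp [Sd, h]

theorem ZZ_lam {s : Fin t → ℕ} {j : Fin t} (h : ZZ m s j) : lam p s j = m * (p - 1) := by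
  rw [lam, h.1, h.2, Nat.mul_sub, mul_one, mul_comm]

theorem Sd_of_Ov [hp : Fact p.Prime] {s : Fin t → ℕ} {j : Fin t} {f : MvPolynomial (Sg m) K}
    (hf : f ∈ Ov K p m) : Sd K p m s j f = f := by
  by_cases h : ZZ m s j
  · rw [Sd_pos h, tau_of_mem_Ov p hf, add_zero]
  · rw [Sd_neg h]

theorem Sd_homog {s : Fin t → ℕ} {j : Fin t} {f : MvPolynomial (Sg m) K}
    (hf : f.IsHomogeneous (lam p s j)) : (Sd K p m s j f).IsHomogeneous (lam p s j) := by
  by_cases h : ZZ m s j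
  · rw [Sd_pos h]
    refine hf.add ?_
    rw [ZZ_lam h] at hf ⊢
    exact tau_homog hf
  · rw [Sd_neg h]; exact hf

theorem Sd_mem_Ad [hp : Fact p.Prime] [CharP K p] (hodd : Odd p) {s : Fin t → ℕ} {j : Fin t}
    {f : MvPolynomial (Sg m) K} (hf : f.IsHomogeneous (lam p s j)) : Sd K p m s j f ∈ Ad K p m s j := by
  refine ⟨Sd_homog hf, fun h => ?_⟩
  rw [Sd_pos h, map_add]
  convert tau_tau hodd f using 1
  ring

theorem Sd_comm_Ts [hp : Fact p.Prime] [CharP K p] (s : Fin t → ℕ) (j : Fin t)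
    {a : Matrix (Sg m) (Sg m) K} (ha : Good a) (f : MvPolynomial (Sg m) K) :
    Sd K p m s j (Ts a f) - Ts a (Sd K p m s j f) ∈ Ov K p m := by
  by_cases h : ZZ m s j
  · rw [Sd_pos h, Sd_pos h, map_add]
    convert tau_Ts p ha.symp (ha.pow p) f using 1
    ring
  · rw [Sd_neg h, Sd_neg h, sub_self]; exact zero_mem _

theorem Sd_comm_Ei [hp : Fact p.Prime] [CharP K p] (hodd : Odd p) (s : Fin t → ℕ) (j : Fin t)
    (i : Fin m) (f : MvPolynomial (Sg m) K) :
    Sd K p m s j (X (Sum.inr i) * pderiv (Sum.inl i) f) -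
      X (Sum.inr i) * pderiv (Sum.inl i) (Sd K p m s j f) ∈ Ov K p m := by
  by_cases h : ZZ m s j
  · rw [Sd_pos h, Sd_pos h, map_add]
    convert tau_Ei hodd i f using 1
    ring
  · rw [Sd_neg h, Sd_neg h, sub_self]; exact zero_mem _

theorem RdS_Sd {s : Fin t → ℕ} {j : Fin t} {e : Sg m →₀ ℕ} (he : Rd p e) (c : K) :
    RdS p (Sd K p m s j (monomial e c)) := by
  intro e' h'
  have h1 : ∀ (e0 : Sg m →₀ ℕ) (c0 : K), e' ∈ (monomial e0 c0 : MvPolynomial (Sg m) K).support → e' = e0 := by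
    intro e0 c0 h
    simpa using support_monomial_subset h
  by_cases h : ZZ m s j
  · rw [Sd_pos h, tau_monomial, if_pos he] at h'
    rcases Finset.mem_union.1 (support_add h') with h2 | h2
    · rw [h1 _ _ h2]; exact he
    · rw [h1 _ _ h2]; exact Rd_bar p e
  · rw [Sd_neg h] at h'
    rw [h1 _ _ h']; exact he

def Psi (K : Type*) [Field K] (p : ℕ) (s : Fin t → ℕ) (e : Fin t → Sg m →₀ ℕ) : (Sg m → K) → K :=
  Phi p (fun j => Sd K p m s j (monomial (e j) 1))

def Adm (p : ℕ) (s : Fin t → ℕ) (e : Fin t → Sg m →₀ ℕ) : Prop :=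
  ∀ j, Rd p (e j) ∧ (e j).degree = lam p s j

theorem Psi_mem_Yf [hp : Fact p.Prime] [CharP K p] (hodd : Odd p) {s : Fin t → ℕ} (hs : Valid p m s)
    {e : Fin t → Sg m →₀ ℕ} (he : ∀ j, (e j).degree = lam p s j) : Psi K p s e ∈ Yf K p t m :=
  Submodule.subset_span ⟨s, hs, _, fun j => Sd_mem_Ad hodd (isHomogeneous_monomial _ (he j)), rfl⟩

theorem two_ne [hp : Fact p.Prime] [CharP K p] (hodd : Odd p) : (2 : K) ≠ 0 := by
  have := CharP.cast_eq_zero_iff K p 2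
  intro h
  have h2 : p ∣ 2 := this.1 (by exact_mod_cast h)
  have h3 := Nat.le_of_dvd (by norm_num) h2
  have h4 := hp.out.two_le
  have : p = 2 := by omega
  subst this
  exact absurd hodd (by decide)

theorem reduce [hp : Fact p.Prime] [CharP K p] (hodd : Odd p) (hK : ∀ x : K, x ^ p ^ t = x)
    {s : Fin t → ℕ} (hs : Valid p m s) (N : Submodule K ((Sg m → K) → K)) (hN : Yl K p m s ≤ N)
    (h : ∀ e : Fin t → Sg m →₀ ℕ, Adm p s e → Psi K p s e ∈ N)
    (G : Fin t → MvPolynomial (Sg m) K) (hG : ∀ j, G j ∈ Ad K p m s j) : Phi p G ∈ N := by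
  refine ML N (fun j => Ad K p m s j)
    (fun j => {f | ∃ e : Sg m →₀ ℕ, Rd p e ∧ e.degree = lam p s j ∧ f = Sd K p m s j (monomial e 1)})
    ?_ ?_ ?_ ?_ G hG
  · rintro j f ⟨e, h1, h2, rfl⟩
    exact Sd_mem_Ad hodd (isHomogeneous_monomial _ h2)
  · intro j f hf
    have key : ∀ f : MvPolynomial (Sg m) K, f.IsHomogeneous (lam p s j) →
        ∃ g ∈ Submodule.span K {f | ∃ e : Sg m →₀ ℕ, Rd p e ∧ e.degree = lam p s j ∧ f = Sd K p m s j (monomial e 1)},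
          ∃ h ∈ Ad K p m s j, h ∈ Ov K p m ∧ Sd K p m s j f = g + h := by
      intro f hf
      refine ⟨∑ e ∈ f.support, if Rd p e then Sd K p m s j (monomial e (coeff e f)) else 0, ?_,
        ∑ e ∈ f.support, if Rd p e then 0 else Sd K p m s j (monomial e (coeff e f)), ?_, ?_, ?_⟩
      · refine Submodule.sum_mem _ fun e he => ?_
        split_ifs with hr
        · have : (monomial e (coeff e f) : MvPolynomial (Sg m) K) = coeff e f • monomial e 1 := by
            simp [smul_monomial]
          rw [this, map_smul]
          exact Submodule.smul_mem _ _ (Submodule.subset_span ⟨e, hr, homog_coeff_degree hf he, rfl⟩)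
        · exact zero_mem _
      · refine Submodule.sum_mem _ fun e he => ?_
        split_ifs with hr
        · exact zero_mem _
        · exact Sd_mem_Ad hodd (isHomogeneous_monomial _ (homog_coeff_degree hf he))
      · refine Ideal.sum_mem _ fun e he => ?_
        split_ifs with hr
        · exact zero_mem _
        · rw [Sd_of_Ov (monomial_mem_Ov p hr _)]
          exact monomial_mem_Ov p hr _
      · rw [← Finset.sum_add_distrib]
        conv_lhs => rw [f.as_sum]
        rw [map_sum]
        refine Finset.sum_congr rfl fun e he => ?_
        split_ifs <;> simp
    by_cases hz : ZZ m s j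
    · obtain ⟨g, hg, r, hr1, hr2, he⟩ := key f hf.1
      rw [Sd_pos hz] at he
      have h2 := two_ne (K := K) hodd
      have hh1 : (2⁻¹ : K) • (f - tau p f) ∈ Ov K p m := by
        apply (Ov K p m).smul_of_tower_mem
        rw [← neg_sub]
        exact neg_mem (hf.2 hz)
      refine ⟨(2⁻¹ : K) • g, Submodule.smul_mem _ _ hg, (2⁻¹ : K) • r + (2⁻¹ : K) • (f - tau p f), ?_, ?_, ?_⟩
      · refine add_mem (Submodule.smul_mem _ _ hr1) ⟨?_, fun _ => ?_⟩
        · refine (homogeneousSubmodule (Sg m) K _).smul_mem _ (sub_mem hf.1 ?_)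
          have := hf.1
          rw [ZZ_lam hz] at this ⊢
          exact tau_homog this
        · rw [tau_of_mem_Ov p hh1, zero_sub]
          exact neg_mem hh1
      · exact add_mem ((Ov K p m).smul_of_tower_mem _ hr2) hh1
      · rw [← add_assoc, ← smul_add, ← he, ← smul_add]
        have : f + tau p f + (f - tau p f) = (2 : K) • f := by rw [two_smul]; ring
        rw [this, smul_smul, inv_mul_cancel₀ h2, one_smul]
    · obtain ⟨g, hg, r, hr1, hr2, he⟩ := key f hf.1
      rw [Sd_neg hz] at he
      exact ⟨g, hg, r, hr1, hr2, he⟩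
  · intro G hG j hj
    exact hN (overflow hK hs G j (fun i _ => hG i) (hG j).1 hj)
  · intro G hG
    choose e h1 h2 h3 using hG
    have : G = fun j => Sd K p m s j (monomial (e j) 1) := funext h3
    rw [this]
    exact h e (fun j => ⟨h1 j, h2 j⟩)

/-- congruence mod overflow -/
theorem Phi_congr [hp : Fact p.Prime] [CharP K p] (hK : ∀ x : K, x ^ p ^ t = x)
    {s : Fin t → ℕ} (hs : Valid p m s) (G G' : Fin t → MvPolynomial (Sg m) K)
    (hG : ∀ j, G j ∈ Ad K p m s j) (hG' : ∀ j, G' j ∈ Ad K p m s j)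
    (h : ∀ j, G' j - G j ∈ Ov K p m) : Phi p G' - Phi p G ∈ Yl K p m s := by
  have key : ∀ S : Finset (Fin t), Phi p (fun j => if j ∈ S then G' j else G j) - Phi p G ∈ Yl K p m s := by
    intro S
    induction S using Finset.induction_on with
    | empty => simp
    | insert j S hj ih =>
      set H : Fin t → MvPolynomial (Sg m) K := fun j => if j ∈ S then G' j else G j with hH
      have hHA : ∀ i, H i ∈ Ad K p m s i := by
        intro i
        simp only [hH]
        split_ifs
        · exact hG' i
        · exact hG i
      have e1 : (fun i => if i ∈ insert j S then G' i else G i) = Function.update H j (G' j) := by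
        funext i
        by_cases hi : i = j
        · subst hi; simp
        · rw [Function.update_of_ne hi]; simp [hi, hH]
      have e2 : G' j - H j ∈ comapD (Yl K p m s) p H j := by
        have hHj : H j = G j := by simp [hH, hj]
        rw [hHj]
        refine overflow hK hs _ j (fun i hi => ?_) ?_ ?_
        · rw [Function.update_of_ne hi]; exact hHA i
        · rw [Function.update_self]
          exact (homogeneousSubmodule (Sg m) K _).sub_mem (hG' j).1 (hG j).1
        · rw [Function.update_self]; exact h j
      have e3 : Phi p (Function.update H j (G' j)) - Phi p H ∈ Yl K p m s := by
        have : Phi p (Function.update H j (G' j)) - Phi p H = Phi p (Function.update H j (G' j - H j)) := by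
          funext v
          have h0 := Phi_update (p := p) H j (H j) v
          rw [Function.update_eq_self] at h0
          rw [Pi.sub_apply, h0, Phi_update, Phi_update, map_sub, sub_pow_char_pow, sub_mul]
        rw [this]
        exact e2
      rw [e1]
      have := add_mem e3 ih
      simpa using this
  have := key Finset.univ
  simpa using this

end psi
end SP

namespace SP
open MvPolynomial

section ops
variable {K : Type*} [Field K] {m : ℕ}

def GLm (i k : Fin m) (c : K) : Matrix (Sg m) (Sg m) K :=
  Matrix.transvection (Sum.inr i) (Sum.inr k) (-c) * Matrix.transvection (Sum.inl k) (Sum.inl i) c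

theorem single_inl_J (a : Sg m) (i : Fin m) (c : K) :
    Matrix.single a (Sum.inl i) c * Matrix.J (Fin m) K = Matrix.single a (Sum.inr i) (-c) := by
  ext z w
  by_cases hz : z = a
  · subst hz
    rw [Matrix.single_mul_apply_same]
    rcases w with j | j
    · simp [Matrix.J, Matrix.single_apply, Matrix.one_apply]
    · simp only [Matrix.J, Matrix.single_apply, Matrix.one_apply, Matrix.fromBlocks_apply₁₂, Matrix.neg_apply]
      by_cases h : i = j <;> simp [h]
  · rw [Matrix.single_mul_apply_of_ne _ _ _ _ _ hz]
    simp [Matrix.single_apply, Ne.symm hz]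

theorem single_inr_J (a : Sg m) (i : Fin m) (c : K) :
    Matrix.single a (Sum.inr i) c * Matrix.J (Fin m) K = Matrix.single a (Sum.inl i) c := by
  ext z w
  by_cases hz : z = a
  · subst hz
    rw [Matrix.single_mul_apply_same]
    rcases w with j | j <;> simp [Matrix.J, Matrix.single_apply, Matrix.one_apply]
  · rw [Matrix.single_mul_apply_of_ne _ _ _ _ _ hz]
    simp [Matrix.single_apply, Ne.symm hz]

theorem good_L (i : Fin m) (c : K) : Good (Matrix.transvection (Sum.inl i : Sg m) (Sum.inr i) c) := by
  refine ⟨Matrix.single (Sum.inl i) (Sum.inl i) (-c), ?_, ?_, ?_⟩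
  · simp
  · rw [single_inl_J]
    exact Matrix.single_mul_single_of_ne _ _ _ _ (by simp) _
  · rw [single_inl_J, neg_neg]; rfl

theorem good_GL {i k : Fin m} (h : i ≠ k) (c : K) : Good (GLm i k c) := by
  refine ⟨Matrix.single (Sum.inl k) (Sum.inr i) c + Matrix.single (Sum.inr i) (Sum.inl k) c, ?_, ?_, ?_⟩
  · simp [add_comm]
  · rw [add_mul, single_inl_J, single_inr_J]
    simp only [add_mul, mul_add]
    rw [Matrix.single_mul_single_of_ne, Matrix.single_mul_single_of_ne, Matrix.single_mul_single_of_ne,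
      Matrix.single_mul_single_of_ne] <;> simp [h, h.symm]
  · rw [add_mul, single_inl_J, single_inr_J, GLm, Matrix.transvection, Matrix.transvection, add_mul,
      mul_add, mul_add, Matrix.single_mul_single_of_ne]
    · simp; abel
    · simp

end ops

section core
variable {K : Type*} [Field K] [Fintype K] {p : ℕ} {t m : ℕ} [NeZero t]

theorem opE [hp : Fact p.Prime] [CharP K p] (hp3 : 3 ≤ p) (hq : Fintype.card K = p ^ t)
    {I : Submodule K ((Sg m → K) → K)}
    (hL : ∀ (i : Fin m) (c : K), ∀ F ∈ Yf K p t m,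
      (fun v => F ((Matrix.transvection (Sum.inl i : Sg m) (Sum.inr i) c).mulVec v)) - F ∈ I)
    (W : Fin t → MvPolynomial (Sg m) K) (hW : ∀ n, RdS p (W n)) (hY : Phi p W ∈ Yf K p t m)
    (l : Fin t) (i : Fin m) :
    Phi p (Function.update W l (X (Sum.inr i) * pderiv (Sum.inl i) (W l))) ∈ I := by
  have ht : 1 ≤ t := Nat.one_le_iff_ne_zero.2 (NeZero.ne t)
  have h := extract1 (p := p) (t := t) hp3 ht hq I (fun a : Fin p => (a : ℕ)) ⟨0, by omega⟩
    (fun κ => by rw [Fin.ext_iff]) (fun n a => Hs (Sum.inl i) (Sum.inr i) (a : ℕ) (W n)) (Phi p W)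
    (fun c => by
      have := hL i c _ hY
      have e0 : (fun v => Phi p W ((Matrix.transvection (Sum.inl i : Sg m) (Sum.inr i) c).mulVec v)) =
        Phi p (fun j => Ts (Matrix.transvection (Sum.inl i : Sg m) (Sum.inr i) c) (W j)) := funext (Phi_Ts _ _)
      rw [e0] at this
      have e : ∀ j, Ts (Matrix.transvection (Sum.inl i : Sg m) (Sum.inr i) c) (W j)
        = ∑ κ : Fin p, c ^ (κ : ℕ) • Hs (Sum.inl i) (Sum.inr i) (κ : ℕ) (W j) :=
        fun j => Ts_transv _ _ c _ (hW j)
      rw [show (fun j => Ts (Matrix.transvection (Sum.inl i : Sg m) (Sum.inr i) c) (W j)) = _ from funext e] at this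
      exact this)
    (fun κ hκ => by
      obtain ⟨n, hn⟩ := hκ
      exact absurd (κ n).isLt (by omega)) l
  simp only [Hs_zero] at h
  have e2 : (∑ κ : Fin p, if (κ : ℕ) = 1 then Hs (Sum.inl i) (Sum.inr i) (κ : ℕ) (W l) else 0)
      = X (Sum.inr i) * pderiv (Sum.inl i) (W l) := by
    rw [Finset.sum_eq_single ⟨1, by omega⟩]
    · simp [Hs_one]
    · intro b _ hb
      rw [if_neg]
      intro h1
      exact hb (Fin.ext h1)
    · simp
  rw [e2] at h
  exact h

/-- all `g` such that putting `Sd g` in digit `n` gives an element of `I` -/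
def Ls (I : Submodule K ((Sg m → K) → K)) (p : ℕ) [Fact p.Prime] [CharP K p] (s : Fin t → ℕ)
    (e : Fin t → Sg m →₀ ℕ) (n : Fin t) : Submodule K (MvPolynomial (Sg m) K) :=
  (comapD I p (fun j => Sd K p m s j (monomial (e j) 1)) n).comap (Sd K p m s n)

theorem mem_Ls [hp : Fact p.Prime] [CharP K p] {I : Submodule K ((Sg m → K) → K)} {s : Fin t → ℕ}
    {e : Fin t → Sg m →₀ ℕ} {n : Fin t} {g : MvPolynomial (Sg m) K} :
    g ∈ Ls I p s e n ↔
      Phi p (Function.update (fun j => Sd K p m s j (monomial (e j) 1)) n (Sd K p m s n g)) ∈ I := Iff.rfl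

theorem Ls_update [hp : Fact p.Prime] [CharP K p] {I : Submodule K ((Sg m → K) → K)} {s : Fin t → ℕ}
    {e : Fin t → Sg m →₀ ℕ} {n : Fin t} (f : Sg m →₀ ℕ) :
    Ls I p s (Function.update e n f) n = Ls I p s e n := by
  ext g
  rw [mem_Ls, mem_Ls]
  have : (Function.update (fun j => Sd K p m s j (monomial (Function.update e n f j) 1)) n (Sd K p m s n g))
    = (Function.update (fun j => Sd K p m s j (monomial (e j) 1)) n (Sd K p m s n g)) := by
    funext j
    by_cases hj : j = n
    · subst hj; simp
    · simp [Function.update_of_ne hj]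
  rw [this]

theorem mem_Ls_mono [hp : Fact p.Prime] [CharP K p] {I : Submodule K ((Sg m → K) → K)} {s : Fin t → ℕ}
    {e : Fin t → Sg m →₀ ℕ} {n : Fin t} (f : Sg m →₀ ℕ) :
    monomial f 1 ∈ Ls I p s e n ↔ Psi K p s (Function.update e n f) ∈ I := by
  rw [mem_Ls, Psi]
  have : (Function.update (fun j => Sd K p m s j (monomial (e j) 1)) n (Sd K p m s n (monomial f 1)))
    = (fun j => Sd K p m s j (monomial (Function.update e n f j) 1)) := by
    funext j
    by_cases hj : j = n
    · subst hj; simp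
    · simp [Function.update_of_ne hj]
  rw [this]

theorem Ls_Ov [hp : Fact p.Prime] [CharP K p] (hodd : Odd p) (hK : ∀ x : K, x ^ p ^ t = x)
    {I : Submodule K ((Sg m → K) → K)} {s : Fin t → ℕ} (hs : Valid p m s) (hI : Yl K p m s ≤ I)
    {e : Fin t → Sg m →₀ ℕ} (he : ∀ j, (e j).degree = lam p s j) (n : Fin t)
    {g : MvPolynomial (Sg m) K} (hg : g.IsHomogeneous (lam p s n)) (hO : g ∈ Ov K p m) :
    g ∈ Ls I p s e n := by
  rw [mem_Ls, Sd_of_Ov hO]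
  refine hI (overflow hK hs _ n (fun j hj => ?_) ?_ ?_)
  · rw [Function.update_of_ne hj]
    exact Sd_mem_Ad hodd (isHomogeneous_monomial _ (he j))
  · rwa [Function.update_self]
  · rwa [Function.update_self]

theorem Ls_tau [hp : Fact p.Prime] [CharP K p] (hodd : Odd p) (hK : ∀ x : K, x ^ p ^ t = x)
    {I : Submodule K ((Sg m → K) → K)} {s : Fin t → ℕ} (hs : Valid p m s) (hI : Yl K p m s ≤ I)
    {e : Fin t → Sg m →₀ ℕ} (he : ∀ j, (e j).degree = lam p s j) (n : Fin t) (hz : ZZ m s n)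
    {g : MvPolynomial (Sg m) K} (hg : g.IsHomogeneous (lam p s n)) :
    tau p g - g ∈ Ls I p s e n := by
  rw [mem_Ls]
  have e1 : Sd K p m s n (tau p g - g) = tau p (tau p g) - g := by
    rw [Sd_pos hz, map_sub]; ring
  have h1 : (tau p g).IsHomogeneous (lam p s n) := by rw [ZZ_lam hz] at hg ⊢; exact tau_homog hg
  have h2 : (tau p (tau p g)).IsHomogeneous (lam p s n) := by rw [ZZ_lam hz] at h1 ⊢; exact tau_homog h1
  rw [e1, ← Sd_of_Ov (s := s) (j := n) (tau_tau hodd g), ← mem_Ls]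
  exact Ls_Ov hodd hK hs hI he n ((homogeneousSubmodule (Sg m) K _).sub_mem h2 hg) (tau_tau hodd g)

theorem Ls_smul_mono [hp : Fact p.Prime] [CharP K p] {I : Submodule K ((Sg m → K) → K)} {s : Fin t → ℕ}
    {e : Fin t → Sg m →₀ ℕ} {n : Fin t} {f : Sg m →₀ ℕ} {c : K} (hc : c ≠ 0)
    (h : monomial f c ∈ Ls I p s e n) : monomial f 1 ∈ Ls I p s e n := by
  have := (Ls I p s e n).smul_mem c⁻¹ h
  rwa [smul_monomial, smul_eq_mul, inv_mul_cancel₀ hc] at this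

theorem cast_ne [hp : Fact p.Prime] [CharP K p] {a : ℕ} (h1 : 1 ≤ a) (h2 : a ≤ p - 1) : (a : K) ≠ 0 := by
  intro h
  have := (CharP.cast_eq_zero_iff K p a).1 h
  have := Nat.le_of_dvd (by omega) this
  omega


theorem sh_inv {A B : Sg m} (hAB : A ≠ B) {e : Sg m →₀ ℕ} {a : ℕ} (h : a ≤ e B) :
    sh A B a (sh B A a e) = e := by
  ext w
  simp only [sh, Finsupp.coe_add, Finsupp.coe_tsub, Pi.add_apply, Pi.sub_apply, Finsupp.single_apply]
  by_cases h1 : B = w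
  · subst h1; simp [hAB]; omega
  · simp [h1]

theorem sh_apply_A {A B : Sg m} (hAB : A ≠ B) (a : ℕ) (e : Sg m →₀ ℕ) : sh A B a e A = e A - a := by
  simp [sh, Finsupp.single_apply, hAB.symm]

theorem sh_apply_B {A B : Sg m} (hAB : A ≠ B) (a : ℕ) (e : Sg m →₀ ℕ) : sh A B a e B = e B + a := by
  simp [sh, Finsupp.single_apply, hAB]

theorem sh_apply_ne {A B w : Sg m} (hA : w ≠ A) (hB : w ≠ B) (a : ℕ) (e : Sg m →₀ ℕ) :
    sh A B a e w = e w := by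
  simp [sh, Finsupp.single_apply, hA.symm, hB.symm]

theorem sh_degree (A B : Sg m) (a : ℕ) (e : Sg m →₀ ℕ) (h : a ≤ e A) : (sh A B a e).degree = e.degree := by
  have : e = (e - Finsupp.single A a) + Finsupp.single A a := by
    ext w
    simp only [Finsupp.coe_add, Finsupp.coe_tsub, Pi.add_apply, Pi.sub_apply, Finsupp.single_apply]
    split_ifs with h
    · subst h; omega
    · omega
  conv_rhs => rw [this]
  simp [sh]

theorem sh_Rd {A B : Sg m} (hAB : A ≠ B) (a : ℕ) {e : Sg m →₀ ℕ} (he : Rd p e) (h : e B + a ≤ p - 1) :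
    Rd p (sh A B a e) := by
  intro w
  by_cases h1 : w = A
  · subst h1; rw [sh_apply_A hAB]; exact (Nat.sub_le _ _).trans (he w)
  by_cases h2 : w = B
  · subst h2; rw [sh_apply_B hAB]; exact h
  · rw [sh_apply_ne h1 h2]; exact he w

theorem Adm_update {s : Fin t → ℕ} {e : Fin t → Sg m →₀ ℕ} (he : Adm p s e) (n : Fin t)
    {f : Sg m →₀ ℕ} (h1 : Rd p f) (h2 : f.degree = lam p s n) : Adm p s (Function.update e n f) := by
  intro j
  by_cases hj : j = n
  · subst hj; rw [Function.update_self]; exact ⟨h1, h2⟩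
  · rw [Function.update_of_ne hj]; exact he j

theorem Ls_E [hp : Fact p.Prime] [CharP K p] (hp3 : 3 ≤ p) (hodd : Odd p) (hq : Fintype.card K = p ^ t)
    {I : Submodule K ((Sg m → K) → K)}
    (hL : ∀ (i : Fin m) (c : K), ∀ F ∈ Yf K p t m,
      (fun v => F ((Matrix.transvection (Sum.inl i : Sg m) (Sum.inr i) c).mulVec v)) - F ∈ I)
    {s : Fin t → ℕ} (hs : Valid p m s) (hI : Yl K p m s ≤ I)
    {w : Fin t → Sg m →₀ ℕ} (hw : Adm p s w) (n : Fin t) (i : Fin m) (hpos : 1 ≤ w n (Sum.inl i)) :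
    X (Sum.inr i) * pderiv (Sum.inl i) (monomial (w n) (1 : K)) ∈ Ls I p s w n := by
  have hK : ∀ x : K, x ^ p ^ t = x := fun x => by rw [← hq]; exact FiniteField.pow_card x
  have hE := opE (p := p) (t := t) hp3 hq hL (fun j => Sd K p m s j (monomial (w j) 1))
    (fun j => RdS_Sd (hw j).1 1) (Psi_mem_Yf hodd hs (fun j => (hw j).2)) n i
  have hC := Sd_comm_Ei (K := K) (p := p) hodd s n i (monomial (w n) 1)
  have h5 : 1 ≤ lam p s n := by
    rw [← (hw n).2, Finsupp.degree_eq_sum]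
    exact hpos.trans (Finset.single_le_sum (f := fun z => w n z) (fun _ _ => Nat.zero_le _)
      (Finset.mem_univ (Sum.inl i)))
  have hom : ∀ g : MvPolynomial (Sg m) K, g.IsHomogeneous (lam p s n) →
      (X (Sum.inr i) * pderiv (Sum.inl i) g).IsHomogeneous (lam p s n) := by
    intro g hg
    have h4 := (isHomogeneous_X K (Sum.inr i : Sg m)).mul (hg.pderiv (i := Sum.inl i))
    have h6 : 1 + (lam p s n - 1) = lam p s n := by omega
    rwa [h6] at h4
  have hm0 := isHomogeneous_monomial (1 : K) (hw n).2
  have h7 := Ls_Ov (I := I) hodd hK hs hI (fun j => (hw j).2) n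
    ((homogeneousSubmodule (Sg m) K _).sub_mem (Sd_homog (s := s) (j := n) (hom _ hm0))
      (hom _ (Sd_homog (s := s) (j := n) hm0))) hC
  rw [mem_Ls, Sd_of_Ov hC] at h7
  rw [mem_Ls]
  have h8 := add_mem (mem_comapD.2 h7) (mem_comapD.2 hE)
  rw [sub_add_cancel] at h8
  exact mem_comapD.1 h8

/-- (a) -/
theorem killA [hp : Fact p.Prime] [CharP K p] (hp3 : 3 ≤ p) (hodd : Odd p) (hq : Fintype.card K = p ^ t)
    {I : Submodule K ((Sg m → K) → K)}
    (hL : ∀ (i : Fin m) (c : K), ∀ F ∈ Yf K p t m,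
      (fun v => F ((Matrix.transvection (Sum.inl i : Sg m) (Sum.inr i) c).mulVec v)) - F ∈ I)
    {s : Fin t → ℕ} (hs : Valid p m s) (hI : Yl K p m s ≤ I)
    {e : Fin t → Sg m →₀ ℕ} (he : Adm p s e) (n : Fin t) (i : Fin m)
    (h1 : e n (Sum.inl i) ≤ p - 2) (h2 : 1 ≤ e n (Sum.inr i)) : Psi K p s e ∈ I := by
  have hne : (Sum.inl i : Sg m) ≠ Sum.inr i := by simp
  have hw : Adm p s (Function.update e n (sh (Sum.inr i) (Sum.inl i) 1 (e n))) :=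
    Adm_update he n (sh_Rd hne.symm 1 (he n).1 (by omega)) (by rw [sh_degree _ _ _ _ h2, (he n).2])
  have h3 := Ls_E hp3 hodd hq hL hs hI hw n i (by
    rw [Function.update_self, sh_apply_B hne.symm]; omega)
  rw [Function.update_self, ← Hs_one, Hs_monomial, sh_inv hne h2, sh_apply_B hne.symm, Ls_update] at h3
  have h6 := Ls_smul_mono (by simpa using cast_ne (K := K) (p := p) (a := e n (Sum.inl i) + 1) (by omega) (by omega)) h3
  rw [mem_Ls_mono, Function.update_eq_self] at h6
  exact h6

/-- general monomial families -/
theorem Phi_mono_mem [hp : Fact p.Prime] [CharP K p] (hodd : Odd p) (hK : ∀ x : K, x ^ p ^ t = x)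
    {I : Submodule K ((Sg m → K) → K)} {s : Fin t → ℕ} (hs : Valid p m s) (hI : Yl K p m s ≤ I)
    (f : Fin t → Sg m →₀ ℕ) (r : Fin t → K) (hd : ∀ n, r n ≠ 0 → (f n).degree = lam p s n)
    (h : Adm p s f → Psi K p s f ∈ I) :
    Phi p (fun n => Sd K p m s n (monomial (f n) (r n))) ∈ I := by
  have e1 : (fun n => Sd K p m s n (monomial (f n) (r n))) =
      fun n => r n • Sd K p m s n (monomial (f n) 1) := by
    funext n
    rw [← map_smul, smul_monomial, smul_eq_mul, mul_one]
  have e2 : Phi p (fun n => Sd K p m s n (monomial (f n) (r n))) =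
      (∏ n, r n ^ (p ^ (n : ℕ))) • Psi K p s f := by
    rw [e1]
    funext v
    rw [Phi_smul, Pi.smul_apply, smul_eq_mul, Psi]
  rw [e2]
  by_cases h0 : ∃ n, r n = 0
  · obtain ⟨n, hn⟩ := h0
    rw [Finset.prod_eq_zero (Finset.mem_univ n), zero_smul]
    · exact I.zero_mem
    · rw [hn, zero_pow (pow_ne_zero _ hp.out.ne_zero)]
  push Not at h0
  have hd' : ∀ n, (f n).degree = lam p s n := fun n => hd n (h0 n)
  refine I.smul_mem _ ?_
  by_cases hR : ∀ n, Rd p (f n)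
  · exact h (fun n => ⟨hR n, hd' n⟩)
  · push Not at hR
    obtain ⟨n, hn⟩ := hR
    have := Ls_Ov (I := I) hodd hK hs hI hd' n (isHomogeneous_monomial (1 : K) (hd' n)) (monomial_mem_Ov p hn 1)
    rwa [mem_Ls_mono, Function.update_eq_self] at this

theorem Ts_GLm [hp : Fact p.Prime] (i k : Fin m) (c : K) {e : Sg m →₀ ℕ} (he : Rd p e) :
    Ts (GLm i k c) (monomial e (1 : K)) = ∑ κ : Fin p × Fin p, c ^ ((κ.1 : ℕ) + (κ.2 : ℕ)) •
      monomial (sh (Sum.inl k) (Sum.inl i) κ.2 (sh (Sum.inr i) (Sum.inr k) κ.1 e))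
        ((-1) ^ (κ.1 : ℕ) * ((e (Sum.inr i)).choose κ.1 : K) * ((e (Sum.inl k)).choose κ.2 : K)) := by
  have hp1 := hp.out.one_lt
  rw [GLm, ← Ts_Ts, Ts_transv_monomial (p := p) _ _ _ _ _ (by have := he (Sum.inr i); omega), map_sum,
    Fintype.sum_prod_type]
  refine Finset.sum_congr rfl fun a _ => ?_
  have h1 : (sh (Sum.inr i) (Sum.inr k) (a : ℕ) e) (Sum.inl k) = e (Sum.inl k) := by
    rw [sh_apply_ne] <;> simp
  rw [map_smul, Hs_monomial, Ts_transv_monomial (p := p) _ _ _ _ _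
    (by rw [h1]; have := he (Sum.inl k); omega), Finset.smul_sum]
  refine Finset.sum_congr rfl fun b _ => ?_
  rw [Hs_monomial, h1, smul_smul, smul_monomial, smul_monomial]
  congr 1
  rw [neg_pow, pow_add, smul_eq_mul, smul_eq_mul]
  ring

/-- the operator coming from `GL_m` -/
theorem Ls_C [hp : Fact p.Prime] [CharP K p] (hp3 : 3 ≤ p) (hodd : Odd p) (hq : Fintype.card K = p ^ t)
    {I : Submodule K ((Sg m → K) → K)}
    (hL : ∀ (i : Fin m) (c : K), ∀ F ∈ Yf K p t m,
      (fun v => F ((Matrix.transvection (Sum.inl i : Sg m) (Sum.inr i) c).mulVec v)) - F ∈ I)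
    (hGL : ∀ (i k : Fin m) (c : K), i ≠ k → ∀ F ∈ I, (fun v => F ((GLm i k c).mulVec v)) ∈ I)
    {s : Fin t → ℕ} (hs : Valid p m s) (hI : Yl K p m s ≤ I)
    {w : Fin t → Sg m →₀ ℕ} (hw : Adm p s w) (hwI : Psi K p s w ∈ I) (l : Fin t) {i k : Fin m}
    (hik : i ≠ k) :
    monomial (sh (Sum.inl k) (Sum.inl i) 1 (w l)) (w l (Sum.inl k) : K)
      - monomial (sh (Sum.inr i) (Sum.inr k) 1 (w l)) (w l (Sum.inr i) : K) ∈ Ls I p s w l := by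
  have hK : ∀ x : K, x ^ p ^ t = x := fun x => by rw [← hq]; exact FiniteField.pow_card x
  have ht : 1 ≤ t := Nat.one_le_iff_ne_zero.2 (NeZero.ne t)
  have hne1 : (Sum.inl k : Sg m) ≠ Sum.inl i := by simp [hik.symm]
  have hne2 : (Sum.inr i : Sg m) ≠ Sum.inr k := by simp [hik]
  let f : Fin t → Fin p × Fin p → Sg m →₀ ℕ := fun n κ =>
    sh (Sum.inl k) (Sum.inl i) κ.2 (sh (Sum.inr i) (Sum.inr k) κ.1 (w n))
  let r : Fin t → Fin p × Fin p → K := fun n κ =>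
    (-1) ^ (κ.1 : ℕ) * ((w n (Sum.inr i)).choose κ.1 : K) * ((w n (Sum.inl k)).choose κ.2 : K)
  have hTs : ∀ n c, Ts (GLm i k c) (monomial (w n) (1 : K)) =
      ∑ κ : Fin p × Fin p, c ^ ((κ.1 : ℕ) + (κ.2 : ℕ)) • monomial (f n κ) (r n κ) :=
    fun n c => Ts_GLm i k c (hw n).1
  have hfd : ∀ n κ, r n κ ≠ 0 → (f n κ).degree = lam p s n := by
    intro n κ hr
    have h1 : (κ.1 : ℕ) ≤ w n (Sum.inr i) := by
      by_contra hc
      apply hr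
      simp only [r]
      rw [Nat.choose_eq_zero_of_lt (by omega)]; simp
    have h2 : (κ.2 : ℕ) ≤ w n (Sum.inl k) := by
      by_contra hc
      apply hr
      simp only [r]
      rw [Nat.choose_eq_zero_of_lt (n := w n (Sum.inl k)) (by omega)]; simp
    simp only [f]
    rw [sh_degree _ _ _ _ (by rw [sh_apply_ne (by simp) (by simp)]; exact h2), sh_degree _ _ _ _ h1, (hw n).2]
  have hx := extract1 (p := p) (t := t) hp3 ht hq I (fun κ : Fin p × Fin p => (κ.1 : ℕ) + (κ.2 : ℕ))
    (⟨0, by omega⟩, ⟨0, by omega⟩)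
    (fun κ => by rw [Prod.ext_iff, Fin.ext_iff, Fin.ext_iff]; simp)
    (fun n κ => Sd K p m s n (monomial (f n κ) (r n κ))) 0
    (fun c => by
      have h1 := hGL i k c hik _ hwI
      have e0 : (fun v => Psi K p s w ((GLm i k c).mulVec v)) =
          Phi p (fun j => Ts (GLm i k c) (Sd K p m s j (monomial (w j) 1))) := funext (Phi_Ts _ _)
      rw [e0] at h1
      have e1 : (fun n => ∑ κ : Fin p × Fin p, c ^ ((κ.1 : ℕ) + (κ.2 : ℕ)) • Sd K p m s n (monomial (f n κ) (r n κ)))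
          = fun n => Sd K p m s n (Ts (GLm i k c) (monomial (w n) 1)) := by
        funext n
        rw [hTs, map_sum]
        simp only [map_smul]
      rw [sub_zero, e1]
      have hgood : Good (GLm i k c) := good_GL hik c
      have hm0 := fun n => isHomogeneous_monomial (1 : K) (hw n).2
      have h2 := hI (Phi_congr hK hs (fun j => Ts (GLm i k c) (Sd K p m s j (monomial (w j) 1)))
        (fun n => Sd K p m s n (Ts (GLm i k c) (monomial (w n) 1)))
        (fun j => by
          have hA : Sd K p m s j (monomial (w j) 1) ∈ Ad K p m s j := Sd_mem_Ad hodd (hm0 j)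
          refine ⟨Ts_homog hA.1, fun hz => ?_⟩
          have h1 := tau_Ts p hgood.symp (hgood.pow p) (Sd K p m s j (monomial (w j) 1))
          have h2 := Ts_mem_Ov p (hA.2 hz) (GLm i k c)
          rw [map_sub] at h2
          have := add_mem h1 h2
          rwa [sub_add_sub_cancel] at this)
        (fun j => Sd_mem_Ad hodd (Ts_homog (hm0 j)))
        (fun j => Sd_comm_Ts s j hgood _))
      have h3 := add_mem h2 h1
      rwa [sub_add_cancel] at h3)
    (fun κ hκ => by
      refine Phi_mono_mem hodd hK hs hI (fun n => f n (κ n)) (fun n => r n (κ n)) (fun n => hfd n (κ n)) ?_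
      intro hA
      obtain ⟨n, hn⟩ := hκ
      have h1 := (κ n).1.isLt
      have h2 := (κ n).2.isLt
      have h3 := (hw n).1 (Sum.inl k)
      refine killA hp3 hodd hq hL hs hI hA n k ?_ ?_
      · simp only [f]
        rw [sh_apply_A hne1, sh_apply_ne (by simp) (by simp)]
        omega
      · simp only [f]
        rw [sh_apply_ne (by simp) (by simp), sh_apply_B hne2]
        omega) l
  have e3 : ∀ n, monomial (f n (⟨0, by omega⟩, ⟨0, by omega⟩)) (r n (⟨0, by omega⟩, ⟨0, by omega⟩)) =
      (monomial (w n) 1 : MvPolynomial (Sg m) K) := by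
    intro n
    simp [f, r, sh]
  simp only [e3] at hx
  rw [mem_Ls]
  have e4 : (∑ κ : Fin p × Fin p, if (κ.1 : ℕ) + (κ.2 : ℕ) = 1 then Sd K p m s l (monomial (f l κ) (r l κ)) else 0) =
      Sd K p m s l (monomial (sh (Sum.inl k) (Sum.inl i) 1 (w l)) (w l (Sum.inl k) : K)
      - monomial (sh (Sum.inr i) (Sum.inr k) 1 (w l)) (w l (Sum.inr i) : K)) := by
    have hnn : ((⟨0, by omega⟩, ⟨1, by omega⟩) : Fin p × Fin p) ≠ (⟨1, by omega⟩, ⟨0, by omega⟩) := by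
      intro h
      have := congrArg (fun z => (z.1 : ℕ)) h
      simp at this
    rw [Finset.sum_eq_add_of_mem _ _ (Finset.mem_univ (⟨0, by omega⟩, ⟨1, by omega⟩))
      (Finset.mem_univ (⟨1, by omega⟩, ⟨0, by omega⟩)) hnn]
    · have z1 : ∀ A B : Sg m, ∀ e : Sg m →₀ ℕ, sh A B 0 e = e := by intro A B e; simp [sh]
      simp only [f, r, z1, zero_add, add_zero, if_true]
      rw [map_sub, sub_eq_add_neg, ← map_neg, ← map_neg]
      simp
    · rintro ⟨a, b⟩ _ ⟨h1, h2⟩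
      rw [if_neg]
      intro h3
      simp only at h3
      rcases Nat.add_eq_one_iff.1 h3 with ⟨h4, h5⟩ | ⟨h4, h5⟩
      · exact h1 (Prod.ext (Fin.ext h4) (Fin.ext h5))
      · exact h2 (Prod.ext (Fin.ext h4) (Fin.ext h5))
  rw [e4] at hx
  exact hx

end core
end SP

namespace SP
open MvPolynomial

section ds
variable {K : Type*} [Field K] {p : ℕ} {m : ℕ}

/-- one-digit facts -/
structure DS (L : Submodule K (MvPolynomial (Sg m) K)) (p d : ℕ) (z : Prop) : Prop where
  ov : ∀ f : Sg m →₀ ℕ, f.degree = d → ¬ Rd p f → ∀ c : K, monomial f c ∈ L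
  ka : ∀ f : Sg m →₀ ℕ, f.degree = d → Rd p f → ∀ i : Fin m, f (Sum.inl i) ≤ p - 2 → 1 ≤ f (Sum.inr i) →
    monomial f 1 ∈ L
  kc : ∀ f : Sg m →₀ ℕ, f.degree = d → Rd p f → monomial f 1 ∈ L → ∀ i k : Fin m, i ≠ k →
    monomial (sh (Sum.inl k) (Sum.inl i) 1 f) (f (Sum.inl k) : K)
      - monomial (sh (Sum.inr i) (Sum.inr k) 1 f) (f (Sum.inr i) : K) ∈ L
  kt : z → ∀ f : Sg m →₀ ℕ, f.degree = d → Rd p f → monomial (bar p f) (sgn K f) - monomial f 1 ∈ L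

def sw (i k : Fin m) (f : Sg m →₀ ℕ) : Sg m →₀ ℕ :=
  Finsupp.equivFunOnFinite.symm
    (fun z => f (Sum.map (Equiv.swap i k) (Equiv.swap i k) z))

@[simp] theorem sw_inl (i k j : Fin m) (f : Sg m →₀ ℕ) : sw i k f (Sum.inl j) = f (Sum.inl (Equiv.swap i k j)) := rfl
@[simp] theorem sw_inr (i k j : Fin m) (f : Sg m →₀ ℕ) : sw i k f (Sum.inr j) = f (Sum.inr (Equiv.swap i k j)) := rfl

theorem sw_degree (i k : Fin m) (f : Sg m →₀ ℕ) : (sw i k f).degree = f.degree := by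
  rw [Finsupp.degree_eq_sum, Finsupp.degree_eq_sum, Fintype.sum_sum_type, Fintype.sum_sum_type]
  simp only [sw_inl, sw_inr]
  rw [Equiv.sum_comp (Equiv.swap i k) (fun j => f (Sum.inl j)), Equiv.sum_comp (Equiv.swap i k) (fun j => f (Sum.inr j))]

theorem sw_Rd (i k : Fin m) {f : Sg m →₀ ℕ} (h : Rd p f) : Rd p (sw i k f) := fun _ => h _

theorem deg_two (f : Sg m →₀ ℕ) : f.degree = ∑ i, (f (Sum.inl i) + f (Sum.inr i)) := by
  rw [Finsupp.degree_eq_sum, Fintype.sum_sum_type, Finset.sum_add_distrib]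

theorem DS.swap {L : Submodule K (MvPolynomial (Sg m) K)} {d : ℕ} {z : Prop} (D : DS L p d z) (hp3 : 3 ≤ p)
    {f : Sg m →₀ ℕ} (hd : f.degree = d) (hR : Rd p f) {i k : Fin m} (hik : i ≠ k)
    (hk : 1 ≤ f (Sum.inr k)) (hi : f (Sum.inr i) = 0)
    (hw : monomial (sh (Sum.inr k) (Sum.inr i) 1 f) (1 : K) ∈ L) :
    monomial (sh (Sum.inl k) (Sum.inl i) 1 (sh (Sum.inr k) (Sum.inr i) 1 f)) (f (Sum.inl k) : K)
      - monomial f 1 ∈ L := by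
  have hne : (Sum.inr k : Sg m) ≠ Sum.inr i := by simp [hik.symm]
  have := D.kc _ (by rw [sh_degree _ _ _ _ hk, hd]) (sh_Rd hne 1 hR (by omega)) hw i k hik
  rwa [sh_inv hne.symm hk, sh_apply_B hne, hi, sh_apply_ne (by simp) (by simp), zero_add, Nat.cast_one] at this

theorem neg_one_cast [Fact p.Prime] [CharP K p] : ((p - 1 : ℕ) : K) = -1 := by
  rw [Nat.cast_sub (Fact.out : p.Prime).one_le]; simp

theorem DS.pair [hp : Fact p.Prime] [CharP K p] {L : Submodule K (MvPolynomial (Sg m) K)} {d : ℕ} {z : Prop}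
    (D : DS L p d z) (hp3 : 3 ≤ p)
    {f : Sg m →₀ ℕ} (hd : f.degree = d) (hR : Rd p f) (hf : monomial f (1 : K) ∉ L) {i k : Fin m}
    (hi : f (Sum.inl i) ≤ p - 2) (hk : 1 ≤ f (Sum.inr k)) :
    i ≠ k ∧ f (Sum.inl i) = p - 2 ∧ f (Sum.inr i) = 0 ∧ f (Sum.inl k) = p - 1 ∧ f (Sum.inr k) = 1 ∧
      monomial (sw i k f) 1 + monomial f (1 : K) ∈ L := by
  have hi0 : f (Sum.inr i) = 0 := by
    by_contra h
    exact hf (D.ka f hd hR i hi (by omega))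
  have hk0 : f (Sum.inl k) = p - 1 := by
    by_contra h
    have := hR (Sum.inl k)
    exact hf (D.ka f hd hR k (by omega) hk)
  have hik : i ≠ k := by rintro rfl; omega
  have hne : (Sum.inr k : Sg m) ≠ Sum.inr i := by simp [hik.symm]
  have hnl : (Sum.inl k : Sg m) ≠ Sum.inl i := by simp [hik.symm]
  have hw1 := sh_Rd hne 1 hR (by omega)
  have hw := D.ka _ (by rw [sh_degree _ _ _ _ hk, hd]) hw1 i
    (by rw [sh_apply_ne (by simp) (by simp)]; exact hi) (by rw [sh_apply_B hne]; omega)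
  have hs := D.swap hp3 hd hR hik hk hi0 hw
  have hs2 : monomial (sh (Sum.inl k) (Sum.inl i) 1 (sh (Sum.inr k) (Sum.inr i) 1 f)) (1 : K)
      + monomial f 1 ∈ L := by
    have h1 := L.neg_mem hs
    rw [hk0, neg_one_cast, map_neg] at h1
    convert h1 using 1
    abel
  set w2 := sh (Sum.inl k) (Sum.inl i) 1 (sh (Sum.inr k) (Sum.inr i) 1 f) with hw2
  have w2d : w2.degree = d := by
    rw [hw2, sh_degree, sh_degree _ _ _ _ hk, hd]
    rw [sh_apply_ne (by simp) (by simp)]; omega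
  have w2R : Rd p w2 := sh_Rd hnl 1 hw1 (by rw [sh_apply_ne (by simp) (by simp)]; omega)
  have w2n : monomial w2 (1 : K) ∉ L := fun h => hf (by
    have := sub_mem hs2 h
    rwa [add_sub_cancel_left] at this)
  have a1 : w2 (Sum.inl i) = f (Sum.inl i) + 1 := by
    rw [hw2, sh_apply_B hnl, sh_apply_ne (by simp) (by simp)]
  have a2 : w2 (Sum.inr i) = 1 := by
    rw [hw2, sh_apply_ne (by simp) (by simp), sh_apply_B hne, hi0]
  have a3 : w2 (Sum.inl k) = p - 2 := by
    rw [hw2, sh_apply_A hnl, sh_apply_ne (by simp) (by simp)]; omega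
  have a4 : w2 (Sum.inr k) = f (Sum.inr k) - 1 := by
    rw [hw2, sh_apply_ne (by simp) (by simp), sh_apply_A hne]
  have hi2 : f (Sum.inl i) = p - 2 := by
    by_contra h
    exact w2n (D.ka w2 w2d w2R i (by omega) (by omega))
  have hk2 : f (Sum.inr k) = 1 := by
    by_contra h
    exact w2n (D.ka w2 w2d w2R k (by omega) (by omega))
  refine ⟨hik, hi2, hi0, hk0, hk2, ?_⟩
  have : w2 = sw i k f := by
    ext y
    rcases y with j | j
    · rw [sw_inl]
      by_cases h1 : j = i
      · subst h1; rw [a1, Equiv.swap_apply_left]; omega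
      by_cases h2 : j = k
      · subst h2; rw [a3, Equiv.swap_apply_right]; omega
      rw [Equiv.swap_apply_of_ne_of_ne h1 h2, hw2, sh_apply_ne (by simp [h2]) (by simp [h1]), sh_apply_ne (by simp) (by simp)]
    · rw [sw_inr]
      by_cases h1 : j = i
      · subst h1; rw [a2, Equiv.swap_apply_left]; omega
      by_cases h2 : j = k
      · subst h2; rw [a4, Equiv.swap_apply_right]; omega
      rw [Equiv.swap_apply_of_ne_of_ne h1 h2, hw2, sh_apply_ne (by simp) (by simp), sh_apply_ne (by simp [h2]) (by simp [h1])]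
  rw [← this]
  exact hs2

theorem two_mono {L : Submodule K (MvPolynomial (Sg m) K)} (h2 : (2 : K) ≠ 0) {f g : Sg m →₀ ℕ}
    (h : monomial g 1 + monomial f (1 : K) ∈ L) (h' : monomial g 1 - monomial f (1 : K) ∈ L) :
    monomial f (1 : K) ∈ L := by
  have h3 := sub_mem h h'
  have h4 : monomial g 1 + monomial f (1 : K) - (monomial g 1 - monomial f (1 : K)) = (2 : K) • monomial f (1 : K) := by
    rw [two_smul]; abel
  rw [h4] at h3
  have := L.smul_mem (2 : K)⁻¹ h3
  rwa [smul_smul, inv_mul_cancel₀ h2, one_smul] at this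

theorem DS.minus [hp : Fact p.Prime] [CharP K p] {L : Submodule K (MvPolynomial (Sg m) K)} {d : ℕ} {z : Prop}
    (D : DS L p d z) (hp3 : 3 ≤ p) (h2 : (2 : K) ≠ 0)
    {f : Sg m →₀ ℕ} (hd : f.degree = d) (hR : Rd p f) (hf : monomial f (1 : K) ∉ L) {i k : Fin m}
    (hi : f (Sum.inl i) ≤ p - 2) (hk : 1 ≤ f (Sum.inr k)) :
    ∀ h, h ≠ i → h ≠ k → f (Sum.inl h) = p - 1 ∧ f (Sum.inr h) = 0 := by
  intro h hhi hhk
  obtain ⟨hik, b1, b2, b3, b4, b5⟩ := D.pair hp3 hd hR hf hi hk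
  have gn : monomial (sw i k f) (1 : K) ∉ L := fun h => hf (by
    have := sub_mem b5 h
    rwa [add_sub_cancel_left] at this)
  constructor
  · by_contra hc
    have hc' : f (Sum.inl h) ≤ p - 2 := by have := hR (Sum.inl h); omega
    obtain ⟨-, c1, c2, c3, c4, c5⟩ := D.pair hp3 hd hR hf hc' hk
    obtain ⟨-, d1, d2, d3, d4, d5⟩ := D.pair (i := h) (k := i) hp3 (by rw [sw_degree, hd]) (sw_Rd i k hR) gn
      (by rw [sw_inl, Equiv.swap_apply_of_ne_of_ne hhi hhk]; exact hc')
      (by rw [sw_inr, Equiv.swap_apply_left]; exact hk)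
    have e : sw h i (sw i k f) = sw h k f := by
      ext y
      rcases y with j | j
      all_goals
        simp only [sw_inl, sw_inr]
        by_cases h1 : j = h
        · subst h1; simp
        by_cases h3 : j = i
        · subst h3
          rw [Equiv.swap_apply_right, Equiv.swap_apply_of_ne_of_ne hhi hhk, Equiv.swap_apply_of_ne_of_ne hhi.symm hik]
          omega
        by_cases h4 : j = k
        · subst h4
          rw [Equiv.swap_apply_of_ne_of_ne hhk.symm hik.symm, Equiv.swap_apply_right, Equiv.swap_apply_right]
          omega
        rw [Equiv.swap_apply_of_ne_of_ne h1 h3, Equiv.swap_apply_of_ne_of_ne h3 h4, Equiv.swap_apply_of_ne_of_ne h1 h4]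
    rw [e] at d5
    apply hf
    refine two_mono h2 c5 ?_
    convert sub_mem d5 b5 using 1
    abel
  · by_contra hc
    have hc' : 1 ≤ f (Sum.inr h) := by omega
    obtain ⟨-, c1, c2, c3, c4, c5⟩ := D.pair hp3 hd hR hf hi hc'
    obtain ⟨-, d1, d2, d3, d4, d5⟩ := D.pair (i := k) (k := h) hp3 (by rw [sw_degree, hd]) (sw_Rd i k hR) gn
      (by rw [sw_inl, Equiv.swap_apply_right]; exact hi)
      (by rw [sw_inr, Equiv.swap_apply_of_ne_of_ne hhi hhk]; exact hc')
    have e : sw k h (sw i k f) = sw i h f := by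
      ext y
      rcases y with j | j
      all_goals
        simp only [sw_inl, sw_inr]
        by_cases h1 : j = h
        · subst h1; simp
        by_cases h3 : j = i
        · subst h3
          rw [Equiv.swap_apply_of_ne_of_ne hik hhi.symm, Equiv.swap_apply_left, Equiv.swap_apply_left]
          omega
        by_cases h4 : j = k
        · subst h4
          rw [Equiv.swap_apply_left, Equiv.swap_apply_of_ne_of_ne hhi hhk, Equiv.swap_apply_of_ne_of_ne hik.symm hhk.symm]
          omega
        rw [Equiv.swap_apply_of_ne_of_ne h4 h1, Equiv.swap_apply_of_ne_of_ne h3 h4, Equiv.swap_apply_of_ne_of_ne h3 h1]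
    rw [e] at d5
    apply hf
    refine two_mono h2 c5 ?_
    convert sub_mem d5 b5 using 1
    abel

theorem sgn_minus [hp : Fact p.Prime] [CharP K p] {f : Sg m →₀ ℕ} {i k : Fin m} (hp3 : 3 ≤ p) (hik : i ≠ k)
    (h1 : f (Sum.inl i) = p - 2) (h2 : f (Sum.inr i) = 0) (h3 : f (Sum.inl k) = p - 1) (h4 : f (Sum.inr k) = 1)
    (h5 : ∀ h, h ≠ i → h ≠ k → f (Sum.inl h) = p - 1 ∧ f (Sum.inr h) = 0) : sgn K f = 1 := by
  have w0 := fact_wilson (K := K) p 0 (by omega)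
  have w1 := fact_wilson (K := K) p 1 (by omega)
  rw [show p - 1 - 1 = p - 2 by omega] at w1
  simp at w0 w1
  have e1 : ∑ j, f (Sum.inr j) = 1 := by
    rw [Finset.sum_eq_single k, h4]
    · intro b _ hb
      by_cases hbi : b = i
      · rw [hbi, h2]
      · exact (h5 b hbi hb).2
    · simp
  have e2 : ∏ j, ((f (Sum.inr j)).factorial : K) = 1 := by
    refine Finset.prod_eq_one fun b _ => ?_
    by_cases hbi : b = i
    · rw [hbi, h2]; simp
    by_cases hbk : b = k
    · rw [hbk, h4]; simp
    · rw [(h5 b hbi hbk).2]; simp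
  have e3 : ∏ j, ((f (Sum.inl j)).factorial : K) = (-1) ^ (m - 1) := by
    rw [← Finset.mul_prod_erase _ _ (Finset.mem_univ i), h1, w1, one_mul,
      Finset.prod_congr rfl (g := fun _ => (-1 : K))]
    · simp
    · intro b hb
      have hbi := (Finset.mem_erase.1 hb).1
      by_cases hbk : b = k
      · rw [hbk, h3, w0]
      · rw [(h5 b hbi hbk).1, w0]
  have hm : 1 ≤ m := by have := i.isLt; omega
  rw [sgn, Fintype.prod_sum_type, e1, e2, e3, mul_one, ← pow_add]
  rw [show 1 + m + (m - 1) = m + m by omega]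
  exact Even.neg_one_pow ⟨m, rfl⟩

theorem DS.main [hp : Fact p.Prime] [CharP K p] {L : Submodule K (MvPolynomial (Sg m) K)} {d : ℕ} {z : Prop}
    (D : DS L p d z) (hp3 : 3 ≤ p) (h2 : (2 : K) ≠ 0) (hz : z → d = m * (p - 1))
    {f : Sg m →₀ ℕ} (hd : f.degree = d) (hR : Rd p f) (hf : monomial f (1 : K) ∉ L) {k : Fin m}
    (hk : 1 ≤ f (Sum.inr k)) :
    ¬ z ∧ m * (p - 1) ≤ d ∧ (d ≠ m * (p - 1) → ∀ i, f (Sum.inl i) = p - 1) := by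
  by_cases hfull : ∀ i, f (Sum.inl i) = p - 1
  · have hlt : m * (p - 1) < d := by
      rw [← hd, deg_two]
      have : ∑ i : Fin m, (p - 1) = m * (p - 1) := by simp
      rw [← this]
      refine Finset.sum_lt_sum (fun i _ => by rw [hfull]; omega) ⟨k, Finset.mem_univ _, by rw [hfull]; omega⟩
    exact ⟨fun h => by have := hz h; omega, hlt.le, fun _ => hfull⟩
  · push Not at hfull
    obtain ⟨i, hi⟩ := hfull
    have hi' : f (Sum.inl i) ≤ p - 2 := by have := hR (Sum.inl i); omega
    obtain ⟨hik, b1, b2, b3, b4, b5⟩ := D.pair hp3 hd hR hf hi' hk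
    have hm := D.minus hp3 h2 hd hR hf hi' hk
    have hdeg : d = m * (p - 1) := by
      rw [← hd, deg_two, ← Finset.add_sum_erase _ _ (Finset.mem_univ i),
        ← Finset.add_sum_erase _ _ (Finset.mem_erase.2 ⟨hik.symm, Finset.mem_univ k⟩), b1, b2, b3, b4,
        Finset.sum_congr rfl (g := fun _ => p - 1)]
      · rw [Finset.sum_const, Finset.card_erase_of_mem (Finset.mem_erase.2 ⟨hik.symm, Finset.mem_univ k⟩),
          Finset.card_erase_of_mem (Finset.mem_univ i), Finset.card_univ, Fintype.card_fin, smul_eq_mul]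
        have hm2 : 2 ≤ m := by
          have := i.isLt
          have := k.isLt
          have : (i : ℕ) ≠ k := fun h => hik (Fin.ext h)
          omega
        obtain ⟨m', rfl⟩ := Nat.exists_eq_add_of_le hm2
        rw [show 2 + m' - 1 - 1 = m' by omega, add_mul]
        omega
      · intro b hb
        simp only [Finset.mem_erase] at hb
        have := hm b hb.2.1 hb.1
        omega
    refine ⟨fun hzz => hf ?_, hdeg.ge, fun h => absurd hdeg h⟩
    have ht := D.kt hzz f hd hR
    rw [sgn_minus hp3 hik b1 b2 b3 b4 hm] at ht
    have e : bar p f = sw i k f := by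
      ext y
      rw [bar_apply]
      rcases y with j | j
      all_goals
        simp only [Sum.swap_inl, Sum.swap_inr, sw_inl, sw_inr]
        by_cases h1 : j = i
        · subst h1; rw [Equiv.swap_apply_left]; omega
        by_cases h2 : j = k
        · subst h2; rw [Equiv.swap_apply_right]; omega
        rw [Equiv.swap_apply_of_ne_of_ne h1 h2]
        have := hm j h1 h2
        omega
    rw [e] at ht
    exact two_mono h2 b5 ht

end ds

section ctx
variable {K : Type*} [Field K] [Fintype K] {p : ℕ} {t m : ℕ} [NeZero t]

theorem mkDS [hp : Fact p.Prime] [CharP K p] (hp3 : 3 ≤ p) (hodd : Odd p) (hq : Fintype.card K = p ^ t)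
    {I : Submodule K ((Sg m → K) → K)}
    (hL : ∀ (i : Fin m) (c : K), ∀ F ∈ Yf K p t m,
      (fun v => F ((Matrix.transvection (Sum.inl i : Sg m) (Sum.inr i) c).mulVec v)) - F ∈ I)
    (hGL : ∀ (i k : Fin m) (c : K), i ≠ k → ∀ F ∈ I, (fun v => F ((GLm i k c).mulVec v)) ∈ I)
    {s : Fin t → ℕ} (hs : Valid p m s) (hI : Yl K p m s ≤ I)
    {e : Fin t → Sg m →₀ ℕ} (he : Adm p s e) (l : Fin t) : DS (Ls I p s e l) p (lam p s l) (ZZ m s l) := by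
  have hK : ∀ x : K, x ^ p ^ t = x := fun x => by rw [← hq]; exact FiniteField.pow_card x
  refine ⟨?_, ?_, ?_, ?_⟩
  · intro f hd hR c
    exact Ls_Ov hodd hK hs hI (fun j => (he j).2) l (isHomogeneous_monomial _ hd) (monomial_mem_Ov p hR c)
  · intro f hd hR i h1 h2
    rw [mem_Ls_mono]
    exact killA hp3 hodd hq hL hs hI (Adm_update he l hR hd) l i (by rwa [Function.update_self])
      (by rwa [Function.update_self])
  · intro f hd hR hf i k hik
    rw [mem_Ls_mono] at hf
    have := Ls_C hp3 hodd hq hL hGL hs hI (Adm_update he l hR hd) hf l hik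
    rwa [Function.update_self, Ls_update] at this
  · intro hz f hd hR
    have := Ls_tau (I := I) hodd hK hs hI (fun j => (he j).2) l hz (isHomogeneous_monomial (1 : K) hd)
    rwa [tau_monomial, if_pos hR, one_mul] at this

end ctx
end SP

namespace SP
open MvPolynomial

section dk
variable {K : Type*} [Field K] {p : ℕ} {t m : ℕ} [NeZero t]

theorem transfer (hK : ∀ x : K, x ^ p ^ t = x) (h h' g : Fin t → ℕ)
    (hg : ∀ n, h n + g n = h' n + p * g (n + 1)) (a b : Fin t) (ha : h a ≠ 0) (hb : h' b ≠ 0) (hp0 : p ≠ 0) (x : K) :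
    ∏ n, (x ^ h n) ^ p ^ (n : ℕ) = ∏ n, (x ^ h' n) ^ p ^ (n : ℕ) := by
  by_cases hx : x = 0
  · rw [Finset.prod_eq_zero (Finset.mem_univ a), Finset.prod_eq_zero (Finset.mem_univ b)]
    · rw [hx, zero_pow hb, zero_pow (pow_ne_zero _ hp0)]
    · rw [hx, zero_pow ha, zero_pow (pow_ne_zero _ hp0)]
  have e1 : ∏ n, (x ^ (p * g (n + 1))) ^ p ^ (n : ℕ) = ∏ n, (x ^ g n) ^ p ^ (n : ℕ) := by
    rw [← Equiv.prod_comp (Equiv.addRight (1 : Fin t)) (fun n : Fin t => (x ^ g n) ^ p ^ (n : ℕ))]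
    refine Finset.prod_congr rfl fun n _ => ?_
    rw [Equiv.coe_addRight, wrap_pow hK, ← pow_mul (n := p), mul_comm p]
  have hne : ∏ n, (x ^ g n) ^ p ^ (n : ℕ) ≠ 0 :=
    Finset.prod_ne_zero_iff.2 fun n _ => pow_ne_zero _ (pow_ne_zero _ hx)
  apply mul_right_cancel₀ hne
  conv_rhs => rw [← e1]
  rw [← Finset.prod_mul_distrib, ← Finset.prod_mul_distrib]
  refine Finset.prod_congr rfl fun n _ => ?_
  rw [← mul_pow, ← mul_pow, ← pow_add, ← pow_add, hg]

theorem sgn_full [hp : Fact p.Prime] [CharP K p] {f : Sg m →₀ ℕ} (h1 : ∀ i, f (Sum.inl i) = p - 1)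
    (h2 : ∀ i, f (Sum.inr i) = 0) : sgn K f = 1 := by
  have w0 := fact_wilson (K := K) p 0 (by omega)
  simp at w0
  rw [sgn, Fintype.prod_sum_type]
  simp only [h1, h2, w0]
  simp [← mul_pow]

theorem Sd_full [hp : Fact p.Prime] [CharP K p] {s : Fin t → ℕ} {n : Fin t} (hz : ZZ m s n) {f : Sg m →₀ ℕ}
    (h1 : ∀ i, f (Sum.inl i) = p - 1)
    (h2 : ∀ i, f (Sum.inr i) = 0) : Sd K p m s n (monomial f 1) = (2 : K) • monomial f 1 := by
  have hR : Rd p f := by rintro (i | i) <;> simp [h1, h2]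
  have hb : bar p f = f := by
    ext y
    rcases y with i | i <;> simp [h1, h2]
  rw [Sd_pos hz, tau_monomial, if_pos hR, sgn_full h1 h2, two_smul, mul_one, hb]

theorem full_y0 {f : Sg m →₀ ℕ} (h1 : ∀ i, f (Sum.inl i) = p - 1) (hd : f.degree = m * (p - 1)) (i : Fin m) :
    f (Sum.inr i) = 0 := by
  rw [deg_two, Finset.sum_add_distrib] at hd
  simp only [h1, Finset.sum_const, Finset.card_univ, Fintype.card_fin, smul_eq_mul, Nat.add_eq_left] at hd
  exact (Finset.sum_eq_zero_iff.1 hd) i (Finset.mem_univ _)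

theorem deg_full {f : Sg m →₀ ℕ} (h1 : ∀ i, f (Sum.inl i) = p - 1) (h2 : ∀ i, f (Sum.inr i) = 0) :
    f.degree = m * (p - 1) := by
  rw [deg_two]; simp [h1, h2]

variable [Fintype K]

theorem directKill [hp : Fact p.Prime] [CharP K p] (hp3 : 3 ≤ p) (hodd : Odd p) (hq : Fintype.card K = p ^ t)
    {I : Submodule K ((Sg m → K) → K)}
    (hL : ∀ (i : Fin m) (c : K), ∀ F ∈ Yf K p t m,
      (fun v => F ((Matrix.transvection (Sum.inl i : Sg m) (Sum.inr i) c).mulVec v)) - F ∈ I)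
    {s : Fin t → ℕ} (hs : Valid p m s)
    {e : Fin t → Sg m →₀ ℕ} (he : Adm p s e) (l j : Fin t) (i : Fin m) (g : Fin t → ℕ)
    (gl : g l = 0) (gl1 : g (l + 1) = 1) (gj : g j = 1) (gj1 : g (j + 1) = 0)
    (gn : ∀ n, n ≠ l → n ≠ j → g n = g (n + 1)) (g01 : ∀ n, g n ≤ 1)
    (hgs : ∀ n, g n = 1 → s n < m)
    (hl1 : e l (Sum.inl i) ≤ p - 2) (hl2 : e l (Sum.inr i) = 0)
    (hb1 : ∀ n, n ≠ j → g n = 1 → ∀ k, e n (Sum.inl k) = p - 1 ∧ e n (Sum.inr k) = 0)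
    (hj1 : 1 ≤ e j (Sum.inr i)) (hj2 : lam p s j = m * (p - 1) + 1 → ∀ k, e j (Sum.inl k) = p - 1) :
    Psi K p s e ∈ I := by
  have hK : ∀ x : K, x ^ p ^ t = x := fun x => by rw [← hq]; exact FiniteField.pow_card x
  have hlj : l ≠ j := by rintro rfl; omega
  have h2K : (2 : K) ≠ 0 := two_ne hodd
  -- the new type
  have hlamj : 1 ≤ lam p s j := by
    rw [← (he j).2, Finsupp.degree_eq_sum]
    exact hj1.trans (Finset.single_le_sum (f := fun z => e j z) (fun _ _ => Nat.zero_le _)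
      (Finset.mem_univ (Sum.inr i)))
  have hs' : Valid p m (fun n => s n + g n) := by
    intro n
    obtain ⟨a1, a2, a3⟩ := hs n
    refine ⟨le_trans a1 (Nat.le_add_right _ _), ?_, ?_⟩
    · show s n + g n ≤ m
      have := g01 n
      by_cases h : g n = 1
      · have := hgs n h; omega
      · omega
    · simp only
      rw [mul_add]
      by_cases h : n = j
      · subst h; rw [lam] at hlamj; omega
      by_cases h' : n = l
      · subst h'; omega
      have := gn n h' h
      rw [← this]
      nlinarith [g01 n]
  have hlam : ∀ n, lam p (fun n => s n + g n) n + g n = lam p s n + p * g (n + 1) := by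
    intro n
    have := (hs n).2.2
    have h2 := (hs' n).2.2
    simp only [lam] at *
    rw [mul_add] at *
    omega
  -- exponents
  let w : Fin t → Sg m →₀ ℕ := fun n =>
    if n = l then e l + Finsupp.single (Sum.inl i) 1 + Finsupp.single (Sum.inr i) (p - 1)
    else if n = j then e j - Finsupp.single (Sum.inr i) 1
    else e n + Finsupp.single (Sum.inr i) ((p - 1) * g n)
  have wl : w l = e l + Finsupp.single (Sum.inl i) 1 + Finsupp.single (Sum.inr i) (p - 1) := if_pos rfl
  have wj : w j = e j - Finsupp.single (Sum.inr i) 1 := by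
    simp [w, hlj.symm]
  have wn : ∀ n, n ≠ l → n ≠ j → w n = e n + Finsupp.single (Sum.inr i) ((p - 1) * g n) := by
    intro n h1 h2
    simp only [w]; rw [if_neg h1, if_neg h2]
  have ej : e j = w j + Finsupp.single (Sum.inr i) 1 := by
    rw [wj]
    ext y
    simp only [Finsupp.coe_add, Finsupp.coe_tsub, Pi.add_apply, Pi.sub_apply, Finsupp.single_apply]
    split_ifs with h
    · subst h; omega
    · omega
  have hw : Adm p (fun n => s n + g n) w := by
    intro n
    have hln := hlam n
    by_cases h : n = j
    · subst h
      constructor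
      · intro y
        have h1 := (he n).1 y
        rw [ej] at h1
        exact (Nat.le_add_right _ _).trans h1
      · have := (he n).2
        rw [ej, map_add, Finsupp.degree_single] at this
        rw [gj, gj1] at hln
        omega
    by_cases h' : n = l
    · subst h'
      rw [wl]
      constructor
      · intro y
        have h1 := (he n).1 y
        simp only [Finsupp.coe_add, Pi.add_apply, Finsupp.single_apply]
        rcases y with y | y
        · by_cases hy : i = y
          · subst hy; simp; omega
          · simp [hy]; omega
        · by_cases hy : i = y
          · subst hy; simp; omega
          · simp [hy]; omega
      · rw [map_add, map_add, Finsupp.degree_single, Finsupp.degree_single, (he n).2]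
        rw [gl, gl1] at hln
        omega
    · rw [wn n h' h]
      have hgg := gn n h' h
      rcases Nat.le_one_iff_eq_zero_or_eq_one.1 (g01 n) with h0 | h0
      · rw [h0] at hgg hln ⊢
        rw [← hgg] at hln
        simp only [mul_zero, Finsupp.single_zero, add_zero] at hln ⊢
        rw [hln]; exact he n
      · rw [h0] at hgg hln ⊢
        rw [← hgg] at hln
        constructor
        · intro y
          have h1 := (he n).1 y
          have h3 := hb1 n h h0 i
          simp only [Finsupp.coe_add, Pi.add_apply, Finsupp.single_apply]
          split_ifs with hy
          · subst hy; omega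
          · omega
        · rw [map_add, Finsupp.degree_single, (he n).2]
          omega
  have hE := opE (p := p) (t := t) hp3 hq hL (fun n => Sd K p m (fun n => s n + g n) n (monomial (w n) 1))
    (fun n => RdS_Sd (hw n).1 1) (Psi_mem_Yf hodd hs' (fun n => (hw n).2)) l i
  -- digits
  let A : Fin t → MvPolynomial (Sg m) K := fun n =>
    if n = j then monomial (w j) 1 else Sd K p m s n (monomial (e n) 1)
  let h : Fin t → ℕ := fun n => if n = l then p else if n = j then 0 else (p - 1) * g n
  let h' : Fin t → ℕ := fun n => if n = j then 1 else 0
  let c : Fin t → K := fun n => if n = l then ((e l (Sum.inl i) + 1 : ℕ) : K) else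
    if n = j ∧ ZZ m (fun n => s n + g n) j then 2 else 1
  have hc : ∀ n, c n ≠ 0 := by
    intro n
    simp only [c]
    split_ifs
    · exact cast_ne (p := p) (by omega) (by omega)
    · exact h2K
    · exact one_ne_zero
  have nzz : ∀ n, (g n = 1 ∨ g (n + 1) = 1) → ¬ ZZ m s n := by
    rintro n (h | h) ⟨h1, h2⟩
    · have := hgs _ h; omega
    · have := hgs _ h; omega
  have d1 : ∀ n, Sd K p m s n (monomial (e n) 1) = X (Sum.inr i) ^ h' n * A n := by
    intro n
    simp only [h', A]
    by_cases hn : n = j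
    · subst hn
      rw [if_pos rfl, if_pos rfl, Sd_neg (nzz _ (Or.inl gj)), X_pow_eq_monomial, monomial_mul, one_mul, add_comm]
      conv_lhs => rw [ej]
    · rw [if_neg hn, if_neg hn, pow_zero, one_mul]
  have d2 : ∀ n, Function.update (fun n => Sd K p m (fun n => s n + g n) n (monomial (w n) 1)) l
      (X (Sum.inr i) * pderiv (Sum.inl i) (Sd K p m (fun n => s n + g n) l (monomial (w l) 1))) n
      = c n • (X (Sum.inr i) ^ h n * A n) := by
    intro n
    by_cases hn : n = l
    · subst hn
      rw [Function.update_self]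
      have q1 : X (Sum.inr i) * pderiv (Sum.inl i) (monomial (w n) (1 : K)) =
          c n • (X (Sum.inr i) ^ h n * A n) := by
        have hexp : sh (Sum.inl i) (Sum.inr i) 1 (w n) = Finsupp.single (Sum.inr i) p + e n := by
          rw [wl, sh]
          ext y
          simp only [Finsupp.coe_add, Finsupp.coe_tsub, Pi.add_apply, Pi.sub_apply, Finsupp.single_apply]
          rcases y with y | y
          · by_cases hy : i = y <;> simp [hy]
          · by_cases hy : i = y
            · simp [hy]; omega
            · simp [hy]
        have hcoef : w n (Sum.inl i) = e n (Sum.inl i) + 1 := by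
          rw [wl]; simp
        rw [← Hs_one, Hs_monomial, hexp, hcoef]
        simp only [c, h, A, if_pos, if_neg hlj]
        rw [Sd_neg (nzz _ (Or.inr gl1)), X_pow_eq_monomial, monomial_mul, smul_monomial]
        simp
      by_cases hz : ZZ m (fun n => s n + g n) n
      · rw [Sd_pos hz, map_add, mul_add, q1, tau_monomial, if_pos (hw n).1, pderiv_monomial]
        have : (bar p (w n)) (Sum.inl i) = 0 := by
          rw [bar_apply, wl]; simp
        rw [this]; simp
      · rw [Sd_neg hz, q1]
    rw [Function.update_of_ne hn]
    by_cases hnj : n = j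
    · subst hnj
      simp only [c, h, A, if_neg hn, if_pos, true_and, pow_zero, one_mul]
      by_cases hz : ZZ m (fun n => s n + g n) n
      · rw [if_pos hz]
        have hl := hlam n
        rw [ZZ_lam hz, gj, gj1] at hl
        have hfull := hj2 (by omega)
        have hwf : ∀ k, w n (Sum.inl k) = p - 1 := by
          intro k
          rw [wj]; simp [hfull]
        refine Sd_full hz hwf (full_y0 hwf ?_)
        rw [(hw n).2, ZZ_lam hz]
      · rw [if_neg hz, Sd_neg hz, one_smul]
    · have hgg := gn n hn hnj
      have cn : c n = 1 := by
        simp only [c, if_neg hn]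
        rw [if_neg (fun hh => hnj hh.1)]
      rw [cn, one_smul]
      simp only [h, A, if_neg hn, if_neg hnj]
      rw [wn n hn hnj]
      rcases Nat.le_one_iff_eq_zero_or_eq_one.1 (g01 n) with h0 | h0
      · rw [h0]
        simp only [mul_zero, Finsupp.single_zero, add_zero, pow_zero, one_mul]
        have hzz : ZZ m (fun n => s n + g n) n ↔ ZZ m s n := by
          simp only [ZZ, h0, ← hgg, add_zero]
        by_cases hz : ZZ m s n
        · rw [Sd_pos hz, Sd_pos (hzz.2 hz)]
        · rw [Sd_neg hz, Sd_neg (fun hh => hz (hzz.1 hh))]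
      · rw [h0, mul_one, Sd_neg (nzz n (Or.inl h0)), X_pow_eq_monomial, monomial_mul, one_mul, add_comm (e n)]
        apply Sd_neg
        intro hz
        have q1 := ZZ_lam (p := p) hz
        have q2 := hlam n
        rw [q1, h0, ← hgg, h0, ← (he n).2, deg_full (fun k => (hb1 n hnj h0 k).1) (fun k => (hb1 n hnj h0 k).2)] at q2
        omega
  have hrel : ∀ n, h n + g n = h' n + p * g (n + 1) := by
    intro n
    simp only [h, h']
    by_cases hn : n = l
    · subst hn; rw [if_pos rfl, if_neg hlj, gl, gl1]; omega
    by_cases hnj : n = j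
    · subst hnj; rw [if_neg hn, if_pos rfl, if_pos rfl, gj, gj1]; omega
    rw [if_neg hn, if_neg hnj, if_neg hnj, ← gn n hn hnj]
    rcases Nat.le_one_iff_eq_zero_or_eq_one.1 (g01 n) with h0 | h0
    · rw [h0]; simp
    · rw [h0]; omega
  rw [show Function.update (fun n => Sd K p m (fun n => s n + g n) n (monomial (w n) 1)) l
      (X (Sum.inr i) * pderiv (Sum.inl i) (Sd K p m (fun n => s n + g n) l (monomial (w l) 1))) = _
      from funext d2] at hE
  have hcc : (∏ n, c n ^ (p ^ (n : ℕ))) ≠ 0 := Finset.prod_ne_zero_iff.2 fun n _ => pow_ne_zero _ (hc n)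
  have hfin : Phi p (fun n => c n • (X (Sum.inr i) ^ h n * A n)) = (∏ n, c n ^ (p ^ (n : ℕ))) • Psi K p s e := by
    funext v
    rw [Phi_smul, Pi.smul_apply, smul_eq_mul]
    congr 1
    rw [Psi, Phi, Phi]
    simp only [d1, map_mul, map_pow, eval_X, mul_pow, Finset.prod_mul_distrib]
    congr 1
    refine transfer hK h h' g hrel l j ?_ ?_ hp.out.ne_zero _
    · simp only [h, if_pos]; exact hp.out.ne_zero
    · simp [h']
  rw [hfin] at hE
  have := I.smul_mem (∏ n, c n ^ (p ^ (n : ℕ)))⁻¹ hE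
  rwa [smul_smul, inv_mul_cancel₀ hcc, one_smul] at this

end dk
end SP

namespace SP
open MvPolynomial

section sel
variable {p t m : ℕ} [NeZero t]

theorem fin_sub_val (a b : Fin t) : (b - a).val = if a.val ≤ b.val then b.val - a.val else t + b.val - a.val := by
  split_ifs with h
  · exact Fin.coe_sub_iff_le.2 h
  · exact Fin.coe_sub_iff_lt.2 (by simpa using h)

theorem fin_add_one_val (a : Fin t) : (a + 1).val = if a.val + 1 < t then a.val + 1 else 0 := by
  have ha := a.2
  rw [Fin.val_add, Fin.val_one']
  split_ifs with h
  · rw [Nat.mod_eq_of_lt (a := 1) (by omega), Nat.mod_eq_of_lt h]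
  · have : a.val + 1 = t := by omega
    rw [Nat.add_mod_mod, this, Nat.mod_self]

theorem sel (hp3 : 3 ≤ p) {s : Fin t → ℕ} (hs : Valid p m s) (YB : Fin t → Prop)
    (h1 : ∀ j, YB j → ¬ ZZ m s j ∧ m * (p - 1) ≤ lam p s j)
    (h2 : ∀ j, ¬ YB j → lam p s j ≤ m * (p - 1)) (h3 : ∃ j, YB j) :
    ∃ (l j : Fin t) (g : Fin t → ℕ), lam p s l < m * (p - 1) ∧ YB j ∧ g l = 0 ∧ g (l + 1) = 1 ∧ g j = 1 ∧
      g (j + 1) = 0 ∧ (∀ n, n ≠ l → n ≠ j → g n = g (n + 1)) ∧ (∀ n, g n ≤ 1) ∧ (∀ n, g n = 1 → s n < m) ∧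
      (∀ n, n ≠ j → g n = 1 → ¬ YB n ∧ lam p s n = m * (p - 1)) := by
  have hpm : m * (p - 1) + m = p * m := by
    obtain ⟨q, rfl⟩ : ∃ q, p = q + 1 := ⟨p - 1, by omega⟩
    simp; ring
  have hex : ∃ l, lam p s l < m * (p - 1) := by
    by_contra hcon
    push Not at hcon
    obtain ⟨j, hj⟩ := h3
    have hsum : ∑ n, lam p s n + ∑ n, s n = p * ∑ n, s n := by
      have hS : ∑ n, s (n + 1) = ∑ n, s n := Equiv.sum_comp (Equiv.addRight (1 : Fin t)) s
      rw [← Finset.sum_add_distrib, ← hS, Finset.mul_sum]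
      refine Finset.sum_congr rfl fun n _ => ?_
      have := (hs n).2.2
      rw [lam]; omega
    have hsm : ∀ n, s n = m := by
      have a1 : ∑ n : Fin t, m * (p - 1) ≤ ∑ n, lam p s n := Finset.sum_le_sum fun n _ => hcon n
      have a2 : ∑ n, s n ≤ ∑ n : Fin t, m := Finset.sum_le_sum fun n _ => (hs n).2.1
      have a3 : ∑ n : Fin t, m * (p - 1) + ∑ n : Fin t, m = p * ∑ n : Fin t, m := by
        rw [← Finset.sum_add_distrib, Finset.mul_sum]
        exact Finset.sum_congr rfl fun n _ => hpm
      have a4 : ∑ n, s n = ∑ n : Fin t, m := by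
        obtain ⟨q, rfl⟩ : ∃ q, p = q + 1 := ⟨p - 1, by omega⟩
        nlinarith
      intro n
      exact (Finset.sum_eq_sum_iff_of_le (fun n _ => (hs n).2.1)).1 a4 n (Finset.mem_univ _)
    exact (h1 j hj).1 ⟨hsm _, hsm _⟩
  have hP : ∃ r, ∃ l j : Fin t, lam p s l < m * (p - 1) ∧ YB j ∧ (j - l).val = r := by
    obtain ⟨l, hl⟩ := hex
    obtain ⟨j, hj⟩ := h3
    exact ⟨_, l, j, hl, hj, rfl⟩
  obtain ⟨l, j, hl, hj, hr⟩ := Nat.find_spec hP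
  have hmin : ∀ l' j', lam p s l' < m * (p - 1) → YB j' → (j - l).val ≤ (j' - l').val := by
    intro l' j' a b
    rw [hr]
    exact Nat.find_min' hP ⟨l', j', a, b, rfl⟩
  have hlj : l ≠ j := by
    rintro rfl
    have := (h1 _ hj).2; omega
  have hD1 : ∀ n : Fin t, (n + 1 - l).val = if (n - l).val + 1 < t then (n - l).val + 1 else 0 := by
    intro n
    rw [show n + 1 - l = (n - l) + 1 by abel, fin_add_one_val]
  have hD0 : ∀ n : Fin t, n ≠ l → 1 ≤ (n - l).val := by
    intro n hn
    by_contra h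
    have h0 : ((0 : Fin t) : ℕ) = 0 := by simp
    have : n - l = 0 := Fin.ext (by omega)
    exact hn (sub_eq_zero.1 this)
  have hDi : ∀ a b : Fin t, (a - l).val = (b - l).val → a = b := by
    intro a b h
    exact sub_left_injective (Fin.ext h)
  have hDl : (l - l).val = 0 := by simp
  have hrt := (j - l).2
  have hr1 := hD0 j hlj.symm
  have hbet : ∀ n, n ≠ j → 1 ≤ (n - l).val → (n - l).val ≤ (j - l).val → ¬ YB n ∧ lam p s n = m * (p - 1) := by
    intro n hnj a b
    have hlt : (n - l).val ≠ (j - l).val := fun h => hnj (hDi _ _ h)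
    have c1 : ¬ YB n := fun h => by have := hmin l n hl h; omega
    refine ⟨c1, le_antisymm (h2 n c1) ?_⟩
    by_contra c2
    push Not at c2
    have := hmin n j c2 hj
    have e : j - n = (j - l) - (n - l) := by abel
    rw [e, Fin.coe_sub_iff_le.2 (show n - l ≤ j - l from b)] at this
    omega
  have hu : ∀ k, 1 ≤ k → k ≤ (j - l).val → ∀ n : Fin t, (n - l).val = k → s n < m := by
    intro k hk
    induction k, hk using Nat.le_induction with
    | base =>
      intro hk n hn
      have e : n = l + 1 := by
        apply hDi; rw [hn, hD1, hDl, if_pos (by omega)]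
      subst e
      have := hs l
      rw [lam] at hl
      by_contra hc
      have : m = s (l + 1) := by have := (hs (l + 1)).2.1; omega
      rw [← this] at hl
      omega
    | succ k hk ih =>
      intro hk' n hn
      obtain ⟨n', rfl⟩ : ∃ n', n = n' + 1 := ⟨n - 1, (sub_add_cancel n 1).symm⟩
      have hn' : (n' - l).val = k := by
        rw [hD1] at hn; split_ifs at hn; omega
      have a := ih (by omega) n' hn'
      have b := (hbet n' (by rintro rfl; omega) (by omega) (by omega)).2
      have := hs n'
      rw [lam] at b
      by_contra hc
      have : m = s (n' + 1) := by have := (hs (n' + 1)).2.1; omega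
      rw [← this] at b
      omega
  refine ⟨l, j, fun n => if 1 ≤ (n - l).val ∧ (n - l).val ≤ (j - l).val then 1 else 0, hl, hj, ?_, ?_, ?_, ?_, ?_, ?_,
    ?_, ?_⟩
  · simp
  · show (if _ then _ else _) = _
    rw [hD1, hDl, if_pos (show 0 + 1 < t by omega), if_pos (by omega)]
  · show (if _ then _ else _) = _
    rw [if_pos (by omega)]
  · show (if _ then _ else _) = _
    rw [hD1, if_neg]
    split_ifs <;> omega
  · intro n hn hnj
    show (if _ then _ else _) = (if _ then _ else _)
    have a := hD0 n hn
    have b : (n - l).val ≠ (j - l).val := fun h => hnj (hDi _ _ h)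
    have c := (n - l).2
    rw [hD1]
    split_ifs <;> omega
  · intro n
    show (if _ then _ else _) ≤ _
    split_ifs <;> omega
  · intro n hn
    have hn : (if 1 ≤ (n - l).val ∧ (n - l).val ≤ (j - l).val then 1 else 0) = 1 := hn
    split_ifs at hn with h
    exact hu _ h.1 h.2 n rfl
  · intro n hnj hn
    have hn : (if 1 ≤ (n - l).val ∧ (n - l).val ≤ (j - l).val then 1 else 0) = 1 := hn
    split_ifs at hn with h
    exact hbet n hnj h.1 h.2

end sel
end SP

namespace SP
open MvPolynomial

section lemK
variable {K : Type*} [Field K] {p : ℕ} {t m : ℕ} [NeZero t]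

theorem full_of_noy {f : Sg m →₀ ℕ} (hR : Rd p f) (h2 : ∀ i, f (Sum.inr i) = 0) (hd : f.degree = m * (p - 1))
    (i : Fin m) : f (Sum.inl i) = p - 1 := by
  rw [deg_two] at hd
  have h3 : ∑ i : Fin m, (p - 1) = m * (p - 1) := by simp
  rw [← h3] at hd
  have := (Finset.sum_eq_sum_iff_of_le (fun i _ => by rw [h2 i, add_zero]; exact hR _)).1 hd i (Finset.mem_univ _)
  rwa [h2 i, add_zero] at this

theorem transfer0 (hK : ∀ x : K, x ^ p ^ t = x) {s : Fin t → ℕ} (hs : Valid p m s) {x : K} (hx : x ≠ 0) :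
    ∏ n, (x ^ lam p s n) ^ p ^ (n : ℕ) = 1 := by
  have e1 : ∏ n, (x ^ (p * s (n + 1))) ^ p ^ (n : ℕ) = ∏ n, (x ^ s n) ^ p ^ (n : ℕ) := by
    rw [← Equiv.prod_comp (Equiv.addRight (1 : Fin t)) (fun n : Fin t => (x ^ s n) ^ p ^ (n : ℕ))]
    refine Finset.prod_congr rfl fun n _ => ?_
    rw [Equiv.coe_addRight, wrap_pow hK, ← pow_mul (n := p), mul_comm p]
  have hne : ∏ n, (x ^ s n) ^ p ^ (n : ℕ) ≠ 0 :=
    Finset.prod_ne_zero_iff.2 fun n _ => pow_ne_zero _ (pow_ne_zero _ hx)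
  apply mul_right_cancel₀ hne
  conv_rhs => rw [← e1]
  rw [← Finset.prod_mul_distrib, one_mul]
  refine Finset.prod_congr rfl fun n _ => ?_
  rw [← mul_pow, ← pow_add]
  have := (hs n).2.2
  rw [show lam p s n + s n = p * s (n + 1) by rw [lam]; omega]

theorem eval_homog_smul {n : ℕ} {f : MvPolynomial (Sg m) K} (h : f.IsHomogeneous n) (c : K) (v : Sg m → K) :
    eval (c • v) f = c ^ n * eval v f := by
  rw [eval_eq, eval_eq, Finset.mul_sum]
  refine Finset.sum_congr rfl fun d hd => ?_
  have := homog_coeff_degree h hd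
  simp only [Pi.smul_apply, smul_eq_mul, mul_pow, Finset.prod_mul_distrib, Finset.prod_pow_eq_pow_sum]
  rw [show ∑ i ∈ d.support, d i = n from this]
  ring

theorem Phi_scale (hK : ∀ x : K, x ^ p ^ t = x) {s : Fin t → ℕ} (hs : Valid p m s)
    (G : Fin t → MvPolynomial (Sg m) K) (hG : ∀ j, (G j).IsHomogeneous (lam p s j)) {c : K} (hc : c ≠ 0)
    (v : Sg m → K) : Phi p G (c • v) = Phi p G v := by
  simp only [Phi, eval_homog_smul (hG _), mul_pow, Finset.prod_mul_distrib]
  have := transfer0 hK hs hc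
  rw [this, one_mul]

variable [Fintype K]

theorem lemK_digit [hp : Fact p.Prime] [CharP K p] (hp3 : 3 ≤ p) (hodd : Odd p) (hq : Fintype.card K = p ^ t)
    {I : Submodule K ((Sg m → K) → K)}
    (hX : ∀ F : (Sg m → K) → K, (∀ v w, (∀ i, v (Sum.inl i) = w (Sum.inl i)) → F v = F w) →
      (∀ (c : K) v, c ≠ 0 → F (c • v) = F v) → F ∈ I)
    (hL : ∀ (i : Fin m) (c : K), ∀ F ∈ Yf K p t m,
      (fun v => F ((Matrix.transvection (Sum.inl i : Sg m) (Sum.inr i) c).mulVec v)) - F ∈ I)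
    (hGL : ∀ (i k : Fin m) (c : K), i ≠ k → ∀ F ∈ I, (fun v => F ((GLm i k c).mulVec v)) ∈ I)
    {s : Fin t → ℕ} (hs : Valid p m s) (hI : Yl K p m s ≤ I)
    {e : Fin t → Sg m →₀ ℕ} (he : Adm p s e) : Psi K p s e ∈ I := by
  have hK : ∀ x : K, x ^ p ^ t = x := fun x => by rw [← hq]; exact FiniteField.pow_card x
  have h2K : (2 : K) ≠ 0 := two_ne hodd
  by_contra hnot
  have hmon : ∀ l, monomial (e l) 1 ∉ Ls I p s e l := by
    intro l h
    rw [mem_Ls_mono, Function.update_eq_self] at h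
    exact hnot h
  have hmain : ∀ j k, 1 ≤ e j (Sum.inr k) → ¬ ZZ m s j ∧ m * (p - 1) ≤ lam p s j ∧
      (lam p s j ≠ m * (p - 1) → ∀ i, e j (Sum.inl i) = p - 1) := fun j k hk =>
    (mkDS hp3 hodd hq hL hGL hs hI he j).main hp3 h2K (fun h => ZZ_lam h) (he j).2 (he j).1 (hmon j) hk
  have hnoy : ∀ j, ¬ (∃ k, 1 ≤ e j (Sum.inr k)) → ∀ k, e j (Sum.inr k) = 0 := by
    intro j h k
    by_contra h'
    exact h ⟨k, by omega⟩
  by_cases hY : ∃ j, ∃ k, 1 ≤ e j (Sum.inr k)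
  · obtain ⟨l, j, g, hl, ⟨k, hk⟩, gl, gl1, gj, gj1, gn, g01, hgs, hb⟩ :=
      sel hp3 hs (fun j => ∃ k, 1 ≤ e j (Sum.inr k))
        (fun j ⟨k, hk⟩ => ⟨(hmain j k hk).1, (hmain j k hk).2.1⟩)
        (fun j hj => by
          rw [← (he j).2, deg_two]
          have h3 : ∑ i : Fin m, (p - 1) = m * (p - 1) := by simp
          rw [← h3]
          exact Finset.sum_le_sum fun i _ => by rw [hnoy j hj i, add_zero]; exact (he j).1 _) hY
    have hly : ∀ k, e l (Sum.inr k) = 0 := hnoy l (fun ⟨k, hk⟩ => by have := (hmain l k hk).2.1; omega)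
    obtain ⟨i, hi⟩ : ∃ i, e l (Sum.inl i) ≤ p - 2 := by
      by_contra hc
      push Not at hc
      have := deg_full (p := p) (f := e l) (fun i => by have := hc i; have := (he l).1 (Sum.inl i); omega) hly
      have := (he l).2
      omega
    have hlj : l ≠ j := by rintro rfl; omega
    have DK : ∀ f : Sg m →₀ ℕ, f.degree = lam p s j → Rd p f → 1 ≤ f (Sum.inr i) →
        (lam p s j = m * (p - 1) + 1 → ∀ k, f (Sum.inl k) = p - 1) → monomial f 1 ∈ Ls I p s e j := by
      intro f f1 f2 f3 f4
      rw [mem_Ls_mono]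
      refine directKill hp3 hodd hq hL hs (Adm_update he j f2 f1) l j i g gl gl1 gj gj1 gn g01 hgs ?_ ?_ ?_ ?_ ?_
      · rwa [Function.update_of_ne hlj]
      · rw [Function.update_of_ne hlj]; exact hly i
      · intro n hn hg k
        rw [Function.update_of_ne hn]
        obtain ⟨b1, b2⟩ := hb n hn hg
        exact ⟨full_of_noy (he n).1 (hnoy n b1) ((he n).2.trans b2) k, hnoy n b1 k⟩
      · rwa [Function.update_self]
      · rwa [Function.update_self]
    have hj3 := (hmain j k hk).2.2
    by_cases hi1 : 1 ≤ e j (Sum.inr i)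
    · exact hmon j (DK _ (he j).2 (he j).1 hi1 (fun h => hj3 (by omega)))
    have hi0 : e j (Sum.inr i) = 0 := by omega
    have hik : i ≠ k := by rintro rfl; omega
    have D := mkDS hp3 hodd hq hL hGL hs hI he j
    have hne : (Sum.inr k : Sg m) ≠ Sum.inr i := by simp [hik.symm]
    have hne' : (Sum.inl k : Sg m) ≠ Sum.inl i := by simp [hik.symm]
    have hw : monomial (sh (Sum.inr k) (Sum.inr i) 1 (e j)) (1 : K) ∈ Ls I p s e j := by
      refine DK _ ?_ ?_ ?_ ?_
      · rw [sh_degree _ _ _ _ hk, (he j).2]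
      · exact sh_Rd hne 1 (he j).1 (by omega)
      · rw [sh_apply_B hne]; omega
      · intro h k'
        rw [sh_apply_ne (by simp) (by simp)]
        exact hj3 (by omega) k'
    have hsw := D.swap hp3 (he j).2 (he j).1 hik hk hi0 hw
    apply hmon j
    suffices hh : monomial (sh (Sum.inl k) (Sum.inl i) 1 (sh (Sum.inr k) (Sum.inr i) 1 (e j))) ((e j (Sum.inl k) : ℕ) : K)
        ∈ Ls I p s e j by
      have := sub_mem hh hsw
      rwa [sub_sub_cancel] at this
    by_cases hk0 : e j (Sum.inl k) = 0
    · rw [hk0, Nat.cast_zero, monomial_zero]; exact zero_mem _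
    have hdeg : (sh (Sum.inl k) (Sum.inl i) 1 (sh (Sum.inr k) (Sum.inr i) 1 (e j))).degree = lam p s j := by
      rw [sh_degree, sh_degree _ _ _ _ hk, (he j).2]
      rw [sh_apply_ne (by simp) (by simp)]; omega
    by_cases hi2 : e j (Sum.inl i) = p - 1
    · refine D.ov _ hdeg (fun h => ?_) _
      have := h (Sum.inl i)
      rw [sh_apply_B hne', sh_apply_ne (by simp) (by simp)] at this
      omega
    · have hm' : lam p s j = m * (p - 1) := by
        by_contra h
        exact hi2 (hj3 h i)
      have h1 : monomial (sh (Sum.inl k) (Sum.inl i) 1 (sh (Sum.inr k) (Sum.inr i) 1 (e j))) (1 : K)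
          ∈ Ls I p s e j := by
        refine DK _ hdeg ?_ ?_ ?_
        · refine sh_Rd hne' 1 (sh_Rd hne 1 (he j).1 (by omega)) ?_
          rw [sh_apply_ne (by simp) (by simp)]
          have := (he j).1 (Sum.inl i)
          omega
        · rw [sh_apply_ne (by simp) (by simp), sh_apply_B hne]; omega
        · intro h; omega
      have := (Ls I p s e j).smul_mem ((e j (Sum.inl k) : ℕ) : K) h1
      rwa [smul_monomial, smul_eq_mul, mul_one] at this
  · push Not at hY
    have hy : ∀ j k, e j (Sum.inr k) = 0 := fun j k => by have := hY j k; omega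
    apply hnot
    have hS : ∀ j, Sd K p m s j (monomial (e j) 1) =
        (if ZZ m s j then (2 : K) else 1) • monomial (e j) 1 := by
      intro j
      by_cases hz : ZZ m s j
      · rw [if_pos hz]
        exact Sd_full hz (full_of_noy (he j).1 (hy j) ((he j).2.trans (ZZ_lam hz))) (hy j)
      · rw [if_neg hz, Sd_neg hz, one_smul]
    rw [Psi, funext hS]
    have hfun : (Phi p fun x => (if ZZ m s x then (2 : K) else 1) • (monomial (e x)) (1 : K)) =
        (∏ n : Fin t, (if ZZ m s n then (2 : K) else 1) ^ (p ^ (n : ℕ))) • Phi p (fun x => (monomial (e x)) (1 : K)) := by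
      funext v
      rw [Phi_smul, Pi.smul_apply, smul_eq_mul]
    rw [hfun]
    apply I.smul_mem
    apply hX
    · intro v w hvw
      simp only [Phi]
      refine Finset.prod_congr rfl fun j _ => ?_
      congr 1
      rw [eval_monomial, eval_monomial, Finsupp.prod_fintype _ _ (by simp), Finsupp.prod_fintype _ _ (by simp),
        Fintype.prod_sum_type, Fintype.prod_sum_type]
      simp only [hy, hvw, pow_zero]
    · intro c v hc
      exact Phi_scale hK hs _ (fun j => isHomogeneous_monomial _ (he j).2) hc v

theorem lemK [hp : Fact p.Prime] [CharP K p] (hp3 : 3 ≤ p) (hodd : Odd p) (hq : Fintype.card K = p ^ t)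
    {I : Submodule K ((Sg m → K) → K)}
    (hX : ∀ F : (Sg m → K) → K, (∀ v w, (∀ i, v (Sum.inl i) = w (Sum.inl i)) → F v = F w) →
      (∀ (c : K) v, c ≠ 0 → F (c • v) = F v) → F ∈ I)
    (hL : ∀ (i : Fin m) (c : K), ∀ F ∈ Yf K p t m,
      (fun v => F ((Matrix.transvection (Sum.inl i : Sg m) (Sum.inr i) c).mulVec v)) - F ∈ I)
    (hGL : ∀ (i k : Fin m) (c : K), i ≠ k → ∀ F ∈ I, (fun v => F ((GLm i k c).mulVec v)) ∈ I) :
    Yf K p t m ≤ I := by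
  have hK : ∀ x : K, x ^ p ^ t = x := fun x => by rw [← hq]; exact FiniteField.pow_card x
  have key : ∀ N, ∀ s : Fin t → ℕ, ∑ j, s j = N → Valid p m s → ∀ G : Fin t → MvPolynomial (Sg m) K,
      (∀ j, G j ∈ Ad K p m s j) → Phi p G ∈ I := by
    intro N
    induction N using Nat.strong_induction_on with
    | _ N ih =>
      intro s hN hs G hG
      have hI : Yl K p m s ≤ I := by
        rw [Yl, Submodule.span_le]
        rintro F ⟨s', h1, h2, h3, G, hG, rfl⟩
        refine ih _ ?_ s' rfl h1 G hG
        rw [← hN]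
        obtain ⟨j, hj⟩ := Function.ne_iff.1 h3
        exact Finset.sum_lt_sum (fun j _ => h2 j) ⟨j, Finset.mem_univ _, lt_of_le_of_ne (h2 j) hj⟩
      exact reduce hodd hK hs I hI (fun e he => lemK_digit hp3 hodd hq hX hL hGL hs hI he) G hG
  rw [Yf, Submodule.span_le]
  rintro F ⟨s, hs, G, hG, rfl⟩
  exact key _ s rfl hs G hG

end lemK
end SP

namespace SP
open MvPolynomial

section lag
variable {K : Type*} [Field K] {m : ℕ}

def om (u w : Sg m → K) : K := ∑ i, (u (Sum.inl i) * w (Sum.inr i) - u (Sum.inr i) * w (Sum.inl i))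

theorem om_add_left (u u' w : Sg m → K) : om (u + u') w = om u w + om u' w := by
  simp only [om, Pi.add_apply, ← Finset.sum_add_distrib]
  exact Finset.sum_congr rfl fun i _ => by ring
theorem om_smul_left (c : K) (u w : Sg m → K) : om (c • u) w = c * om u w := by
  simp only [om, Pi.smul_apply, smul_eq_mul, Finset.mul_sum]
  exact Finset.sum_congr rfl fun i _ => by ring
theorem om_swap (u w : Sg m → K) : om u w = - om w u := by
  simp only [om, ← Finset.sum_neg_distrib]
  exact Finset.sum_congr rfl fun i _ => by ring
theorem om_add_right (u w w' : Sg m → K) : om u (w + w') = om u w + om u w' := by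
  rw [om_swap, om_add_left, om_swap w, om_swap w']; ring
theorem om_smul_right (c : K) (u w : Sg m → K) : om u (c • w) = c * om u w := by
  rw [om_swap, om_smul_left, om_swap w]; ring
theorem om_self (u : Sg m → K) : om u u = 0 := by
  simp only [om]
  exact Finset.sum_eq_zero fun i _ => by ring

theorem J_mulVec (w : Sg m → K) : (Matrix.J (Fin m) K).mulVec w =
    Sum.elim (fun i => - w (Sum.inr i)) (fun i => w (Sum.inl i)) := by
  rw [Matrix.J, ← Sum.elim_comp_inl_inr w, Matrix.fromBlocks_mulVec]
  ext z
  rcases z with i | i <;> simp [Matrix.neg_mulVec]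

theorem dot_J (u w : Sg m → K) : u ⬝ᵥ (Matrix.J (Fin m) K).mulVec w = - om u w := by
  rw [J_mulVec, dotProduct, Fintype.sum_sum_type, om, ← Finset.sum_neg_distrib, ← Finset.sum_add_distrib]
  exact Finset.sum_congr rfl fun i _ => by simp; ring

theorem Good.om {a : Matrix (Sg m) (Sg m) K} (h : Good a) (u w : Sg m → K) :
    om (a.mulVec u) (a.mulVec w) = om u w := by
  have h1 : a ∈ Matrix.symplecticGroup (Fin m) K := SymplecticGroup.mem_iff.2 h.symp
  have h2 := SymplecticGroup.mem_iff'.1 h1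
  have h3 := dot_J (a.mulVec u) (a.mulVec w)
  rw [Matrix.dotProduct_mulVec, Matrix.dotProduct_mulVec, ← Matrix.mulVec_transpose, ← Matrix.mulVec_transpose,
    Matrix.mulVec_mulVec, Matrix.mulVec_mulVec, ← Matrix.transpose_transpose a, ← Matrix.transpose_mul,
    ← Matrix.transpose_mul, Matrix.transpose_transpose, ← Matrix.mul_assoc, h2, Matrix.mulVec_transpose,
    ← Matrix.dotProduct_mulVec, dot_J] at h3
  exact (neg_injective h3).symm

theorem Good.inj {a : Matrix (Sg m) (Sg m) K} (h : Good a) : Function.Injective a.mulVec := by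
  have h1 : a ∈ Matrix.symplecticGroup (Fin m) K := SymplecticGroup.mem_iff.2 h.symp
  rw [Matrix.mulVec_injective_iff_isUnit, Matrix.isUnit_iff_isUnit_det]
  exact SymplecticGroup.symplectic_det h1

def Good.equiv {a : Matrix (Sg m) (Sg m) K} (h : Good a) : (Sg m → K) ≃ₗ[K] (Sg m → K) :=
  LinearEquiv.ofInjectiveEndo a.mulVecLin h.inj

theorem Good.equiv_apply {a : Matrix (Sg m) (Sg m) K} (h : Good a) (v : Sg m → K) : h.equiv v = a.mulVec v := rfl

def tv (u : Sg m → K) (c : K) : Matrix (Sg m) (Sg m) K :=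
  1 + (c • Matrix.vecMulVec u u) * Matrix.J (Fin m) K

theorem tv_mulVec (u : Sg m → K) (c : K) (v : Sg m → K) : (tv u c).mulVec v = v - (c * om u v) • u := by
  rw [tv, Matrix.add_mulVec, Matrix.one_mulVec, ← Matrix.mulVec_mulVec, Matrix.smul_mulVec,
    Matrix.vecMulVec_mulVec, dot_J]
  ext z
  simp
  ring

theorem good_tv (u : Sg m → K) (c : K) : Good (tv u c) := by
  refine ⟨c • Matrix.vecMulVec u u, ?_, ?_, rfl⟩
  · rw [Matrix.transpose_smul, Matrix.transpose_vecMulVec]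
  · apply Matrix.ext_of_mulVec_single
    intro i
    rw [Matrix.mul_assoc, ← Matrix.mulVec_mulVec, ← Matrix.mulVec_mulVec, Matrix.smul_mulVec, Matrix.smul_mulVec,
      Matrix.vecMulVec_mulVec, Matrix.vecMulVec_mulVec, Matrix.zero_mulVec]
    simp [Matrix.mulVec_smul, dot_J, om_self]

def Lag (W : Submodule K (Sg m → K)) : Prop :=
  (∀ u ∈ W, ∀ w ∈ W, om u w = 0) ∧ Module.finrank K W = m

def ind (W : Submodule K (Sg m → K)) : (Sg m → K) → K := fun v => if v ∈ W then 1 else 0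

def Mv (K : Type*) [Field K] (m : ℕ) : Submodule K ((Sg m → K) → K) :=
  Submodule.span K {F | ∃ W : Submodule K (Sg m → K), Lag W ∧ F = ind W}

theorem Lag.comap {a : Matrix (Sg m) (Sg m) K} (h : Good a) {W : Submodule K (Sg m → K)} (hW : Lag W) :
    Lag (W.comap (h.equiv : (Sg m → K) →ₗ[K] (Sg m → K))) := by
  refine ⟨fun u hu w hw => ?_, ?_⟩
  · rw [← h.om]
    exact hW.1 _ hu _ hw
  · rw [Submodule.comap_equiv_eq_map_symm]
    exact (LinearEquiv.finrank_map_eq _ _).trans hW.2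

theorem Lag.map {a : Matrix (Sg m) (Sg m) K} (h : Good a) {W : Submodule K (Sg m → K)} (hW : Lag W) :
    Lag (W.map (h.equiv : (Sg m → K) →ₗ[K] (Sg m → K))) := by
  refine ⟨?_, ?_⟩
  · rintro _ ⟨u, hu, rfl⟩ _ ⟨w, hw, rfl⟩
    have := h.om u w
    rw [hW.1 u hu w hw] at this
    exact this
  · exact (LinearEquiv.finrank_map_eq _ _).trans hW.2

theorem Mv_stable {a : Matrix (Sg m) (Sg m) K} (h : Good a) {F : (Sg m → K) → K} (hF : F ∈ Mv K m) :
    (fun v => F (a.mulVec v)) ∈ Mv K m := by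
  unfold Mv at hF
  induction hF using Submodule.span_induction with
  | mem x hx =>
    obtain ⟨W, hW, rfl⟩ := hx
    exact Submodule.subset_span ⟨_, hW.comap h, rfl⟩
  | zero => exact zero_mem _
  | add x y _ _ hx hy => exact add_mem hx hy
  | smul c x _ hx => exact Submodule.smul_mem _ c hx

def xyS (A B : Submodule K (Fin m → K)) : Submodule K (Sg m → K) :=
  A.comap (LinearMap.funLeft K K Sum.inl) ⊓ B.comap (LinearMap.funLeft K K Sum.inr)

theorem mem_xyS {A B : Submodule K (Fin m → K)} {v : Sg m → K} :
    v ∈ xyS A B ↔ (fun i => v (Sum.inl i)) ∈ A ∧ (fun i => v (Sum.inr i)) ∈ B := Iff.rfl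

theorem finrank_xyS (A B : Submodule K (Fin m → K)) :
    Module.finrank K (xyS A B) = Module.finrank K A + Module.finrank K B := by
  rw [← Module.finrank_prod]
  refine LinearEquiv.finrank_eq
    { toFun := fun v => (⟨_, v.2.1⟩, ⟨_, v.2.2⟩)
      invFun := fun w => ⟨Sum.elim w.1 w.2, w.1.2, w.2.2⟩
      map_add' := fun v w => rfl
      map_smul' := fun c v => rfl
      left_inv := fun v => ?_
      right_inv := fun w => rfl }
  apply Subtype.ext
  ext z
  rcases z with i | i <;> rfl

def Winf (K : Type*) [Field K] (m : ℕ) : Submodule K (Sg m → K) := xyS ⊥ ⊤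

theorem mem_Winf {v : Sg m → K} : v ∈ Winf K m ↔ ∀ i, v (Sum.inl i) = 0 := by
  rw [Winf, mem_xyS, Submodule.mem_bot, funext_iff]
  simp

theorem Lag_Winf : Lag (Winf K m) := by
  refine ⟨fun u hu w hw => ?_, ?_⟩
  · rw [mem_Winf] at hu hw
    simp [om, hu, hw]
  · rw [Winf, finrank_xyS]; simp

theorem Lag_W0 {x0 : Fin m → K} (h0 : x0 ≠ 0) :
    Lag (xyS (K ∙ x0) (LinearMap.ker (Fintype.linearCombination K x0))) := by
  refine ⟨fun u hu w hw => ?_, ?_⟩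
  · rw [mem_xyS, Submodule.mem_span_singleton, LinearMap.mem_ker, Fintype.linearCombination_apply] at hu hw
    obtain ⟨⟨a, ha⟩, hu2⟩ := hu
    obtain ⟨⟨b, hb⟩, hw2⟩ := hw
    have ha' : ∀ i, u (Sum.inl i) = a * x0 i := fun i => (congrFun ha i).symm
    have hb' : ∀ i, w (Sum.inl i) = b * x0 i := fun i => (congrFun hb i).symm
    have : om u w = a * (∑ i, w (Sum.inr i) • x0 i) - b * (∑ i, u (Sum.inr i) • x0 i) := by
      simp only [om, ha', hb', Finset.mul_sum, ← Finset.sum_sub_distrib, smul_eq_mul]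
      exact Finset.sum_congr rfl fun i _ => by ring
    rw [this, hw2, hu2]; ring
  · rw [finrank_xyS, finrank_span_singleton h0]
    have h1 := LinearMap.finrank_range_add_finrank_ker (Fintype.linearCombination K x0)
    have h2 : LinearMap.range (Fintype.linearCombination K x0) = ⊤ := by
      rw [LinearMap.range_eq_top]
      obtain ⟨i, hi⟩ := Function.ne_iff.1 h0
      intro y
      refine ⟨Pi.single i (y * (x0 i)⁻¹), ?_⟩
      rw [Fintype.linearCombination_apply_single, smul_eq_mul, mul_assoc, inv_mul_cancel₀ hi, mul_one]
    rw [h2, finrank_top, Module.finrank_self, Module.finrank_fin_fun] at h1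
    exact h1

theorem ind_mem {W : Submodule K (Sg m → K)} (hW : Lag W) : ind W ∈ Mv K m := Submodule.subset_span ⟨W, hW, rfl⟩

variable [Fintype K]

theorem line_mem (x0 : Fin m → K) (h0 : x0 ≠ 0) :
    (fun v : Sg m → K => if (fun i => v (Sum.inl i)) ∈ (K ∙ x0) then (1 : K) else 0) ∈ Mv K m := by
  have key : (fun v : Sg m → K => if (fun i => v (Sum.inl i)) ∈ (K ∙ x0) then (1 : K) else 0) =
      ∑ κ : K, (fun v => ind (Winf K m) ((tv (Sum.elim x0 0) κ).mulVec v))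
        + ind (xyS (K ∙ x0) (LinearMap.ker (Fintype.linearCombination K x0))) := by
    funext v
    rw [Pi.add_apply, Finset.sum_apply]
    simp only [ind, mem_xyS, LinearMap.mem_ker, Fintype.linearCombination_apply, mem_Winf, tv_mulVec]
    have hom : om (Sum.elim x0 0) v = ∑ i, v (Sum.inr i) • x0 i := by
      simp only [om, Sum.elim_inl, Sum.elim_inr, Pi.zero_apply, zero_mul, sub_zero, smul_eq_mul, mul_comm]
    simp only [hom, Pi.sub_apply, Pi.smul_apply, Sum.elim_inl]
    set b := ∑ i, v (Sum.inr i) • x0 i with hb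
    by_cases hx : (fun i => v (Sum.inl i)) ∈ (K ∙ x0)
    · simp only [hx, if_true, true_and]
      obtain ⟨a, ha⟩ := Submodule.mem_span_singleton.1 hx
      have ha' : ∀ i, v (Sum.inl i) = a * x0 i := fun i => (congrFun ha i).symm
      have hiff : ∀ κ : K, (∀ i, v (Sum.inl i) - (κ * b) • x0 i = 0) ↔ a = κ * b := by
        intro κ
        constructor
        · intro h
          obtain ⟨i, hi⟩ := Function.ne_iff.1 h0
          have := h i
          rw [ha', smul_eq_mul, ← sub_mul] at this
          exact sub_eq_zero.1 ((mul_eq_zero.1 this).resolve_right hi)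
        · intro h i
          rw [ha', ← h, smul_eq_mul, sub_self]
      simp only [hiff]
      by_cases hb0 : b = 0
      · simp [hb0]
      · have h2 : ∀ κ : K, (a = κ * b) ↔ κ = a * b⁻¹ := by
          intro κ
          constructor
          · rintro rfl; rw [mul_assoc, mul_inv_cancel₀ hb0, mul_one]
          · rintro rfl; rw [mul_assoc, inv_mul_cancel₀ hb0, mul_one]
        simp [h2, hb0]
    · simp only [hx, if_false, false_and, add_zero]
      refine (Finset.sum_eq_zero fun κ _ => ?_).symm
      rw [if_neg]
      intro h
      apply hx
      refine Submodule.mem_span_singleton.2 ⟨κ * b, ?_⟩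
      funext i
      exact (sub_eq_zero.1 (h i)).symm
  rw [key]
  refine add_mem (Submodule.sum_mem _ fun κ _ => Mv_stable (good_tv _ _) (ind_mem Lag_Winf)) (ind_mem (Lag_W0 h0))

theorem xonly_mem (F : (Sg m → K) → K) (h1 : ∀ v w, (∀ i, v (Sum.inl i) = w (Sum.inl i)) → F v = F w)
    (h2 : ∀ (c : K) v, c ≠ 0 → F (c • v) = F v) : F ∈ Mv K m := by
  let f : (Fin m → K) → K := fun x => F (Sum.elim x 0)
  have key : F = f 0 • ind (Winf K m) - ∑ x0 ∈ Finset.univ.filter (fun x0 : Fin m → K => x0 ≠ 0),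
      f x0 • ((fun v : Sg m → K => if (fun i => v (Sum.inl i)) ∈ (K ∙ x0) then (1 : K) else 0) - ind (Winf K m)) := by
    funext v
    simp only [Pi.sub_apply, Pi.smul_apply, Finset.sum_apply, ind, mem_Winf, smul_eq_mul]
    have hv : F v = f (fun i => v (Sum.inl i)) := h1 _ _ fun i => rfl
    rw [hv]
    generalize hxx : (fun i => v (Sum.inl i)) = x
    have hxi : ∀ i, v (Sum.inl i) = x i := fun i => congrFun hxx i
    simp only [hxi]
    by_cases hx : x = 0
    · subst hx
      simp
    · have hx' : ¬ ∀ i, x i = 0 := fun h => hx (funext h)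
      simp only [hx', if_false, mul_zero, sub_zero, zero_sub, mul_ite, mul_one]
      rw [← Finset.sum_filter, Finset.filter_filter]
      have himg : Finset.univ.filter (fun x0 : Fin m → K => x0 ≠ 0 ∧ x ∈ (K ∙ x0)) =
          (Finset.univ.erase (0 : K)).image (fun c => c • x) := by
        ext y
        simp only [Finset.mem_filter, Finset.mem_univ, true_and, Finset.mem_image, Finset.mem_erase, and_true,
          Submodule.mem_span_singleton]
        constructor
        · rintro ⟨hy, a, ha⟩
          have ha0 : a ≠ 0 := by rintro rfl; apply hx; rw [← ha, zero_smul]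
          exact ⟨a⁻¹, inv_ne_zero ha0, by rw [← ha, smul_smul, inv_mul_cancel₀ ha0, one_smul]⟩
        · rintro ⟨c, hc, rfl⟩
          exact ⟨smul_ne_zero hc hx, c⁻¹, by rw [smul_smul, inv_mul_cancel₀ hc, one_smul]⟩
      rw [himg, Finset.sum_image (fun a _ b _ h => smul_left_injective K hx h)]
      have hconst : ∀ c ∈ Finset.univ.erase (0 : K), f (c • x) = f x := by
        intro c hc
        have := h2 c (Sum.elim x 0) (Finset.ne_of_mem_erase hc)
        show F (Sum.elim (c • x) 0) = F (Sum.elim x 0)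
        rw [← this]
        apply h1
        intro i; rfl
      rw [Finset.sum_congr rfl hconst, Finset.sum_const, Finset.card_erase_of_mem (Finset.mem_univ _),
        Finset.card_univ, nsmul_eq_mul, Nat.cast_sub Fintype.card_pos]
      simp
  rw [key]
  refine sub_mem (Submodule.smul_mem _ _ (ind_mem Lag_Winf)) (Submodule.sum_mem _ fun x0 hx0 => ?_)
  exact Submodule.smul_mem _ _ (sub_mem (line_mem x0 (Finset.mem_filter.1 hx0).2) (ind_mem Lag_Winf))

end lag
end SP

namespace SP
open MvPolynomial

section filt
variable {K : Type*} [Field K] {p t m : ℕ}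

def mof (d : Sg m → ℕ) : (Sg m → K) → K := fun v => ∏ z, v z ^ d z

def Fk (K : Type*) [Field K] (m k : ℕ) : Submodule K ((Sg m → K) → K) :=
  Submodule.span K {F | ∃ d : Sg m → ℕ, ∑ i, d (Sum.inl i) < k ∧ F = mof d}

theorem Fk_zero : Fk K m 0 = ⊥ := by
  rw [Fk, Submodule.span_eq_bot]
  rintro x ⟨d, h, _⟩
  omega

theorem Fk_mono {a b : ℕ} (h : a ≤ b) : Fk K m a ≤ Fk K m b := by
  apply Submodule.span_mono
  rintro x ⟨d, h1, h2⟩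
  exact ⟨d, h1.trans_le h, h2⟩

theorem Fk_mul {a b n : ℕ} (hn : a + b ≤ n + 1) {f g : (Sg m → K) → K} (hf : f ∈ Fk K m a) (hg : g ∈ Fk K m b) : f * g ∈ Fk K m n := by
  have h := Submodule.mul_mem_mul hf hg
  rw [Fk, Fk, Submodule.span_mul_span] at h
  refine Submodule.span_mono ?_ h
  rintro _ ⟨_, ⟨d, hd, rfl⟩, _, ⟨d', hd', rfl⟩, rfl⟩
  refine ⟨d + d', ?_, ?_⟩
  · simp only [Pi.add_apply, Finset.sum_add_distrib]; omega
  · funext v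
    simp [mof, pow_add, Finset.prod_mul_distrib]

theorem Fk_mof {d : Sg m → ℕ} {k : ℕ} (h : ∑ i, d (Sum.inl i) < k) : mof d ∈ Fk K m k :=
  Submodule.subset_span ⟨d, h, rfl⟩

theorem Fk_one : (1 : (Sg m → K) → K) ∈ Fk K m 1 := by
  have : (1 : (Sg m → K) → K) = mof 0 := by funext v; simp [mof]
  rw [this]; exact Fk_mof (by simp)

def wt : Sg m → ℕ := Sum.elim 1 0

theorem coord_mem (z : Sg m) : (fun v => v z) ∈ Fk K m (wt z + 1) := by
  have : (fun v : Sg m → K => v z) = mof (Pi.single z 1) := by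
    funext v
    rw [mof, Finset.prod_eq_single z]
    · simp
    · intro b _ hb; simp [hb]
    · simp
  rw [this]
  apply Fk_mof
  rcases z with i | i
  · simp [wt, Pi.single_apply]
  · simp [wt]

def RR (a : ℕ) (f g : (Sg m → K) → K) : Prop := f ∈ Fk K m (a + 1) ∧ g ∈ Fk K m (a + 1) ∧ f - g ∈ Fk K m a

theorem RR.mul {a b : ℕ} {f g f' g' : (Sg m → K) → K} (h : RR a f g) (h' : RR b f' g') :
    RR (a + b) (f * f') (g * g') := by
  refine ⟨Fk_mul (by omega) h.1 h'.1, Fk_mul (by omega) h.2.1 h'.2.1, ?_⟩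
  have : f * f' - g * g' = f * (f' - g') + (f - g) * g' := by ring
  rw [this]
  exact add_mem (Fk_mul (by omega) h.1 h'.2.2) (Fk_mul (by omega) h.2.2 h'.2.1)

theorem RR.one : RR 0 (1 : (Sg m → K) → K) 1 := ⟨Fk_one, Fk_one, by simp⟩

theorem RR.pow {a : ℕ} {f g : (Sg m → K) → K} (h : RR a f g) (n : ℕ) : RR (n * a) (f ^ n) (g ^ n) := by
  induction n with
  | zero => simpa using RR.one
  | succ n ih => rw [pow_succ, pow_succ, add_mul, one_mul]; exact ih.mul h

theorem RR.prod {ι : Type*} (s : Finset ι) (a : ι → ℕ) (f g : ι → (Sg m → K) → K) (h : ∀ i, RR (a i) (f i) (g i)) :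
    RR (∑ i ∈ s, a i) (∏ i ∈ s, f i) (∏ i ∈ s, g i) := by
  induction s using Finset.induction_on with
  | empty => simpa using RR.one
  | insert i s hi ih => rw [Finset.sum_insert hi, Finset.prod_insert hi, Finset.prod_insert hi]; exact (h i).mul ih

theorem RR.subst {a b : Matrix (Sg m) (Sg m) K}
    (h : ∀ z, RR (wt z) (fun v => a.mulVec v z) (fun v => b.mulVec v z)) {k : ℕ} {F : (Sg m → K) → K}
    (hF : F ∈ Fk K m (k + 1)) : RR k (fun v => F (a.mulVec v)) (fun v => F (b.mulVec v)) := by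
  unfold Fk at hF
  induction hF using Submodule.span_induction with
  | mem x hx =>
    obtain ⟨d, hd, rfl⟩ := hx
    have := RR.prod Finset.univ (fun z => d z * wt z) _ _ (fun z => (h z).pow (d z))
    have e : ∀ a : Matrix (Sg m) (Sg m) K, (∏ z, (fun v : Sg m → K => a.mulVec v z) ^ d z) = fun v => mof d (a.mulVec v) := by
      intro a
      funext v
      simp [mof, Finset.prod_apply]
    rw [e, e] at this
    have hle : ∑ z, d z * wt z ≤ k := by
      rw [Fintype.sum_sum_type]; simp [wt]; omega
    refine ⟨?_, ?_, ?_⟩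
    · exact Fk_mono (by omega) this.1
    · exact Fk_mono (by omega) this.2.1
    · exact Fk_mono (by omega) this.2.2
  | zero => exact ⟨zero_mem _, zero_mem _, by simpa using zero_mem _⟩
  | add x y _ _ hx hy =>
    refine ⟨add_mem hx.1 hy.1, add_mem hx.2.1 hy.2.1, ?_⟩
    have := add_mem hx.2.2 hy.2.2
    rwa [sub_add_sub_comm] at this
  | smul c x _ hx =>
    refine ⟨Submodule.smul_mem _ c hx.1, Submodule.smul_mem _ c hx.2.1, ?_⟩
    have := Submodule.smul_mem _ c hx.2.2
    rwa [smul_sub] at this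

theorem transv_mulVec (A B : Sg m) (c : K) (v : Sg m → K) (z : Sg m) :
    (Matrix.transvection A B c).mulVec v z = v z + if z = A then c * v B else 0 := by
  rw [Matrix.transvection, Matrix.add_mulVec, Matrix.one_mulVec, Pi.add_apply, Matrix.single_mulVec]
  congr 1
  by_cases h : z = A
  · subst h; simp
  · simp [h]

theorem RR_L (i : Fin m) (c : K) (z : Sg m) :
    RR (wt z) (fun v : Sg m → K => (Matrix.transvection (Sum.inl i : Sg m) (Sum.inr i) c).mulVec v z)
      (fun v => (1 : Matrix (Sg m) (Sg m) K).mulVec v z) := by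
  simp only [Matrix.one_mulVec, transv_mulVec]
  have hz := coord_mem (K := K) z
  by_cases h : z = Sum.inl i
  · subst h
    simp only [if_true]
    have hy : c • (fun v : Sg m → K => v (Sum.inr i)) ∈ Fk K m 1 := Submodule.smul_mem _ _ (coord_mem (Sum.inr i))
    refine ⟨?_, hz, ?_⟩
    · exact add_mem hz (Fk_mono (by simp) hy)
    · have : (fun v : Sg m → K => v (Sum.inl i) + c * v (Sum.inr i)) - (fun v => v (Sum.inl i)) =
        c • (fun v : Sg m → K => v (Sum.inr i)) := by funext v; simp
      rw [this]; exact hy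
  · simp only [h, if_false, add_zero]
    exact ⟨hz, hz, by simp⟩

theorem RR_GL (i k : Fin m) (c : K) (z : Sg m) :
    RR (wt z) (fun v : Sg m → K => (GLm i k c).mulVec v z) (fun v => (GLm i k c).mulVec v z) := by
  have h : (fun v : Sg m → K => (GLm i k c).mulVec v z) ∈ Fk K m (wt z + 1) := by
    simp only [GLm, ← Matrix.mulVec_mulVec, transv_mulVec]
    have hz := coord_mem (K := K) z
    rcases z with z | z
    · simp only [reduceCtorEq, if_false, add_zero]
      refine add_mem hz ?_
      by_cases h : (Sum.inl z : Sg m) = Sum.inl k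
      · simp only [h, if_true]
        exact Submodule.smul_mem _ c (coord_mem (Sum.inl i))
      · simp only [h, if_false]; exact zero_mem _
    · simp only [reduceCtorEq, if_false, add_zero]
      refine add_mem hz ?_
      by_cases h : (Sum.inr z : Sg m) = Sum.inr i
      · simp only [h, if_true]
        exact Submodule.smul_mem _ (-c) (coord_mem (Sum.inr k))
      · simp only [h, if_false]; exact zero_mem _
  exact ⟨h, h, by simp⟩

variable [Fintype K]

theorem Fk_top : Fk K m (m * (Fintype.card K - 1) + 1) = ⊤ := by
  rw [eq_top_iff, ← map_restrict_dom_evalₗ (K := K) (σ := Sg m)]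
  rintro _ ⟨f, hf, rfl⟩
  rw [SetLike.mem_coe, mem_restrictDegree] at hf
  have : evalₗ K (Sg m) f = ∑ d ∈ f.support, f.coeff d • mof (fun z => d z) := by
    funext v
    rw [evalₗ_apply, eval_eq', Finset.sum_apply]
    rfl
  rw [this]
  refine Submodule.sum_mem _ fun d hd => Submodule.smul_mem _ _ (Fk_mof ?_)
  have : ∑ i : Fin m, d (Sum.inl i) ≤ ∑ i : Fin m, (Fintype.card K - 1) :=
    Finset.sum_le_sum fun i _ => hf d hd _
  simp at this
  omega

theorem Yf_le_Mv [NeZero t] [hp : Fact p.Prime] [CharP K p] (hp3 : 3 ≤ p) (hodd : Odd p)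
    (hq : Fintype.card K = p ^ t) : Yf K p t m ≤ Mv K m := by
  have key : ∀ n k, k + n = m * (Fintype.card K - 1) + 1 → Yf K p t m ≤ Mv K m ⊔ (Yf K p t m ⊓ Fk K m k) := by
    intro n
    induction n with
    | zero =>
      intro k hk
      rw [add_zero] at hk
      rw [hk, Fk_top, inf_top_eq]; exact le_sup_right
    | succ n ih =>
      intro k hk
      have ih' := ih (k + 1) (by omega)
      refine lemK hp3 hodd hq ?_ ?_ ?_
      · intro F h1 h2
        exact le_sup_left (a := Mv K m) (xonly_mem F h1 h2)
      · intro i c F hF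
        obtain ⟨M, hM, G, ⟨hG1, hG2⟩, rfl⟩ := Submodule.mem_sup.1 (ih' hF)
        have e : (fun v => (M + G) ((Matrix.transvection (Sum.inl i : Sg m) (Sum.inr i) c).mulVec v)) - (M + G) =
          ((fun v => M ((Matrix.transvection (Sum.inl i : Sg m) (Sum.inr i) c).mulVec v)) - M) +
          ((fun v => G ((Matrix.transvection (Sum.inl i : Sg m) (Sum.inr i) c).mulVec v)) - G) := by
          funext v; simp; ring
        rw [e]
        refine Submodule.add_mem_sup (sub_mem (Mv_stable (good_L i c) hM) hM) ⟨sub_mem (Yf_stable (good_L i c) hG1) hG1, ?_⟩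
        have := (RR.subst (RR_L i c) hG2).2.2
        simp only [Matrix.one_mulVec] at this
        exact this
      · intro i j c hij F hF
        obtain ⟨M, hM, G, ⟨hG1, hG2⟩, rfl⟩ := Submodule.mem_sup.1 hF
        refine Submodule.add_mem_sup (Mv_stable (good_GL hij c) hM) ⟨Yf_stable (good_GL hij c) hG1, ?_⟩
        rcases k with _ | k
        · rw [Fk_zero] at hG2 ⊢
          have : G = 0 := hG2
          rw [this]; exact zero_mem _
        · exact (RR.subst (RR_GL i j c) hG2).1
  have := key _ 0 (zero_add _)
  rwa [Fk_zero, inf_bot_eq, sup_bot_eq] at this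

end filt
end SP

namespace SP
open MvPolynomial

section conv
variable {K : Type*} [Field K] {p t m : ℕ} [NeZero t]

def C1 (K : Type*) [Field K] (p t m : ℕ) [NeZero t] : Submodule K ((Sg m → K) → K) :=
  Submodule.span K {(fun _ => 1 : (Sg m → K) → K)} ⊔ Yf K p t m

theorem C1_stable [Fact p.Prime] [CharP K p] {a : Matrix (Sg m) (Sg m) K} (ha : Good a)
    {F : (Sg m → K) → K} (hF : F ∈ C1 K p t m) : (fun v => F (a.mulVec v)) ∈ C1 K p t m := by
  obtain ⟨M, hM, G, hG, rfl⟩ := Submodule.mem_sup.1 hF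
  obtain ⟨c, rfl⟩ := Submodule.mem_span_singleton.1 hM
  exact Submodule.add_mem_sup (Submodule.smul_mem _ c (Submodule.mem_span_singleton_self _)) (Yf_stable ha hG)

theorem pow_digits (p : ℕ) (hp : 1 ≤ p) (x : K) (t : ℕ) : ∏ j : Fin t, (x ^ (p - 1)) ^ p ^ (j : ℕ) = x ^ (p ^ t - 1) := by
  rw [Fin.prod_univ_eq_prod_range (fun j => (x ^ (p - 1)) ^ p ^ j) t]
  induction t with
  | zero => simp
  | succ t ih =>
    rw [Finset.prod_range_succ, ih, ← pow_mul, ← pow_add]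
    congr 1
    have : 1 ≤ p ^ t := Nat.one_le_pow _ _ hp
    rw [pow_succ, Nat.sub_mul, mul_comm (p ^ t) p]
    have : p ^ t ≤ p * p ^ t := Nat.le_mul_of_pos_left _ hp
    omega

theorem xI_mem [hp : Fact p.Prime] [CharP K p] (I : Finset (Fin m)) (hI : I.Nonempty) :
    (fun v : Sg m → K => ∏ i ∈ I, v (Sum.inl i) ^ (p ^ t - 1)) ∈ Yf K p t m := by
  have hp1 := hp.out.one_lt
  let e : Sg m →₀ ℕ := Finsupp.equivFunOnFinite.symm (Sum.elim (fun i => if i ∈ I then p - 1 else 0) 0)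
  have e1 : ∀ i, e (Sum.inl i) = if i ∈ I then p - 1 else 0 := fun i => rfl
  have e2 : ∀ i, e (Sum.inr i) = 0 := fun i => rfl
  have hlam : ∀ j : Fin t, lam p (fun _ : Fin t => I.card) j = I.card * (p - 1) := by
    intro j
    rw [lam, Nat.mul_sub, mul_one, mul_comm]
  have hdeg : e.degree = I.card * (p - 1) := by
    rw [deg_two]
    simp only [e1, e2, add_zero, Finset.sum_ite_mem, Finset.univ_inter, Finset.sum_const, smul_eq_mul]
  refine Submodule.subset_span ⟨fun _ => I.card, ?_, fun _ => monomial e 1, ?_, ?_⟩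
  · intro j
    refine ⟨hI.card_pos, ?_, Nat.le_mul_of_pos_left _ (by omega)⟩
    simpa using Finset.card_le_univ I
  · intro j
    refine ⟨isHomogeneous_monomial _ (by rw [hlam, hdeg]), fun hz => ?_⟩
    have hIu : I = Finset.univ := by
      rw [← Finset.card_eq_iff_eq_univ, Fintype.card_fin]; exact hz.1
    have e1' : ∀ i, e (Sum.inl i) = p - 1 := fun i => by rw [e1, hIu]; simp
    have hR : Rd p e := by rintro (i | i) <;> simp [e1', e2]
    have hb : bar p e = e := by
      ext y
      rcases y with i | i <;> simp [e1', e2]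
    rw [tau_monomial, if_pos hR, sgn_full e1' e2, mul_one, hb, sub_self]
    exact zero_mem _
  · funext v
    have hev : eval v (monomial e (1 : K)) = ∏ i ∈ I, v (Sum.inl i) ^ (p - 1) := by
      rw [eval_monomial, one_mul, Finsupp.prod_fintype _ _ (by simp), Fintype.prod_sum_type]
      simp only [e1, e2, pow_zero, Finset.prod_const_one, mul_one, pow_ite]
      rw [Finset.prod_ite_mem, Finset.univ_inter]
    simp only [Phi, hev]
    simp only [← Finset.prod_pow]
    rw [Finset.prod_comm]
    exact Finset.prod_congr rfl fun i _ => (pow_digits p hp1.le _ _).symm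

variable [Fintype K]

theorem delta_mem [hp : Fact p.Prime] [CharP K p] (hq : Fintype.card K = p ^ t) : ind (Winf K m) ∈ C1 K p t m := by
  have key : ind (Winf K m) = ∑ I ∈ (Finset.univ : Finset (Fin m)).powerset,
      ((-1 : K) ^ I.card) • (fun v : Sg m → K => ∏ i ∈ I, v (Sum.inl i) ^ (p ^ t - 1)) := by
    funext v
    rw [Finset.sum_apply]
    have h1 : ind (Winf K m) v = ∏ i, (1 + - v (Sum.inl i) ^ (p ^ t - 1)) := by
      rw [ind]
      by_cases h : v ∈ Winf K m
      · rw [if_pos h]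
        rw [mem_Winf] at h
        have : p ^ t - 1 ≠ 0 := by
          have := Fintype.one_lt_card (α := K)
          omega
        simp [h, this]
      · rw [if_neg h]
        rw [mem_Winf] at h
        push Not at h
        obtain ⟨i, hi⟩ := h
        rw [Finset.prod_eq_zero (Finset.mem_univ i)]
        rw [← hq, FiniteField.pow_card_sub_one_eq_one _ hi]; ring
    rw [h1, Finset.prod_one_add]
    refine Finset.sum_congr rfl fun I _ => ?_
    rw [Pi.smul_apply, smul_eq_mul, Finset.prod_neg]
  rw [key]
  refine Submodule.sum_mem _ fun I _ => Submodule.smul_mem _ _ ?_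
  rcases I.eq_empty_or_nonempty with rfl | hI
  · refine le_sup_left (a := Submodule.span K {(fun _ => 1 : (Sg m → K) → K)}) ?_
    simp only [Finset.prod_empty]
    exact Submodule.mem_span_singleton_self _
  · exact le_sup_right (a := Submodule.span K {(fun _ => 1 : (Sg m → K) → K)}) (xI_mem I hI)

theorem ind_mem_C1 [hp : Fact p.Prime] [CharP K p] (hq : Fintype.card K = p ^ t) :
    ∀ n, ∀ W : Submodule K (Sg m → K), Lag W → m - Module.finrank K (W ⊓ Winf K m : Submodule K (Sg m → K)) = n →
      ind W ∈ C1 K p t m := by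
  intro n
  induction n using Nat.strong_induction_on with
  | _ n ih =>
    intro W hW hn
    by_cases hle : W ≤ Winf K m
    · rw [Submodule.eq_of_le_of_finrank_eq hle (hW.2.trans Lag_Winf.2.symm)]
      exact delta_mem hq
    obtain ⟨w, hw, hw'⟩ := SetLike.not_le_iff_exists.1 hle
    rw [mem_Winf] at hw'
    push Not at hw'
    obtain ⟨i, hi⟩ := hw'
    let w0 : Sg m → K := Pi.single (Sum.inr i) 1
    have hw0 : w0 ∈ Winf K m := by
      rw [mem_Winf]; intro k; simp [w0]
    have hom : om w w0 = w (Sum.inl i) := by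
      simp [om, w0, Pi.single_apply]
    have hw0W : w0 ∉ W := by
      intro h
      rw [hW.1 w hw w0 h] at hom
      exact hi hom.symm
    let u := w0 + (-1 : K) • w
    have hg := good_tv u (w (Sum.inl i))⁻¹
    have hmap := hW.map hg
    have hlt : W ⊓ Winf K m < W.map (hg.equiv : (Sg m → K) →ₗ[K] (Sg m → K)) ⊓ Winf K m := by
      refine lt_of_le_of_ne ?_ ?_
      · rintro v ⟨hv1, hv2⟩
        refine ⟨⟨v, hv1, ?_⟩, hv2⟩
        show (tv u (w (Sum.inl i))⁻¹).mulVec v = v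
        rw [tv_mulVec, show om u v = 0 by
          rw [om_add_left, om_smul_left, hW.1 w hw v hv1, Lag_Winf.1 w0 hw0 v hv2]; ring]
        simp
      · intro heq
        have : w0 ∈ W.map (hg.equiv : (Sg m → K) →ₗ[K] (Sg m → K)) ⊓ Winf K m := by
          refine ⟨⟨w, hw, ?_⟩, hw0⟩
          show (tv u (w (Sum.inl i))⁻¹).mulVec w = w0
          rw [tv_mulVec, show om u w = - w (Sum.inl i) by
            rw [om_add_left, om_smul_left, om_self, om_swap, hom]; ring]
          rw [mul_neg, inv_mul_cancel₀ hi, neg_smul, one_smul]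
          simp [u]
        rw [← heq] at this
        exact hw0W this.1
    have hlt2 := Submodule.finrank_lt_finrank_of_lt hlt
    have hle2 := Submodule.finrank_mono (inf_le_right :
      W.map (hg.equiv : (Sg m → K) →ₗ[K] (Sg m → K)) ⊓ Winf K m ≤ Winf K m)
    rw [Lag_Winf.2] at hle2
    have hh := C1_stable hg (ih _ (by omega) _ hmap rfl)
    have : ind W = (fun v => ind (W.map (hg.equiv : (Sg m → K) →ₗ[K] (Sg m → K))) ((tv u (w (Sum.inl i))⁻¹).mulVec v)) := by
      funext v
      simp only [ind]
      congr 1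
      rw [eq_iff_iff, ← hg.equiv_apply]
      constructor
      · intro h; exact ⟨v, h, rfl⟩
      · rintro ⟨v', h, h'⟩
        rwa [← hg.equiv.injective h']
    rw [this]; exact hh

theorem Mv_eq [hp : Fact p.Prime] [CharP K p] (hp3 : 3 ≤ p) (hodd : Odd p) (hq : Fintype.card K = p ^ t) :
    Mv K m = C1 K p t m := by
  apply le_antisymm
  · rw [Mv, Submodule.span_le]
    rintro _ ⟨W, hW, rfl⟩
    exact ind_mem_C1 hq _ W hW rfl
  · refine sup_le ?_ (Yf_le_Mv hp3 hodd hq)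
    rw [Submodule.span_singleton_le_iff_mem]
    exact xonly_mem _ (fun _ _ _ => rfl) (fun _ _ _ => rfl)

end conv
end SP

namespace SP
open MvPolynomial

section zsum
variable {K : Type*} [Field K] [Fintype K] {p t m : ℕ} [NeZero t]

theorem sum_lam (hp : 1 ≤ p) {s : Fin t → ℕ} (hs : Valid p m s) :
    ∑ j, lam p s j * p ^ (j : ℕ) = (p ^ t - 1) * s 0 := by
  have h1 : ∀ j : Fin t, ((lam p s j * p ^ (j : ℕ) : ℕ) : ℤ) =
      (fun n : ℕ => (p : ℤ) ^ n * s (Fin.ofNat t n)) ((j : ℕ) + 1)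
        - (fun n : ℕ => (p : ℤ) ^ n * s (Fin.ofNat t n)) (j : ℕ) := by
    intro j
    have e1 : Fin.ofNat t (j : ℕ) = j := by ext; simp [Nat.mod_eq_of_lt j.isLt]
    have e2 : Fin.ofNat t ((j : ℕ) + 1) = j + 1 := by
      ext
      simp [Fin.val_add]
    simp only [e1, e2]
    rw [lam]
    push_cast [Nat.cast_sub (hs j).2.2]
    ring
  have h2 : ((∑ j, lam p s j * p ^ (j : ℕ) : ℕ) : ℤ) = (p ^ t - 1 : ℤ) * s 0 := by
    rw [Nat.cast_sum, Finset.sum_congr rfl (fun j _ => h1 j),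
      Fin.sum_univ_eq_sum_range (fun n : ℕ => (fun n : ℕ => (p : ℤ) ^ n * s (Fin.ofNat t n)) (n + 1)
        - (fun n : ℕ => (p : ℤ) ^ n * s (Fin.ofNat t n)) n) t,
      Finset.sum_range_sub (fun n : ℕ => (p : ℤ) ^ n * s (Fin.ofNat t n)) t]
    have e1 : Fin.ofNat t t = 0 := by ext; simp
    have e2 : Fin.ofNat t 0 = 0 := by ext; simp
    simp only [e1, e2]
    ring
  have : 1 ≤ p ^ t := Nat.one_le_pow _ _ hp
  zify [this]
  simpa using h2

theorem Yf_zero [hp : Fact p.Prime] {F : (Sg m → K) → K} (hF : F ∈ Yf K p t m) : F 0 = 0 := by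
  unfold Yf at hF
  induction hF using Submodule.span_induction with
  | mem x hx =>
    obtain ⟨s, hs, G, hG, rfl⟩ := hx
    have h1 : 0 < ∑ j, lam p s j * p ^ (j : ℕ) := by
      rw [sum_lam hp.out.one_lt.le hs]
      have := hs 0
      have h3 : 1 < p ^ t := Nat.one_lt_pow (NeZero.ne t) hp.out.one_lt
      exact Nat.mul_pos (by omega) (by omega)
    obtain ⟨j, hj⟩ : ∃ j, 0 < lam p s j := by
      by_contra hc
      push Not at hc
      rw [Finset.sum_eq_zero] at h1
      · exact lt_irrefl _ h1
      · intro j _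
        have := hc j
        rw [show lam p s j = 0 by omega, zero_mul]
    rw [Phi]
    apply Finset.prod_eq_zero (Finset.mem_univ j)
    have := eval_homog_smul (hG j).1 (0 : K) (0 : Sg m → K)
    rw [smul_zero, zero_pow hj.ne', zero_mul] at this
    rw [this, zero_pow (pow_ne_zero _ hp.out.ne_zero)]
  | zero => rfl
  | add x y _ _ hx hy => rw [Pi.add_apply, hx, hy, add_zero]
  | smul a x _ hx => rw [Pi.smul_apply, hx, smul_zero]

theorem Yf_sum [hp : Fact p.Prime] (hq : Fintype.card K = p ^ t) (hm : 1 ≤ m)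
    {F : (Sg m → K) → K} (hF : F ∈ Yf K p t m) : ∑ v, F v = 0 := by
  unfold Yf at hF
  induction hF using Submodule.span_induction with
  | mem x hx =>
    obtain ⟨s, hs, G, hG, rfl⟩ := hx
    have h0 : (∏ j, G j ^ p ^ (j : ℕ)).totalDegree ≤ (p ^ t - 1) * s 0 := by
      rw [← sum_lam hp.out.one_lt.le hs]
      refine (totalDegree_finset_prod _ _).trans (Finset.sum_le_sum fun j _ => ?_)
      refine (totalDegree_pow _ _).trans ?_
      rw [mul_comm]
      exact Nat.mul_le_mul_right _ (hG j).1.totalDegree_le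
    have h1 := MvPolynomial.sum_eval_eq_zero (∏ j, G j ^ p ^ (j : ℕ)) (by
      refine lt_of_le_of_lt h0 ?_
      rw [hq]
      have h3 : 1 < p ^ t := Nat.one_lt_pow (NeZero.ne t) hp.out.one_lt
      refine Nat.mul_lt_mul_of_pos_left ?_ (by omega)
      have := hs 0
      simp
      omega)
    rw [← h1]
    refine Finset.sum_congr (by congr) fun v _ => ?_
    simp [Phi, map_prod]
  | zero => simp
  | add x y _ _ hx hy => simp [Finset.sum_add_distrib, hx, hy]
  | smul a x _ hx => simp [← Finset.mul_sum, hx]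

theorem Yf_const [hp : Fact p.Prime] [CharP K p] (hq : Fintype.card K = p ^ t) (hm : 1 ≤ m)
    {F : (Sg m → K) → K} (hF : F ∈ Yf K p t m) (c : K) (hc : ∀ v, v ≠ 0 → F v = c) : c = 0 := by
  have h1 := Yf_sum hq hm hF
  rw [← Finset.add_sum_erase _ _ (Finset.mem_univ (0 : Sg m → K)), Yf_zero hF, zero_add,
    Finset.sum_congr rfl (g := fun _ => c) (fun v hv => hc v (Finset.ne_of_mem_erase hv)),
    Finset.sum_const, Finset.card_erase_of_mem (Finset.mem_univ _), nsmul_eq_mul, Finset.card_univ,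
    Nat.cast_sub Fintype.card_pos, Fintype.card_fun, hq] at h1
  have h2 : ((p ^ t) ^ Fintype.card (Sg m) : ℕ) = (0 : K) := by
    push_cast
    rw [CharP.cast_eq_zero K p, zero_pow (NeZero.ne t), zero_pow]
    simp; omega
  rw [h2] at h1
  simpa using h1

theorem Yf_scale [hp : Fact p.Prime] (hK : ∀ x : K, x ^ p ^ t = x) {F : (Sg m → K) → K}
    (hF : F ∈ Yf K p t m) {c : K} (hc : c ≠ 0) (v : Sg m → K) : F (c • v) = F v := by
  unfold Yf at hF
  induction hF using Submodule.span_induction with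
  | mem x hx =>
    obtain ⟨s, hs, G, hG, rfl⟩ := hx
    exact Phi_scale hK hs G (fun j => (hG j).1) hc v
  | zero => rfl
  | add x y _ _ hx hy => rw [Pi.add_apply, hx, hy, Pi.add_apply]
  | smul a x _ hx => rw [Pi.smul_apply, hx, Pi.smul_apply]

end zsum
end SP

namespace SP
open MvPolynomial

section dig
variable {p t m : ℕ} [hp : Fact p.Prime]

def Ev (p t m : ℕ) [Fact p.Prime] : SympV p t m ≃ₗ[GaloisField p t] (Sg m → GaloisField p t) :=
  (LinearEquiv.sumArrowLequivProdArrow (Fin m) (Fin m) (GaloisField p t) (GaloisField p t)).symm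

@[simp] theorem Ev_inl (v : SympV p t m) (i : Fin m) : Ev p t m v (Sum.inl i) = v.1 i := rfl
@[simp] theorem Ev_inr (v : SympV p t m) (i : Fin m) : Ev p t m v (Sum.inr i) = v.2 i := rfl

theorem sform_om (v w : SympV p t m) : sform v w = om (Ev p t m v) (Ev p t m w) := rfl

def ed (α β : Fin m → ℕ) : Sg m →₀ ℕ := Finsupp.equivFunOnFinite.symm (Sum.elim α β)

@[simp] theorem ed_inl (α β : Fin m → ℕ) (i : Fin m) : ed α β (Sum.inl i) = α i := rfl
@[simp] theorem ed_inr (α β : Fin m → ℕ) (i : Fin m) : ed α β (Sum.inr i) = β i := rfl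

theorem ed_eta (e : Sg m →₀ ℕ) : ed (fun i => e (Sum.inl i)) (fun i => e (Sum.inr i)) = e := by
  ext z; rcases z with i | i <;> rfl

theorem ed_degree (α β : Fin m → ℕ) : (ed α β).degree = (∑ i, α i) + ∑ i, β i := by
  rw [deg_two, Finset.sum_add_distrib]; rfl

theorem ed_Rd {α β : Fin m → ℕ} (hα : ∀ i, α i ≤ p - 1) (hβ : ∀ i, β i ≤ p - 1) : Rd p (ed α β) := by
  intro z; rcases z with i | i
  · exact hα i
  · exact hβ i

theorem bar_ed (α β : Fin m → ℕ) : bar p (ed α β) = ed (abar p β) (abar p α) := by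
  ext z; rcases z with i | i <;> rfl

theorem sgn_ed (α β : Fin m → ℕ) : sgn (GaloisField p t) (ed α β) =
    (-1) ^ ((∑ i, β i) + m) * factk p t α * factk p t β := by
  rw [sgn, Fintype.prod_sum_type, mul_assoc]; rfl

theorem eval_ed (α β : Fin m → ℕ) (c : GaloisField p t) (v : SympV p t m) :
    eval (Ev p t m v) (monomial (ed α β) c) = c * mono α β v := by
  rw [eval_monomial, Finsupp.prod_fintype _ _ (fun _ => pow_zero _), Fintype.prod_sum_type, mono,
    Finset.prod_mul_distrib]
  rfl

theorem sgn_self (hodd : Odd p) (α : Fin m → ℕ) (hα : ∀ i, α i ≤ p - 1) :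
    sgn (GaloisField p t) (ed α (abar p α)) = 1 := by
  have hw : ∏ i, (((α i).factorial : GaloisField p t) * ((abar p α i).factorial : GaloisField p t)) =
      ∏ i, (-1) ^ (α i + 1) := Finset.prod_congr rfl (fun i _ => fact_wilson p (α i) (hα i))
  rw [sgn_ed, factk, factk, mul_assoc, ← Finset.prod_mul_distrib, hw, Finset.prod_pow_eq_pow_sum, ← pow_add]
  apply Even.neg_one_pow
  have : (∑ i, abar p α i) + m + ∑ i, (α i + 1) = m * (p - 1) + 2 * m := by
    have h1 : ∑ i : Fin m, (abar p α i + α i) = m * (p - 1) := by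
      rw [Finset.sum_congr rfl (g := fun _ => p - 1)
        (fun i _ => by have := hα i; simp only [abar]; omega)]
      simp
    rw [Finset.sum_add_distrib] at h1
    have h2 : ∑ i : Fin m, 1 = m := by simp
    rw [Finset.sum_add_distrib, h2]
    omega
  rw [this]
  have hev : Even (p - 1) := hodd.tsub_odd odd_one
  exact (hev.mul_left _).add (even_two_mul _)

theorem bar_self (α : Fin m → ℕ) (hα : ∀ i, α i ≤ p - 1) :
    bar p (ed α (abar p α)) = ed α (abar p α) := by
  rw [bar_ed]
  congr 1
  funext i
  have := hα i
  simp only [abar]; omega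

theorem bar_degree_half {e : Sg m →₀ ℕ} (he : Rd p e) (h : e.degree = m * (p - 1)) :
    (bar p e).degree = m * (p - 1) := by
  have := degree_bar he
  rw [h, mul_assoc] at this
  omega

theorem digit_Ad [NeZero t] (hodd : Odd p) {s : Fin t → ℕ} {j : Fin t} {pl : Prop}
    (hz : ZZ m s j → pl) {g : SympV p t m → GaloisField p t}
    (hg : IsDigit p t m (lam p s j) pl g) :
    ∃ f ∈ Ad (GaloisField p t) p m s j, g = fun v => eval (Ev p t m v) f := by
  rcases hg with ⟨h1, h2, α, β, hα, hβ, hd, rfl⟩ | ⟨h1, h2, α, hα, rfl⟩ | ⟨h1, α, β, hα, hβ, hd, hne, rfl⟩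
  · refine ⟨monomial (ed α β) 1, ⟨isHomogeneous_monomial _ (by rw [ed_degree, hd]), fun h => ?_⟩, ?_⟩
    · exact absurd (ZZ_lam h) h1
    · funext v; rw [eval_ed, one_mul]
  · refine ⟨monomial (ed α (abar p α)) 1, ⟨isHomogeneous_monomial _ ?_, fun h => ?_⟩, ?_⟩
    · rw [ed_degree, h1, ← Finset.sum_add_distrib, Finset.sum_congr rfl (g := fun _ => p - 1)]
      · simp
      · intro i _
        have := hα i
        simp only [abar]; omega
    · rw [tau_monomial, if_pos (ed_Rd hα (show ∀ i, abar p α i ≤ p - 1 from fun i => Nat.sub_le _ _)), bar_self α hα, sgn_self hodd α hα]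
      simp
    · funext v; rw [eval_ed, one_mul]
  · have hR := ed_Rd hα hβ
    have hdeg : (ed α β).degree = m * (p - 1) := by rw [ed_degree, hd]
    refine ⟨monomial (ed α β) 1 + monomial (bar p (ed α β))
      ((if pl then 1 else -1) * sgn (GaloisField p t) (ed α β)), ⟨?_, fun h => ?_⟩, ?_⟩
    · rw [h1]
      exact (isHomogeneous_monomial _ hdeg).add (isHomogeneous_monomial _ (bar_degree_half hR hdeg))
    · rw [if_pos (hz h), one_mul]
      have := (Sd_mem_Ad (K := GaloisField p t) hodd (s := s) (j := j)
        (isHomogeneous_monomial (1 : GaloisField p t) (hdeg.trans h1.symm))).2 h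
      rw [Sd_pos h, tau_monomial, if_pos hR, one_mul] at this
      exact this
    · funext v
      rw [map_add, eval_ed, one_mul, bar_ed, eval_ed, sgn_ed]
      simp only [Pi.add_apply, Pi.smul_apply, smul_eq_mul]

/-- the digits allowed at position `j` -/
def Dg (p t m : ℕ) [Fact p.Prime] [NeZero t] (s : Fin t → ℕ) (j : Fin t) :
    Set (MvPolynomial (Sg m) (GaloisField p t)) :=
  {f | ∃ pl : Prop, (ZZ m s j → pl) ∧ IsDigit p t m (lam p s j) pl (fun v => eval (Ev p t m v) f)}

theorem Sd_span [NeZero t] (hodd : Odd p) {s : Fin t → ℕ} {j : Fin t} {e : Sg m →₀ ℕ} (hR : Rd p e)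
    (hd : e.degree = lam p s j) :
    Sd (GaloisField p t) p m s j (monomial e 1) ∈ Submodule.span (GaloisField p t) (Dg p t m s j) := by
  obtain ⟨α, β, rfl⟩ : ∃ α β, e = ed α β := ⟨_, _, (ed_eta e).symm⟩
  have hα : ∀ i, α i ≤ p - 1 := fun i => hR (Sum.inl i)
  have hβ : ∀ i, β i ≤ p - 1 := fun i => hR (Sum.inr i)
  have h2 : (2 : GaloisField p t) ≠ 0 := two_ne hodd
  rw [ed_degree] at hd
  by_cases hl : lam p s j = m * (p - 1)
  · by_cases hb : β = abar p α
    · subst hb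
      have hmem : monomial (ed α (abar p α)) (1 : GaloisField p t) ∈ Dg p t m s j := by
        refine ⟨True, fun _ => trivial, Or.inr (Or.inl ⟨hl, trivial, α, hα, ?_⟩)⟩
        funext v; rw [eval_ed, one_mul]
      by_cases hz : ZZ m s j
      · rw [Sd_pos hz, tau_monomial, if_pos hR, bar_self α hα, sgn_self hodd α hα, one_mul]
        exact Submodule.add_mem _ (Submodule.subset_span hmem) (Submodule.subset_span hmem)
      · rw [Sd_neg hz]
        exact Submodule.subset_span hmem
    · have hbin : ∀ pl : Prop, (ZZ m s j → pl) → monomial (ed α β) 1 + monomial (bar p (ed α β))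
          ((if pl then 1 else -1) * sgn (GaloisField p t) (ed α β)) ∈ Dg p t m s j := by
        intro pl hpl
        refine ⟨pl, hpl, Or.inr (Or.inr ⟨hl, α, β, hα, hβ, by rw [hd, hl], hb, ?_⟩)⟩
        funext v
        rw [map_add, eval_ed, one_mul, bar_ed, eval_ed, sgn_ed]
        simp only [Pi.add_apply, Pi.smul_apply, smul_eq_mul]
      by_cases hz : ZZ m s j
      · have := hbin True (fun _ => trivial)
        rw [if_pos trivial, one_mul] at this
        rw [Sd_pos hz, tau_monomial, if_pos hR, one_mul]
        exact Submodule.subset_span this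
      · have h3 := hbin True (fun _ => trivial)
        have h4 := hbin False (fun h => hz h)
        rw [if_pos trivial, one_mul] at h3
        rw [if_neg not_false, neg_one_mul, map_neg] at h4
        rw [Sd_neg hz]
        have := Submodule.smul_mem _ (2 : GaloisField p t)⁻¹
          (Submodule.add_mem _ (Submodule.subset_span h3) (Submodule.subset_span h4))
        convert this using 1
        rw [eq_inv_smul_iff₀ h2, two_smul]
        ring
  · have hz : ¬ ZZ m s j := fun h => hl (ZZ_lam h)
    rw [Sd_neg hz]
    refine Submodule.subset_span ⟨False, fun h => hz h, Or.inl ⟨hl, not_false, α, β, hα, hβ, hd, ?_⟩⟩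
    funext v; rw [eval_ed, one_mul]

end dig
end SP

namespace SP
open MvPolynomial

section fin
variable {p t m : ℕ} [hp : Fact p.Prime] [NeZero t]

theorem gf_pow (x : GaloisField p t) : x ^ p ^ t = x := by
  letI : Fintype (GaloisField p t) := Fintype.ofFinite _
  have hq : Fintype.card (GaloisField p t) = p ^ t := by
    rw [← Nat.card_eq_fintype_card, GaloisField.card p t (NeZero.ne t)]
  rw [← hq]
  exact FiniteField.pow_card x

/-- pull back along `Ev` -/
def Tp (p t m : ℕ) [Fact p.Prime] : ((Sg m → GaloisField p t) → GaloisField p t) →ₗ[GaloisField p t]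
    (SympV p t m → GaloisField p t) where
  toFun F := fun v => F (Ev p t m v)
  map_add' _ _ := rfl
  map_smul' _ _ := rfl

def Bset (p t m : ℕ) [Fact p.Prime] [NeZero t] : Set (SympV p t m → GaloisField p t) :=
  {f | ∃ (s' : Fin t → ℤ) (eps' : Finset (Fin t)), memS p t m s' eps' ∧
    leSd p t m 0 s' eps' (fun _ => (m : ℤ)) Finset.univ ∧ IsSBF p t m (lamOfN p t 0 s') eps' f}

theorem lamOf_cast {s : Fin t → ℕ} (hs : Valid p m s) (j : Fin t) :
    lamOf p t 0 (fun i => (s i : ℤ)) j = lam p s j := by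
  rw [lamOf, lam, digitp, Nat.cast_sub (hs j).2.2]
  simp

theorem m_cast (hp1 : 1 ≤ p) : ((m * (p - 1) : ℕ) : ℤ) = m * ((p : ℤ) - 1) := by
  push_cast [Nat.cast_sub hp1]; rfl

theorem Bset_sub (hodd : Odd p) : ∀ f ∈ Bset p t m, ∃ F ∈ Yf (GaloisField p t) p t m, f = Tp p t m F := by
  rintro f ⟨s', eps', ⟨⟨h1, h2⟩, h3⟩, ⟨h4, h5⟩, g, hg, rfl⟩
  have hp1 := hp.out.one_lt
  obtain ⟨s, rfl⟩ : ∃ s : Fin t → ℕ, s' = fun i => (s i : ℤ) :=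
    ⟨fun i => (s' i).toNat, by funext i; have := (h1 i).1; simp; omega⟩
  have hs : Valid p m s := by
    intro j
    refine ⟨Int.ofNat_le.1 (h1 j).1, Int.ofNat_le.1 (h4 j), ?_⟩
    have := (h2 j).1
    rw [lamOf, digitp] at this
    simp at this
    exact_mod_cast this
  have hlam : ∀ j, lamOfN p t 0 (fun i => (s i : ℤ)) j = lam p s j := by
    intro j; rw [lamOfN, lamOf_cast hs]; simp
  have hz : ∀ j, ZZ m s j → j ∈ eps' := by
    intro j hj
    have : j ∈ Finset.univ ∩ Zset p t m 0 (fun i => (s i : ℤ)) (fun _ => (m : ℤ)) := by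
      simp only [Finset.univ_inter, Zset, Finset.mem_filter, Finset.mem_univ, true_and]
      refine ⟨by exact_mod_cast hj.1, by exact_mod_cast hj.2, ?_⟩
      rw [lamOf_cast hs, ZZ_lam hj, m_cast hp1.le]
    rw [h5] at this
    exact (Finset.mem_inter.1 this).1
  have : ∀ j, ∃ f ∈ Ad (GaloisField p t) p m s j, g j = fun v => eval (Ev p t m v) f := by
    intro j
    have := hg j
    rw [hlam] at this
    exact digit_Ad hodd (hz j) this
  choose G hG hg2 using this
  refine ⟨Phi p G, Submodule.subset_span ⟨s, hs, G, hG, rfl⟩, ?_⟩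
  funext v
  simp [Tp, Phi, hg2]

theorem digits_mem {s : Fin t → ℕ} (hs : Valid p m s) (G : Fin t → MvPolynomial (Sg m) (GaloisField p t))
    (hG : ∀ j, G j ∈ Dg p t m s j) : Tp p t m (Phi p G) ∈ Bset p t m := by
  have hp1 := hp.out.two_le
  choose pl hpl hd using hG
  have hlam : ∀ j, lamOfN p t 0 (fun i => (s i : ℤ)) j = lam p s j := by
    intro j; rw [lamOfN, lamOf_cast hs]; simp
  refine ⟨fun i => (s i : ℤ), Finset.univ.filter pl, ⟨⟨fun j => ?_, fun j => ?_⟩, ?_⟩, ⟨fun j => ?_, ?_⟩,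
    fun j v => eval (Ev p t m v) (G j), fun j => ?_, rfl⟩
  · have h := hs j
    constructor
    · exact Int.ofNat_le.2 h.1
    · have h1 := h.1
      have h2 := h.2.1
      change (s j : ℤ) ≤ 2 * m - 1
      omega
  · rw [lamOf_cast hs]
    refine ⟨by positivity, ?_⟩
    have h1 : lam p s j ≤ p * m - 1 := by
      have h2 := hs j
      have h3 := Nat.mul_le_mul_left p (hs (j + 1)).2.1
      rw [lam]; omega
    have h3 : p * m ≤ 2 * m * (p - 1) := by
      obtain ⟨q, rfl⟩ : ∃ q, p = q + 2 := ⟨p - 2, by omega⟩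
      simp only [show q + 2 - 1 = q + 1 by omega]
      nlinarith
    have h4 : lam p s j ≤ 2 * m * (p - 1) := by omega
    have h5 : ((2 * m * (p - 1) : ℕ) : ℤ) = 2 * m * ((p : ℤ) - 1) := by
      push_cast [Nat.cast_sub (show 1 ≤ p by omega)]; rfl
    rw [← h5]
    exact_mod_cast h4
  · intro j hj
    have hj : pl j := by simpa using hj
    simp only [Jset, Finset.mem_filter, Finset.mem_univ, true_and]
    rw [lamOf_cast hs, ← m_cast (by omega)]
    rcases hd j with ⟨_, h, _⟩ | ⟨h, _⟩ | ⟨h, _⟩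
    · exact absurd hj h
    · rw [h]
    · rw [h]
  · exact Int.ofNat_le.2 (hs j).2.1
  · ext j
    simp only [Finset.univ_inter, Finset.mem_inter, Finset.mem_filter, Finset.mem_univ, true_and]
    refine ⟨fun h => ⟨?_, h⟩, fun h => h.2⟩
    simp only [Zset, Finset.mem_filter, Finset.mem_univ, true_and] at h
    exact hpl j ⟨by exact_mod_cast h.1, by exact_mod_cast h.2.1⟩
  · rw [hlam]
    simpa using hd j

theorem ML0 {K : Type*} [Field K] [CharP K p] (N : Submodule K ((Sg m → K) → K))
    (B : Fin t → Set (MvPolynomial (Sg m) K))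
    (hB : ∀ G : Fin t → MvPolynomial (Sg m) K, (∀ j, G j ∈ B j) → Phi p G ∈ N)
    (G : Fin t → MvPolynomial (Sg m) K) (hG : ∀ j, G j ∈ Submodule.span K (B j)) : Phi p G ∈ N := by
  have key : ∀ S : Finset (Fin t), ∀ G : Fin t → MvPolynomial (Sg m) K,
      (∀ j, G j ∈ Submodule.span K (B j)) → (∀ j ∉ S, G j ∈ B j) → Phi p G ∈ N := by
    intro S
    induction S using Finset.induction_on with
    | empty => exact fun G _ h => hB G (fun j => h j (by simp))
    | insert j S hj ih =>
      intro G hG h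
      have h1 : Submodule.span K (B j) ≤ comapD N p G j := by
        rw [Submodule.span_le]
        intro b hb
        refine ih _ (fun i => ?_) (fun i hi => ?_)
        · by_cases hij : i = j
          · subst hij; simpa using Submodule.subset_span hb
          · rw [Function.update_of_ne hij]; exact hG i
        · by_cases hij : i = j
          · subst hij; simpa using hb
          · rw [Function.update_of_ne hij]; exact h i (by simp [hij, hi])
      have h3 := h1 (hG j)
      rw [mem_comapD, Function.update_eq_self] at h3
      exact h3
  exact key Finset.univ G hG (by simp)

theorem Psi_mem (hodd : Odd p) {s : Fin t → ℕ} (hs : Valid p m s) {e : Fin t → Sg m →₀ ℕ}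
    (he : Adm p s e) : Psi (GaloisField p t) p s e ∈
      (Submodule.span (GaloisField p t) (Bset p t m)).comap (Tp p t m) :=
  ML0 ((Submodule.span (GaloisField p t) (Bset p t m)).comap (Tp p t m)) (fun j => Dg p t m s j) (fun G hG => Submodule.subset_span (digits_mem hs G hG)) _
    (fun j => Sd_span hodd (he j).1 (he j).2)

theorem Yf_le_B (hodd : Odd p) : Yf (GaloisField p t) p t m ≤
    (Submodule.span (GaloisField p t) (Bset p t m)).comap (Tp p t m) := by
  have key : ∀ N, ∀ s : Fin t → ℕ, ∑ j, s j = N → Valid p m s →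
      ∀ G : Fin t → MvPolynomial (Sg m) (GaloisField p t),
      (∀ j, G j ∈ Ad (GaloisField p t) p m s j) → Phi p G ∈
        (Submodule.span (GaloisField p t) (Bset p t m)).comap (Tp p t m) := by
    intro N
    induction N using Nat.strong_induction_on with
    | _ N ih =>
      intro s hN hs G hG
      refine reduce hodd gf_pow hs _ ?_ (fun e he => Psi_mem hodd hs he) G hG
      rw [Yl, Submodule.span_le]
      rintro F ⟨s', h1, h2, h3, G, hG, rfl⟩
      refine ih _ ?_ s' rfl h1 G hG
      rw [← hN]
      obtain ⟨j, hj⟩ := Function.ne_iff.1 h3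
      exact Finset.sum_lt_sum (fun j _ => h2 j) ⟨j, Finset.mem_univ _, lt_of_le_of_ne (h2 j) hj⟩
  rw [Yf, Submodule.span_le]
  rintro F ⟨s, hs, G, hG, rfl⟩
  exact key _ s rfl hs G hG

theorem span_B (hodd : Odd p) : Submodule.span (GaloisField p t) (Bset p t m) =
    (Yf (GaloisField p t) p t m).map (Tp p t m) := by
  apply le_antisymm
  · rw [Submodule.span_le]
    intro f hf
    obtain ⟨F, hF, rfl⟩ := Bset_sub hodd f hf
    exact ⟨F, hF, rfl⟩
  · rw [Submodule.map_le_iff_le_comap]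
    exact Yf_le_B hodd

theorem rep_ex (Z : Pts p t m) : ∃ v : SympV p t m, v ≠ 0 ∧ Z.val = Submodule.span (GaloisField p t) {v} := by
  obtain ⟨v, hv⟩ := finrank_eq_one_iff'.1 Z.2
  refine ⟨v.1, fun h => hv.1 (Subtype.ext h), le_antisymm (fun w hw => ?_) ?_⟩
  · obtain ⟨c, hc⟩ := hv.2 ⟨w, hw⟩
    rw [Submodule.mem_span_singleton]
    exact ⟨c, congrArg Subtype.val hc⟩
  · rw [Submodule.span_singleton_le_iff_mem]
    exact v.2

def rep (Z : Pts p t m) : SympV p t m := (rep_ex Z).choose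

theorem rep_ne (Z : Pts p t m) : rep Z ≠ 0 := (rep_ex Z).choose_spec.1
theorem rep_span (Z : Pts p t m) : Z.val = Submodule.span (GaloisField p t) {rep Z} := (rep_ex Z).choose_spec.2

def Rp (p t m : ℕ) [Fact p.Prime] [NeZero t] : (SympV p t m → GaloisField p t) →ₗ[GaloisField p t]
    (Pts p t m → GaloisField p t) where
  toFun F := fun Z => F (rep Z)
  map_add' _ _ := rfl
  map_smul' _ _ := rfl

theorem rep_scale (Z : Pts p t m) {v : SympV p t m} (hv : v ∈ Z.val) (h0 : v ≠ 0) :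
    ∃ c : GaloisField p t, c ≠ 0 ∧ v = c • rep Z := by
  rw [rep_span, Submodule.mem_span_singleton] at hv
  obtain ⟨c, rfl⟩ := hv
  exact ⟨c, fun h => h0 (by rw [h, zero_smul]), rfl⟩

theorem Yhat_eq (hodd : Odd p) : YhatSm p t m = ((Yf (GaloisField p t) p t m).map (Tp p t m)).map (Rp p t m) := by
  rw [← span_B hodd, Submodule.map_span, YhatSm]
  congr 1
  ext F
  constructor
  · rintro ⟨s', eps', f, h1, h2, h3, h4⟩
    refine ⟨f, ⟨s', eps', h1, h2, h3⟩, ?_⟩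
    funext Z
    refine (h4 Z (rep Z) ?_ (rep_ne Z)).symm
    conv_lhs => rw [rep_span Z]
    exact Submodule.mem_span_singleton_self _
  · rintro ⟨f, hf, rfl⟩
    obtain ⟨F, hF, h⟩ := Bset_sub hodd f hf
    obtain ⟨s', eps', h1, h2, h3⟩ := hf
    refine ⟨s', eps', f, h1, h2, h3, fun Z v hv h0 => ?_⟩
    obtain ⟨c, hc, rfl⟩ := rep_scale Z hv h0
    letI : Fintype (GaloisField p t) := Fintype.ofFinite _
    subst h
    change F (Ev p t m (rep Z)) = F (Ev p t m (c • rep Z))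
    rw [map_smul, Yf_scale gf_pow hF hc]

theorem chi_span : Submodule.span (GaloisField p t)
        {F | ∃ W : Submodule (GaloisField p t) (SympV p t m),
          IsTotIso W ∧ Module.finrank (GaloisField p t) W = m ∧ F = chi W} =
    ((Mv (GaloisField p t) m).map (Tp p t m)).map (Rp p t m) := by
  rw [Mv, Submodule.map_span, Submodule.map_span]
  congr 1
  have key : ∀ W : Submodule (GaloisField p t) (SympV p t m),
      Rp p t m (Tp p t m (ind (W.map (Ev p t m : SympV p t m →ₗ[GaloisField p t] _)))) = chi W := by
    intro W
    funext Z
    change ind _ (Ev p t m (rep Z)) = chi W Z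
    rw [ind, chi, rep_span Z, Submodule.span_singleton_le_iff_mem]
    congr 1
    rw [eq_iff_iff]
    constructor
    · rintro ⟨v, hv, h⟩
      rwa [← (Ev p t m).injective h]
    · intro h; exact ⟨_, h, rfl⟩
  ext F
  constructor
  · rintro ⟨W, h1, h2, rfl⟩
    refine ⟨_, ⟨_, ⟨W.map (Ev p t m : SympV p t m →ₗ[GaloisField p t] _), ⟨?_, ?_⟩, rfl⟩, rfl⟩, key W⟩
    · rintro _ ⟨u, hu, rfl⟩ _ ⟨w, hw, rfl⟩
      exact h1 u hu w hw
    · rw [LinearEquiv.finrank_map_eq, h2]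
  · rintro ⟨_, ⟨_, ⟨W, ⟨h1, h2⟩, rfl⟩, rfl⟩, rfl⟩
    have hW : W = (W.map ((Ev p t m).symm : _ →ₗ[GaloisField p t] SympV p t m)).map
        (Ev p t m : SympV p t m →ₗ[GaloisField p t] _) := by
      ext x
      constructor
      · intro hx; exact ⟨_, ⟨x, hx, rfl⟩, by simp⟩
      · rintro ⟨_, ⟨y, hy, rfl⟩, rfl⟩
        simpa using hy
    refine ⟨W.map ((Ev p t m).symm : _ →ₗ[GaloisField p t] SympV p t m), ?_, ?_, ?_⟩
    · rintro _ ⟨u, hu, rfl⟩ _ ⟨w, hw, rfl⟩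
      rw [sform_om]
      simpa using h1 u hu w hw
    · rw [LinearEquiv.finrank_map_eq, h2]
    · rw [← key, ← hW]

theorem final (hodd : Odd p) (hm : 2 ≤ m) :
    Submodule.span (GaloisField p t)
        {F | ∃ W : Submodule (GaloisField p t) (SympV p t m),
          IsTotIso W ∧ Module.finrank (GaloisField p t) W = m ∧ F = chi W} =
      Submodule.span (GaloisField p t)
          {(fun _ => 1 : Pts p t m → GaloisField p t)} ⊔ YhatSm p t m
    ∧ Submodule.span (GaloisField p t)
          {(fun _ => 1 : Pts p t m → GaloisField p t)} ⊓ YhatSm p t m = ⊥ := by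
  letI : Fintype (GaloisField p t) := Fintype.ofFinite _
  have hq : Fintype.card (GaloisField p t) = p ^ t := by
    rw [← Nat.card_eq_fintype_card, GaloisField.card p t (NeZero.ne t)]
  have hp3 : 3 ≤ p := by
    have := hp.out.two_le
    rcases hodd with ⟨k, hk⟩
    omega
  constructor
  · rw [chi_span, Yhat_eq hodd, Mv_eq hp3 hodd hq, C1, Submodule.map_sup, Submodule.map_sup]
    congr 1
    rw [Submodule.map_span, Submodule.map_span, Set.image_singleton, Set.image_singleton]
    rfl
  · rw [Yhat_eq hodd, eq_bot_iff]
    rintro G ⟨h1, h2⟩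
    obtain ⟨c, rfl⟩ := Submodule.mem_span_singleton.1 h1
    obtain ⟨_, ⟨F, hF, rfl⟩, h⟩ := h2
    have : c = 0 := by
      refine Yf_const hq (by omega) hF c (fun v hv => ?_)
      have hv' : (Ev p t m).symm v ≠ 0 := by simpa using hv
      let Z : Pts p t m := ⟨Submodule.span (GaloisField p t) {(Ev p t m).symm v}, finrank_span_singleton hv'⟩
      obtain ⟨d, hd, he⟩ := rep_scale Z (Submodule.mem_span_singleton_self _) hv'
      have h3 : F (Ev p t m (rep Z)) = c := by
        have := congrFun h Z
        rw [Pi.smul_apply, smul_eq_mul, mul_one] at this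
        exact this
      rw [← h3, ← Yf_scale gf_pow hF hd (Ev p t m (rep Z)), ← map_smul, ← he]
      simp
    rw [this, zero_smul]
    exact Submodule.zero_mem _

end fin
end SP

/-- Theorem: the span in `k[P]` of the characteristic functions of the totally
isotropic `m`-dimensional subspaces of `V` is the internal direct sum of the constant
functions `k·1` and `Ŷ(s_m,ε_m)`. -/
theorem im_eta_m (p t m : ℕ) [Fact p.Prime] [NeZero t]
    (hodd : Odd p) (ht : 1 ≤ t) (hm : 2 ≤ m) :
    Submodule.span (GaloisField p t)
        {F | ∃ W : Submodule (GaloisField p t) (SympV p t m),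
          IsTotIso W ∧ Module.finrank (GaloisField p t) W = m ∧ F = chi W} =
      Submodule.span (GaloisField p t)
          {(fun _ => 1 : Pts p t m → GaloisField p t)} ⊔ YhatSm p t m
    ∧ Submodule.span (GaloisField p t)
          {(fun _ => 1 : Pts p t m → GaloisField p t)} ⊓ YhatSm p t m = ⊥ :=
  SP.final hodd hm

end
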